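/- Let P = A ∪ B be an ℓ-divided set of points in the plane in general position with |A| = 5, |B| = 6, and with A not in convex position. Then there is an ℓ-divided 5-hole in P. -/

import Mathlib

noncomputable section

/-- Points of the plane. -/
abbrev Pt : Type := ℝ × ℝ

/-- The cross product (signed area) of two planar vectors. -/
def cross2 (u v : Pt) : ℝ := u.1 * v.2 - u.2 * v.1

/-- The dot product of two planar vectors. -/
def dotp (v p : Pt) : ℝ := v.1 * p.1 + v.2 * p.2

/-- A set of points in the plane is in general position if no three of its points
are collinear. -/
def GenPos (P : Set Pt) : Prop :=
  ∀ p ∈ P, ∀ q ∈ P, ∀ r ∈ P, p ≠ q → p ≠ r → q ≠ r →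
    ¬ Collinear ℝ ({p, q, r} : Set Pt)

/-- A set of points is in convex position if no point of the set lies in the convex
hull of the other points. -/
def ConvexPos (S : Set Pt) : Prop :=
  ∀ p ∈ S, p ∉ convexHull ℝ (S \ {p})

/-- `H` is a `k`-hole in `P`: a subset of `P` of size `k` in convex position whose
convex hull contains no point of `P \ H`. -/
def IsKHole (k : ℕ) (P H : Finset Pt) : Prop :=
  H ⊆ P ∧ H.card = k ∧ ConvexPos (↑H : Set Pt) ∧
    ∀ p ∈ P, p ∉ H → p ∉ convexHull ℝ (↑H : Set Pt)

/-- The number of `k`-holes in `P`. -/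
def numKHoles (k : ℕ) (P : Finset Pt) : ℕ :=
  Set.ncard {H : Finset Pt | IsKHole k P H}

/-- For an `ℓ`-divided set `P = A ∪ B`, an `ℓ`-divided 5-hole is a 5-hole in `A ∪ B`
containing points of both `A` and `B`. -/
def DividedFiveHole (A B H : Finset Pt) : Prop :=
  IsKHole 5 (A ∪ B) H ∧ (↑H ∩ ↑A : Set Pt).Nonempty ∧ (↑H ∩ ↑B : Set Pt).Nonempty

/-- `x` is an extremal point of `P`: it lies on the boundary of the convex hull of `P`. -/
def OnHullBoundary (P : Finset Pt) (x : Pt) : Prop :=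
  x ∈ frontier (convexHull ℝ (↑P : Set Pt))

/-- An `ℓ`-divided set `C = A ∪ B` is `ℓ`-critical if neither part is in convex position
and, for every extremal point `x` of `C`, one of the sets `(C \ {x}) ∩ A` and
`(C \ {x}) ∩ B` is in convex position. -/
def LCritical (A B : Finset Pt) : Prop :=
  ¬ ConvexPos (↑A : Set Pt) ∧ ¬ ConvexPos (↑B : Set Pt) ∧
    ∀ x ∈ A ∪ B, OnHullBoundary (A ∪ B) x →
      (ConvexPos (↑(A.erase x) : Set Pt) ∨ ConvexPos (↑(B.erase x) : Set Pt))

/-- The closed wedge with apex `a` swept clockwise from the ray `a→p` to the ray `a→q`.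
If the clockwise angle from `a→p` to `a→q` is at most `π` the wedge is convex, otherwise
it is the corresponding reflex region. -/
def Wedge (a p q : Pt) : Set Pt :=
  if cross2 (p - a) (q - a) ≤ 0 then
    {x | cross2 (p - a) (x - a) ≤ 0 ∧ 0 ≤ cross2 (q - a) (x - a)}
  else
    {x | cross2 (p - a) (x - a) ≤ 0 ∨ 0 ≤ cross2 (q - a) (x - a)}

/-- `W` is an `a`-wedge of `A`: one of the closed regions into which the rays from `a`
through the other points of `A` partition the plane, i.e. a wedge spanned by two
points of `A \ {a}` that are angularly consecutive around `a` (no other point of `A`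
lies in the wedge). -/
def IsAWedge (A : Finset Pt) (a : Pt) (W : Set Pt) : Prop :=
  ∃ p ∈ A.erase a, ∃ q ∈ A.erase a, p ≠ q ∧ W = Wedge a p q ∧
    (↑A : Set Pt) ∩ Wedge a p q ⊆ {a, p, q}

/-- The combinatorial data of the `a*`-wedges of an `ℓ`-divided set `P = A ∪ B`, where
`ℓ` is the vertical line `x = x0` and `A` lies to its left: `aStar` is the rightmost
interior point `a*` of `A`; `lbl` is the clockwise cyclic labeling `a_0, a_1, …` of
`A \ {a*}` (period `|A| - 1`), so that the `k`-th wedge `W_k` is swept clockwise from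
the ray through `lbl (k-1)` to the ray through `lbl k` and contains no other point
of `A`; the wedges `W_1, …, W_t` are exactly those meeting `ℓ`, in top-to-bottom
order along `ℓ`. -/
structure StarSetup (x0 : ℝ) (A : Finset Pt) where
  aStar : Pt
  lbl : ℕ → Pt
  t : ℕ
  aStar_mem : aStar ∈ A
  aStar_interior : aStar ∈ interior (convexHull ℝ (↑A : Set Pt))
  aStar_rightmost : ∀ p ∈ A, p ∈ interior (convexHull ℝ (↑A : Set Pt)) → p.1 ≤ aStar.1
  lbl_mem : ∀ k, lbl k ∈ A.erase aStar
  lbl_periodic : ∀ k, lbl (k + (A.card - 1)) = lbl k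
  lbl_bij : ∀ p ∈ A.erase aStar, ∃! k, k ∈ Finset.Icc 1 (A.card - 1) ∧ lbl k = p
  consec : ∀ k ∈ Finset.Icc 1 (A.card - 1),
    (↑A : Set Pt) ∩ Wedge aStar (lbl (k - 1)) (lbl k) ⊆ {aStar, lbl (k - 1), lbl k}
  t_pos : 1 ≤ t
  t_le : t ≤ A.card - 1
  inter_iff : ∀ k ∈ Finset.Icc 1 (A.card - 1),
    ((Wedge aStar (lbl (k - 1)) (lbl k)) ∩ {p : Pt | p.1 = x0}).Nonempty ↔ k ≤ t
  ordered : ∀ k ∈ Finset.Icc 1 t, ∀ k' ∈ Finset.Icc 1 t, k < k' →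
    ∀ p ∈ (Wedge aStar (lbl (k - 1)) (lbl k)) ∩ {q : Pt | q.1 = x0},
    ∀ p' ∈ (Wedge aStar (lbl (k' - 1)) (lbl k')) ∩ {q : Pt | q.1 = x0},
      p'.2 ≤ p.2

/-- The `k`-th `a*`-wedge `W_k`. -/
def StarSetup.W {x0 : ℝ} {A : Finset Pt} (S : StarSetup x0 A) (k : ℕ) : Set Pt :=
  Wedge S.aStar (S.lbl (k - 1)) (S.lbl k)

/-- `w_k`, the number of points of `B` in the `k`-th `a*`-wedge. -/
def StarSetup.w {x0 : ℝ} {A : Finset Pt} (S : StarSetup x0 A) (B : Finset Pt) (k : ℕ) : ℕ :=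
  Set.ncard ((↑B : Set Pt) ∩ S.W k)


/-! ## A small resolution checker

Clauses are natural numbers: bit `i < K` is the positive literal of variable `i`, and bit
`K + i` is its negative literal. -/

namespace FiveHole

/-- Evaluate a natural number before passing it on (this only matters for the speed of
kernel reduction). -/
def force {α : Type} (n : ℕ) (f : ℕ → α) : α :=
  Nat.rec (motive := fun _ => α) (f 0) (fun m _ => f (Nat.succ m)) n

theorem force_eq {α : Type} (n : ℕ) (f : ℕ → α) : force n f = f n := by
  cases n <;> rfl

/-- The number of variables. -/
def K : ℕ := 990

/-- The truth value of a literal. -/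
def lv (val : ℕ → Prop) (j : ℕ) : Prop := if j < 990 then val j else ¬ val (j - 990)

/-- A well-formed clause that is satisfied by `val`. -/
def Good (val : ℕ → Prop) (c : ℕ) : Prop :=
  c < 2 ^ 1980 ∧ (∀ i, c.testBit i = true → c.testBit (990 + i) = true → False) ∧
    ∃ j, c.testBit j = true ∧ lv val j

/-- Resolution of two clauses; returns the first one if there are several clashing variables. -/
def resolve (c d : ℕ) : ℕ :=
  (fun u : ℕ => (fun x : ℕ =>
    cond (Nat.beq (Nat.land x (Nat.pred x)) 0)
      (Nat.xor (Nat.xor u x) (Nat.shiftLeft x 990)) c)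
    (Nat.land u (Nat.shiftRight u 990))) (Nat.lor c d)

theorem pow_two_of_land {x i : ℕ} (h : x &&& (x - 1) = 0) (hi : x.testBit i = true) :
    x = 2 ^ i := by
  have hx : x ≠ 0 := by
    rintro rfl
    simp at hi
  have h1 : x.testBit x.log2 = true := Nat.testBit_log2 hx
  have hle : 2 ^ x.log2 ≤ x := Nat.log2_self_le hx
  have hlt : x < 2 ^ (x.log2 + 1) := Nat.lt_log2_self
  have hx2 : x = 2 ^ x.log2 := by
    by_contra hne
    have hlt2 : 2 ^ x.log2 ≤ x - 1 := by omega
    have : (x - 1).testBit x.log2 = true :=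
      Nat.testBit_of_two_pow_le_and_two_pow_add_one_gt hlt2 (by omega)
    have h3 : (x &&& (x - 1)).testBit x.log2 = true := by
      rw [Nat.testBit_and, h1, this]; rfl
    rw [h] at h3
    simp at h3
  rw [hx2, Nat.testBit_two_pow] at hi
  have : x.log2 = i := by simpa using hi
  rw [← this]; exact hx2

theorem resolve_good {val : ℕ → Prop} {c d : ℕ} (hc : Good val c) (hd : Good val d) :
    Good val (resolve c d) := by
  unfold resolve
  simp only []
  set u := Nat.lor c d with hu
  set x := Nat.land u (Nat.shiftRight u 990) with hx
  have hub : ∀ i, u.testBit i = (c.testBit i || d.testBit i) := fun i => Nat.testBit_or c d i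
  have hxb : ∀ i, x.testBit i = (u.testBit i && u.testBit (990 + i)) := fun i => by
    have : x.testBit i = (u.testBit i && (u >>> 990).testBit i) := Nat.testBit_and u _ i
    rw [this, Nat.testBit_shiftRight]
  have hult : u < 2 ^ 1980 := Nat.or_lt_two_pow hc.1 hd.1
  have huz : ∀ i, 1980 ≤ i → u.testBit i = false := fun i hi =>
    Nat.testBit_lt_two_pow (lt_of_lt_of_le hult (Nat.pow_le_pow_right (by norm_num) hi))
  cases hcase : Nat.beq (Nat.land x (Nat.pred x)) 0 with
  | false => exact hc
  | true =>
    have hz : x &&& (x - 1) = 0 := Nat.eq_of_beq_eq_true hcase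
    simp only [cond_true]
    set r := Nat.xor (Nat.xor u x) (Nat.shiftLeft x 990) with hr
    have hrb : ∀ i, r.testBit i =
        ((u.testBit i ^^ x.testBit i) ^^ (decide (990 ≤ i) && x.testBit (i - 990))) := fun i => by
      have h1 : r.testBit i = ((Nat.xor u x).testBit i ^^ (x <<< 990).testBit i) :=
        Nat.testBit_xor _ _ i
      have h2 : (Nat.xor u x).testBit i = (u.testBit i ^^ x.testBit i) := Nat.testBit_xor u x i
      rw [h1, h2, Nat.testBit_shiftLeft]
    have hxlt : ∀ i, x.testBit i = true → i < 990 := fun i hi => by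
      by_contra hge
      rw [hxb, huz (990 + i) (by omega)] at hi
      simp at hi
    have hxge : ∀ i, 990 ≤ i → x.testBit i = false := fun i hi => by
      by_contra h
      have := hxlt i (by simpa using h)
      omega
    -- positive and negative parts of the resolvent
    have hlow : ∀ i, i < 990 → r.testBit i = (u.testBit i && !u.testBit (990 + i)) := by
      intro i hi
      rw [hrb, hxb]
      have : decide (990 ≤ i) = false := by simpa using hi
      rw [this]
      cases u.testBit i <;> cases u.testBit (990 + i) <;> rfl
    have hhigh : ∀ i, i < 990 → r.testBit (990 + i) = (u.testBit (990 + i) && !u.testBit i) := by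
      intro i hi
      rw [hrb, hxge (990 + i) (by omega), show 990 + i - 990 = i by omega, hxb]
      have : decide (990 ≤ 990 + i) = true := by simp
      rw [this]
      cases u.testBit i <;> cases u.testBit (990 + i) <;> rfl
    have hbig : ∀ i, 1980 ≤ i → r.testBit i = false := by
      intro i hi
      rw [hrb, huz i hi, hxge i (by omega), hxge (i - 990) (by omega)]
      simp
    refine ⟨Nat.lt_pow_two_of_testBit _ (fun i hi => hbig i hi), ?_, ?_⟩
    · intro i h1 h2
      by_cases hi : i < 990
      · rw [hlow i hi] at h1
        rw [hhigh i hi] at h2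
        revert h1 h2
        cases u.testBit i <;> cases u.testBit (990 + i) <;> simp
      · rw [hbig (990 + i) (by omega)] at h2
        simp at h2
    · -- satisfaction
      -- a literal of `u` survives unless its complement is in `u`
      have surv : ∀ j, u.testBit j = true → lv val j →
          (∀ i, x.testBit i = true → j ≠ i ∧ j ≠ 990 + i) → ∃ j, r.testBit j = true ∧ lv val j := by
        intro j hj hl hne
        refine ⟨j, ?_, hl⟩
        rw [hrb, hj]
        have h1 : x.testBit j = false := by
          by_contra h
          exact (hne j (by simpa using h)).1 rfl
        rw [h1]
        by_cases hj2 : 990 ≤ j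
        · have h2 : x.testBit (j - 990) = false := by
            by_contra h
            exact (hne (j - 990) (by simpa using h)).2 (by omega)
          rw [h2]; simp
        · have : decide (990 ≤ j) = false := by simpa using hj2
          rw [this]; rfl
      by_cases hx0 : ∃ i, x.testBit i = true
      · obtain ⟨i, hi⟩ := hx0
        have hx2 := pow_two_of_land hz hi
        have hi9 := hxlt i hi
        have huniq : ∀ k, x.testBit k = true → k = i := by
          intro k hk
          rw [hx2, Nat.testBit_two_pow] at hk
          simpa using (of_decide_eq_true hk).symm
        -- any clause not containing the true literal of variable `i` gives a survivor
        have key : ∀ e, (∀ k, e.testBit k = true → u.testBit k = true) → Good val e →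
            ((val i → e.testBit i = false) ∧ (¬ val i → e.testBit (990 + i) = false)) →
            ∃ j, r.testBit j = true ∧ lv val j := by
          intro e he hge hno
          obtain ⟨j, hj, hl⟩ := hge.2.2
          refine surv j (he j hj) hl ?_
          intro k hk
          rw [huniq k hk]
          constructor
          · rintro rfl
            have hv : val j := by simpa [lv, hi9] using hl
            rw [hno.1 hv] at hj
            simp at hj
          · rintro rfl
            have hv : ¬ val i := by simpa [lv] using hl
            rw [hno.2 hv] at hj
            simp at hj
        have hcu : ∀ k, c.testBit k = true → u.testBit k = true := fun k hk => by
          rw [hub, hk]; rfl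
        have hdu : ∀ k, d.testBit k = true → u.testBit k = true := fun k hk => by
          rw [hub, hk]; simp
        rw [hxb, hub, hub] at hi
        have hcd := hc.2.1 i
        have hdd := hd.2.1 i
        by_cases hv : val i
        · by_cases h1 : c.testBit i = true
          · refine key d hdu hd ⟨fun _ => ?_, fun h => absurd hv h⟩
            have h2 : c.testBit (990 + i) = false := by
              by_contra h
              exact hcd h1 (by simpa using h)
            rw [h2] at hi
            by_contra h
            have h3 : d.testBit i = true := by simpa using h
            have h4 : d.testBit (990 + i) = true := by simpa using (Bool.and_eq_true_iff.1 hi).2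
            exact hdd h3 h4
          · exact key c hcu hc ⟨fun _ => by simpa using h1, fun h => absurd hv h⟩
        · by_cases h1 : c.testBit (990 + i) = true
          · refine key d hdu hd ⟨fun h => absurd h hv, fun _ => ?_⟩
            have h2 : c.testBit i = false := by
              by_contra h
              exact hcd (by simpa using h) h1
            rw [h2] at hi
            by_contra h
            have h3 : d.testBit (990 + i) = true := by simpa using h
            have h4 : d.testBit i = true := by simpa using (Bool.and_eq_true_iff.1 hi).1
            exact hdd h4 h3
          · exact key c hcu hc ⟨fun h => absurd h hv, fun _ => by simpa using h1⟩
      · push Not at hx0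
        obtain ⟨j, hj, hl⟩ := hc.2.2
        refine surv j (by rw [hub, hj]; rfl) hl ?_
        intro i hi
        exact absurd hi (hx0 i)

/-- Binary tries storing clauses. -/
inductive Tree : Type
  | nil : Tree
  | leaf : ℕ → Tree
  | node : Tree → Tree → Tree

/-- Look up a clause, least significant bit of the key first. The clause `dflt` is returned
for keys that are not present. -/
def Tree.get (dflt : ℕ) (t : Tree) : ℕ → ℕ :=
  Tree.rec (motive := fun _ => ℕ → ℕ) (fun _ => dflt) (fun v _ => v)
    (fun _ _ gl gr k =>
      cond (Nat.beq (Nat.land k 1) 0) (gl (Nat.shiftRight k 1)) (gr (Nat.shiftRight k 1))) t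

/-- Apply a continuation to a tree (a definition of its own, to keep kernel reduction
shallow). -/
def appT (f : Tree → Bool) (t : Tree) : Bool := f t

/-- Insert a clause at depth `n`, in continuation passing style, so that the resulting tree is
always in normal form. -/
def Tree.ins (n : ℕ) : Tree → ℕ → ℕ → (Tree → Bool) → Bool :=
  Nat.rec (motive := fun _ => Tree → ℕ → ℕ → (Tree → Bool) → Bool)
    (fun _ _ v f => appT f (Tree.leaf v))
    (fun _ ih t k v f =>
      Tree.rec (motive := fun _ => Bool)
        (cond (Nat.beq (Nat.land k 1) 0)
          (ih Tree.nil (Nat.shiftRight k 1) v (fun t' => f (Tree.node t' Tree.nil)))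
          (ih Tree.nil (Nat.shiftRight k 1) v (fun t' => f (Tree.node Tree.nil t'))))
        (fun _ => appT f Tree.nil)
        (fun l r _ _ =>
          cond (Nat.beq (Nat.land k 1) 0)
            (ih l (Nat.shiftRight k 1) v (fun t' => f (Tree.node t' r)))
            (ih r (Nat.shiftRight k 1) v (fun t' => f (Tree.node l t')))) t) n

/-- All clauses in the tree are good. -/
def TGood (val : ℕ → Prop) : Tree → Prop
  | Tree.nil => True
  | Tree.leaf c => Good val c
  | Tree.node l r => TGood val l ∧ TGood val r

theorem get_good {val : ℕ → Prop} {dflt : ℕ} (hd : Good val dflt) :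
    ∀ (t : Tree), TGood val t → ∀ k, Good val (t.get dflt k)
  | Tree.nil, _, _ => hd
  | Tree.leaf _, h, _ => h
  | Tree.node l r, h, k => by
    change Good val (cond (Nat.beq (Nat.land k 1) 0) (l.get dflt (Nat.shiftRight k 1))
      (r.get dflt (Nat.shiftRight k 1)))
    cases Nat.beq (Nat.land k 1) 0 with
    | true => exact get_good hd l h.1 _
    | false => exact get_good hd r h.2 _

theorem ins_good {val : ℕ → Prop} : ∀ (n : ℕ) (t : Tree) (k v : ℕ) (f : Tree → Bool),
    TGood val t → Good val v → t.ins n k v f = true → ∃ t', TGood val t' ∧ f t' = true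
  | 0, _, _, v, _, _, hv, h => ⟨Tree.leaf v, hv, h⟩
  | n + 1, Tree.nil, k, v, f, ht, hv, h => by
    change cond (Nat.beq (Nat.land k 1) 0)
      (Tree.nil.ins n (Nat.shiftRight k 1) v (fun t' => f (Tree.node t' Tree.nil)))
      (Tree.nil.ins n (Nat.shiftRight k 1) v (fun t' => f (Tree.node Tree.nil t'))) = true at h
    cases hb : Nat.beq (Nat.land k 1) 0 with
    | true =>
      rw [hb] at h
      obtain ⟨t', h1, h2⟩ := ins_good n _ _ _ _ ht hv h
      exact ⟨Tree.node t' Tree.nil, ⟨h1, trivial⟩, h2⟩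
    | false =>
      rw [hb] at h
      obtain ⟨t', h1, h2⟩ := ins_good n _ _ _ _ ht hv h
      exact ⟨Tree.node Tree.nil t', ⟨trivial, h1⟩, h2⟩
  | n + 1, Tree.leaf _, _, _, _, _, _, h => ⟨Tree.nil, trivial, h⟩
  | n + 1, Tree.node l r, k, v, f, ht, hv, h => by
    change cond (Nat.beq (Nat.land k 1) 0)
      (l.ins n (Nat.shiftRight k 1) v (fun t' => f (Tree.node t' r)))
      (r.ins n (Nat.shiftRight k 1) v (fun t' => f (Tree.node l t'))) = true at h
    cases hb : Nat.beq (Nat.land k 1) 0 with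
    | true =>
      rw [hb] at h
      obtain ⟨t', h1, h2⟩ := ins_good n _ _ _ _ ht.1 hv h
      exact ⟨Tree.node t' r, ⟨h1, ht.2⟩, h2⟩
    | false =>
      rw [hb] at h
      obtain ⟨t', h1, h2⟩ := ins_good n _ _ _ _ ht.2 hv h
      exact ⟨Tree.node l t', ⟨ht.1, h1⟩, h2⟩

/-- Resolve `c` successively with the clauses whose keys are the base `2 ^ 15` digits of `h`. -/
def chain (dflt : ℕ) (t : Tree) (fuel : ℕ) : ℕ → ℕ → ℕ :=
  Nat.rec (motive := fun _ => ℕ → ℕ → ℕ) (fun _ c => c)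
    (fun _ ih h c =>
      cond (Nat.beq h 0) c
        (force (resolve c (t.get dflt (Nat.land h 32767)))
          (fun c' => ih (Nat.shiftRight h 15) c'))) fuel

theorem chain_good {val : ℕ → Prop} {dflt : ℕ} (hd : Good val dflt) {t : Tree}
    (ht : TGood val t) : ∀ (fuel h c : ℕ), Good val c → Good val (chain dflt t fuel h c)
  | 0, _, _, hc => hc
  | n + 1, h, c, hc => by
    change Good val (cond (Nat.beq h 0) c (force (resolve c (t.get dflt (Nat.land h 32767)))
      (fun c' => chain dflt t n (Nat.shiftRight h 15) c')))
    rw [force_eq]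
    cases Nat.beq h 0 with
    | true => exact hc
    | false => exact chain_good hd ht n _ _ (resolve_good hc (get_good hd t ht _))

/-- Run a list of resolution chains. The `n`-th derived clause is stored at key `2 n + 1`, and the
result tells whether the last derived clause was empty. -/
def run (dflt : ℕ) (steps : List ℕ) : Tree → ℕ → ℕ → Bool :=
  List.rec (motive := fun _ => Tree → ℕ → ℕ → Bool) (fun _ _ last => Nat.beq last 0)
    (fun s _ ih t k _ =>
      force (chain dflt t 400 (Nat.shiftRight s 15) (t.get dflt (Nat.land s 32767)))
        (fun c => t.ins 15 k c (fun t' => force (Nat.add k 2) (fun k' => ih t' k' c)))) steps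

theorem run_sound {val : ℕ → Prop} {dflt : ℕ} (hd : Good val dflt) :
    ∀ (steps : List ℕ) (t : Tree) (k last : ℕ), TGood val t → Good val last →
      run dflt steps t k last = true → False
  | [], _, _, last, _, hl, h => by
    have h0 : last = 0 := Nat.eq_of_beq_eq_true h
    obtain ⟨j, hj, _⟩ := hl.2.2
    rw [h0] at hj
    simp at hj
  | s :: ss, t, k, last, ht, _, h => by
    have hc := chain_good hd ht 400 (Nat.shiftRight s 15) _
      (get_good hd t ht (Nat.land s 32767))
    change force (chain dflt t 400 (Nat.shiftRight s 15) (t.get dflt (Nat.land s 32767)))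
      (fun c => t.ins 15 k c (fun t' => force (Nat.add k 2) (fun k' => run dflt ss t' k' c))) = true at h
    rw [force_eq] at h
    obtain ⟨t', ht', h'⟩ := ins_good 15 t k _ _ ht hc h
    rw [force_eq] at h'
    exact run_sound hd ss _ _ _ ht' hc h'

/-- Apply a continuation (a definition of its own, to keep kernel reduction shallow). -/
def app (k : Tree → List ℕ → Bool) (t : Tree) (ys : List ℕ) : Bool := k t ys

/-- Build a complete tree of depth `n` from a list, in continuation passing style. -/
def build (n : ℕ) : List ℕ → (Tree → List ℕ → Bool) → Bool :=
  Nat.rec (motive := fun _ => List ℕ → (Tree → List ℕ → Bool) → Bool)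
    (fun xs k => List.rec (motive := fun _ => Bool) (app k Tree.nil [])
      (fun x ys _ => app k (Tree.leaf x) ys) xs)
    (fun _ ih xs k => ih xs (fun l ys => ih ys (fun r zs => k (Tree.node l r) zs))) n

theorem build_sound {val : ℕ → Prop} : ∀ (n : ℕ) (xs : List ℕ) (k : Tree → List ℕ → Bool),
    (∀ x ∈ xs, Good val x) → build n xs k = true →
      ∃ t ys, TGood val t ∧ (∀ x ∈ ys, Good val x) ∧ k t ys = true
  | 0, [], k, hx, h => ⟨Tree.nil, [], trivial, hx, h⟩
  | 0, x :: ys, k, hx, h => ⟨Tree.leaf x, ys, hx x (by simp),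
      fun y hy => hx y (by simp [hy]), h⟩
  | n + 1, xs, k, hx, h => by
    obtain ⟨l, ys, hl, hys, h2⟩ := build_sound n xs _ hx h
    obtain ⟨r, zs, hr, hzs, h3⟩ := build_sound n ys _ hys h2
    exact ⟨Tree.node l r, zs, ⟨hl, hr⟩, hzs, h3⟩

/-- The complete check. -/
def check (dflt : ℕ) (axs steps : List ℕ) : Bool :=
  build 14 axs (fun t _ => run dflt steps (Tree.node t Tree.nil) 1 dflt)

theorem check_sound {val : ℕ → Prop} {dflt : ℕ} (hd : Good val dflt) {axs steps : List ℕ}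
    (ha : ∀ x ∈ axs, Good val x) (h : check dflt axs steps = true) : False := by
  obtain ⟨t, _, ht, _, h2⟩ := build_sound 14 axs _ ha h
  exact run_sound hd steps (Tree.node t Tree.nil) 1 dflt ⟨ht, trivial⟩ hd h2

end FiveHole

namespace FiveHole

/-- Propositional variables: orientations of triples, nonemptiness of triangles, and the two
ways in which a point of a sorted quadruple can lie in the triangle of the others. -/
inductive Vr : Type
  | X (a b c : ℕ)
  | N (a b c : ℕ)
  | J (a b c d : ℕ)
  | L (a b c d : ℕ)
deriving DecidableEq

/-- Position of a sorted triple. -/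
def tri (a b c : ℕ) : ℕ :=
  Nat.add (Nat.add (Nat.div (Nat.mul c (Nat.mul (Nat.sub c 1) (Nat.sub c 2))) 6)
    (Nat.div (Nat.mul b (Nat.sub b 1)) 2)) a

/-- Twice the position of a sorted quadruple. -/
def quad (a b c d : ℕ) : ℕ :=
  Nat.add (Nat.div (Nat.mul d (Nat.mul (Nat.sub d 1) (Nat.mul (Nat.sub d 2) (Nat.sub d 3)))) 12)
    (Nat.mul 2 (tri a b c))

/-- Positive literals. -/
def pX (a b c : ℕ) : ℕ := tri a b c
/-- Negative orientation literals. -/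
def nX (a b c : ℕ) : ℕ := Nat.add 990 (tri a b c)
/-- Positive nonemptiness literals. -/
def pN (a b c : ℕ) : ℕ := Nat.add 165 (tri a b c)
/-- Negative nonemptiness literals. -/
def nN (a b c : ℕ) : ℕ := Nat.add 1155 (tri a b c)
/-- Positive literals for the second point lying in the triangle of the others. -/
def pJ (a b c d : ℕ) : ℕ := Nat.add 330 (quad a b c d)
/-- Negative literals for the second point lying in the triangle of the others. -/
def nJ (a b c d : ℕ) : ℕ := Nat.add 1320 (quad a b c d)
/-- Positive literals for the third point lying in the triangle of the others. -/
def pL (a b c d : ℕ) : ℕ := Nat.add 331 (quad a b c d)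
/-- Negative literals for the third point lying in the triangle of the others. -/
def nL (a b c d : ℕ) : ℕ := Nat.add 1321 (quad a b c d)

/-- The list of sorted triples. -/
def triples : List (ℕ × ℕ × ℕ) :=
  (List.range 11).flatMap fun c => (List.range c).flatMap fun b => (List.range b).map fun a =>
    (a, b, c)

/-- The list of sorted quadruples. -/
def quads : List (ℕ × ℕ × ℕ × ℕ) :=
  (List.range 11).flatMap fun d => (List.range d).flatMap fun c => (List.range c).flatMap fun b =>
    (List.range b).map fun a => (a, b, c, d)

/-- The table of variables. -/
def tbl : List Vr :=
  triples.map (fun t => Vr.X t.1 t.2.1 t.2.2) ++ triples.map (fun t => Vr.N t.1 t.2.1 t.2.2) ++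
    quads.flatMap (fun t => [Vr.J t.1 t.2.1 t.2.2.1 t.2.2.2, Vr.L t.1 t.2.1 t.2.2.1 t.2.2.2])

theorem tbl_tri : ∀ c < 11, ∀ b < c, ∀ a < b,
    (tri a b c < 165 ∧ tbl[tri a b c]? = some (Vr.X a b c) ∧
      tbl[165 + tri a b c]? = some (Vr.N a b c)) := by
  decide +kernel

set_option synthInstance.maxSize 2000 in
set_option synthInstance.maxHeartbeats 400000 in
theorem tbl_quad : ∀ d < 11, ∀ c < d, ∀ b < c, ∀ a < b,
    (quad a b c d + 331 < 990 ∧ tbl[330 + quad a b c d]? = some (Vr.J a b c d) ∧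
      tbl[331 + quad a b c d]? = some (Vr.L a b c d)) := by
  decide +kernel

/-- Signotope axioms. -/
def axS : List (List ℕ) :=
  (List.range 11).flatMap fun d => (List.range d).flatMap fun c => (List.range c).flatMap fun b =>
    (List.range b).flatMap fun a =>
    [[pX a b c, nX a b d, pX a c d], [nX a b c, pX a b d, nX a c d],
     [pX a b c, nX a b d, pX b c d], [nX a b c, pX a b d, nX b c d],
     [pX a b c, nX a c d, pX b c d], [nX a b c, pX a c d, nX b c d],
     [pX a b d, nX a c d, pX b c d], [nX a b d, pX a c d, nX b c d]]

/-- Consequences of a point lying in a triangle. -/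
def axJ : List (List ℕ) :=
  (List.range 11).flatMap fun d => (List.range d).flatMap fun c => (List.range c).flatMap fun b =>
    (List.range b).flatMap fun a =>
    [[nJ a b c d, nX a b d, pX a c d], [nJ a b c d, pX a b d, nX a c d],
     [nJ a b c d, pX a b c, pX a c d], [nJ a b c d, nX a b c, nX a c d],
     [nL a b c d, nX a c d, pX a b d], [nL a b c d, pX a c d, nX a b d],
     [nL a b c d, pX b c d, pX a b d], [nL a b c d, nX b c d, nX a b d]]

/-- A nonempty triangle contains a point. -/
def axN : List (List ℕ) :=
  (List.range 11).flatMap fun c => (List.range c).flatMap fun b => (List.range b).map fun a =>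
    nN a b c :: ((List.range 11).flatMap fun q =>
      cond (Nat.blt a q && Nat.blt q b) [pJ a q b c]
        (cond (Nat.blt b q && Nat.blt q c) [pL a b q c] []))

/-- There are no divided pentagons whose three triangles (seen from the middle point) are empty. -/
def axH : List (List ℕ) :=
  (List.range 11).flatMap fun e => (List.range e).flatMap fun d => (List.range d).flatMap fun c =>
    (List.range c).flatMap fun b => (List.range b).flatMap fun a =>
    cond (Nat.blt a 5 && Nat.blt 4 e)
    [[nX a b c, nX b c d, nX c d e, pN c d e, pN a c e, pN a b c],
     [pX a d e, nX a b c, nX b c e, pN c d e, pN a c d, pN a b c],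
     [pX a c e, nX a b d, nX b d e, pN a b c, pN b c d, pN c d e],
     [pX a c d, pX c d e, nX a b e, pN a b c, pN b c e, pN c d e],
     [pX a b e, nX a c d, nX c d e, pN c d e, pN b c e, pN a b c],
     [pX a b d, pX b d e, nX a c e, pN c d e, pN b c d, pN a b c],
     [pX a b c, pX b c e, nX a d e, pN a b c, pN a c d, pN c d e],
     [pX a b c, pX b c d, pX c d e, pN a b c, pN a c e, pN c d e]] []

/-- The first five points are not in convex position. -/
def axA : List ℕ :=
  (List.range 5).flatMap fun d => (List.range d).flatMap fun c => (List.range c).flatMap fun b =>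
    (List.range b).flatMap fun a => [pJ a b c d, pL a b c d]

/-- The line through the points `4` and `5` separates the others. -/
def axT : List (List ℕ) :=
  ((List.range 4).map fun a => [pX a 4 5]) ++ ((List.range 5).map fun a => [nX 4 5 (6 + a)])

/-- All axioms. -/
def axs : List (List ℕ) := axS ++ (axJ ++ (axN ++ (axH ++ (axA :: axT))))

/-- The clause with the given literals. -/
def mask : List ℕ → ℕ :=
  List.rec (motive := fun _ => ℕ) 0 (fun l _ m => Nat.lor (Nat.shiftLeft 1 l) m)

/-- Well-formedness of clauses. -/
def wf (c : ℕ) : Bool :=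
  Nat.beq (Nat.land c (Nat.shiftRight c 990)) 0 && Nat.beq (Nat.shiftRight c 1980) 0

theorem axs_wf : (axs.all fun l => wf (mask l)) = true := by
  decide +kernel

theorem mask_testBit {l : ℕ} : ∀ {ls : List ℕ}, l ∈ ls → (mask ls).testBit l = true
  | k :: ls, h => by
    have h1 : (mask (k :: ls)).testBit l = ((1 <<< k).testBit l || (mask ls).testBit l) :=
      Nat.testBit_or _ _ l
    rw [h1]
    rcases List.mem_cons.1 h with rfl | h
    · have : (1 <<< l).testBit l = true := by simp
      rw [this]; rfl
    · rw [mask_testBit h]; simp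

theorem good_of_wf {val : ℕ → Prop} {ls : List ℕ} (h : wf (mask ls) = true)
    (hs : ∃ l ∈ ls, lv val l) : Good val (mask ls) := by
  obtain ⟨l, hl, hv⟩ := hs
  unfold wf at h
  rw [Bool.and_eq_true] at h
  have h1 : mask ls &&& (mask ls >>> 990) = 0 := Nat.eq_of_beq_eq_true h.1
  have h2 : mask ls >>> 1980 = 0 := Nat.eq_of_beq_eq_true h.2
  refine ⟨?_, ?_, l, mask_testBit hl, hv⟩
  · refine Nat.lt_pow_two_of_testBit _ (fun i hi => ?_)
    have h3 : (mask ls >>> 1980).testBit (i - 1980) = false := by rw [h2]; simp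
    rw [Nat.testBit_shiftRight] at h3
    rwa [show 1980 + (i - 1980) = i by omega] at h3
  · intro i hi hi2
    have h3 : (mask ls &&& (mask ls >>> 990)).testBit i = true := by
      rw [Nat.testBit_and, Nat.testBit_shiftRight, hi, hi2]; rfl
    rw [h1] at h3
    simp at h3

end FiveHole

namespace FiveHole

/-- The refutation: one resolution chain per derived clause. -/
def steps : List ℕ :=
 [7422376,
  812727488,
  7436968,
  7433576,
  544304568,
  1068591544,
  1068581568,
  812719004,
  544293952,
  7423316,
  860518324,
  860488716,
  141632612,
  141642316,
  21658452,
  21652820,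
  21633740,
  21631092,
  7434216,
  21648596,
  812728296,
  141637720,
  812739484,
  141639328,
  7431256,
  17835712208212,
  21635188,
  21645140,
  625615476,
  281684436,
  7431608,
  141633284,
  625607156,
  544305576,
  1068583680,
  1068584616,
  625615348,
  1068571304,
  625612028,
  21648396,
  21637076,
  17835712204116,
  625611948,
  625611252,
  141636000,
  27096970307412,
  261448193355920601940,
  826964212,
  544308904,
  584440617682752340,
  812726816,
  1068592808,
  812724248,
  281705396,
  145379426,
  7424704,
  1068590440,
  826944052,
  826941292,
  21650260,
  7431424,
  860496812,
  21655380,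
  826950004,
  21629044,
  281683892,
  21644340,
  145365346,
  145382754,
  625609452,
  281705532,
  141637688,
  302473059561513940,
  826954292,
  21634636,
  7424064,
  544294592,
  275855720,
  826933876,
  826957100,
  975843420,
  975859356,
  975857756,
  275853376,
  860498228,
  145382242,
  826957516,
  975847324,
  35014742538580,
  281702868,
  975837852,
  21657652,
  21647660,
  20500739423092,
  145380194,
  625631732,
  826956020,
  281682388,
  826956500,
  145366690,
  21647700,
  975858844,
  584440617682750292,
  21631042,
  812718242,
  21634900,
  9230745216012,
  145389154,
  17835712201556,
  1068591784,
  27097574305844,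
  812726248,
  826934484,
  826942708,
  975851932,
  625609396,
  1068596392,
  9230745216468,
  860489356,
  826938580,
  1147389471625997140,
  975855516,
  7432004,
  826959060,
  625607852,
  26631226404204,
  625613548,
  826939444,
  975845468,
  625608652,
  21630836,
  281693548,
  975839132,
  975848540,
  21633140,
  28197085914996,
  141640920,
  281691932,
  28196742002700,
  826948308,
  975856732,
  1068572328,
  35015581398356,
  975861148,
  21648076,
  986347884,
  975837276,
  145386338,
  21639508,
  145383074,
  145385314,
  812722680,
  21633404,
  975852700,
  975855708,
  275845872,
  1068584720,
  986330548,
  145363362,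
  21647220,
  21632980,
  975853724,
  21645652,
  21640404,
  21636148,
  812719896,
  275845472,
  242687301972,
  21634004,
  20500739421492,
  975846812,
  1068591192,
  975838364,
  21649628,
  145381794,
  21638356,
  625636020,
  4641688005532,
  21650796,
  860519052,
  28196742004268,
  20500705847348,
  975839644,
  544301080,
  625632012,
  21626996,
  21642068,
  21649460,
  1068591080,
  28197446619060,
  145364322,
  986338996,
  141639392,
  21632852,
  21647740,
  281687508,
  625607436,
  145387362,
  812727272,
  860497204,
  826940482,
  826959924,
  826935348,
  9039040375372,
  21647988,
  21645940,
  531721384,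
  975861852,
  826961716,
  826951500,
  975839324,
  28196742002132,
  1059058830619062196,
  986331828,
  531718232,
  21643380,
  986345836,
  7434920,
  145381026,
  625633972,
  7430568,
  975838876,
  812722980,
  986336692,
  531719848,
  17423395351892,
  826964692,
  625617588,
  281689812,
  986325428,
  625612748,
  975844764,
  709496566740,
  826963764,
  141629496,
  531711232,
  145365922,
  678499016,
  281702412,
  986347956,
  986334644,
  826962484,
  975853468,
  531718980,
  826957428,
  21632588,
  986332852,
  975849564,
  21649996,
  826955628,
  975851676,
  678508984,
  275854696,
  21628756,
  9039040352636,
  625614900,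
  812732184,
  625615628,
  531718584,
  410072900,
  826950900,
  21634060,
  860519852,
  975851612,
  975848348,
  4640993848578,
  625617108,
  17835712206164,
  21648716,
  9039040374556,
  812722232,
  671768228661984724,
  625613492,
  31976176908130,
  27097574308052,
  868876876,
  141636696,
  986341044,
  986339764,
  544301928,
  32320497809484,
  860497548,
  544304964,
  28595692138389236755020,
  986326380,
  145368418,
  975863196,
  812728088,
  21633324,
  145366882,
  975852956,
  21653332,
  4764094571362,
  1003566976547792608134641278306538874658572749265785293355438446106384145300,
  1020939590558588308,
  627538458486436311141190292,
  14488835641395865398966679871189198217011284022846884870248954425933761521882888706551686190095916804469486954863218567668932097500539330859752481959669553676,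
  6169782377242440047225948525613312178400654918131,
  1407718596559350431680580125313606742830025471191545940,
  1244529078895397357844505777014460556,
  29347365374625839908131303760910720076585215336569044178509269896273710440204,
  1419930717688689108667345628762549019109643252,
  20563331653893380537396536934935,
  23707750435883733846591778575962856817125059353204,
  28473444880768421739341926110324791352599682327258894865015700,
  324747951857072757944234452,
  5197675782574605033098223620766864303373986335546917246283152978818967566618779277994877720891021149007481866699190782282000931109776713164040440996444088417954902611423984115700389742752508044195344753523301383801011409317848785571668400234466447084151435158146452,
  341486977971433641987424212484751905,
  3440552275196564,
  1123052277466127586426090440428768829146553068,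
  5115284332829121533524,
  324752681988034209777857620,
  1228156304904697332859332097828434946938700813251379293,
  26772864804305740856638637487423929,
  760950253662219839124,
  968380025657840482152869765444024231705274666008606804,
  32825661758514162568113284721556,
  9911446237105510783892,
  341148351582983104,
  801967767674682239589494841636496080385532960916664649071336674091037886240936895166635135714061230220803436986142651755932761032729517764530956,
  34334730967103457605716,
  1137155760190057691117792656,
  12900548268867926860399572849306829062846946683154586035820,
  3526279979937523168760064,
  1131274482901372308,
  13153737766962983730953629873424043444315339644770,
  1967826141835,
  305162684842559961901269076143219081344807898488759376340792869750413333948678954989087895939435447699210347673338780564,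
  3306115367359309003544428225823954995691787862295568003700368665137330231670999197146407801532884236796427123605133657584860031577992758386055949691155321229813396,
  12015096208290391730702043912113536332655379098004,
  22011879811290436871828,
  1834767125379973837604050386987561893692191698129268588992375572486595064004588771578969341989434396068927856010343332252778847533961618375110919039425988192172055630688910499079430434741084099627948202238783652160015133365931956551632460533371406468182406079525857348583266434739971913255829578114431829654720489055401498083066533492,
  1311051329339876334060529486344650624777354808,
  18025161719122580,
  680971365255549068285731903835412786836,
  217038028713005670766970025485819505791219004808448802594734740,
  84127521125434844205239560852,
  422749230533672462258732819174843755013113953312165874353013175,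
  4810383536064,
  20112544,
  603380864306450531936862804858610355340549465323080396110462671749220528962205191432537376228355604476485356,
  35648239203251579953711404461816861505793422356238415762535448469228,
  25834683762362521628244,
  653718228526645641899,
  1075652943467897293087979644312507468,
  111824609829112858592061433779763225358556803690144986779357959660,
  29306835472689789906926510311002855984532,
  697578280,
  781466920,
  19567890530168,
  501318383911425684,
  1143805883500571494256323506870672501267653460,
  24696776406420617625523908605533473497291668,
  1221014962704111952560441035132127220,
  1240102584959989466715078310305013769020940077404675148,
  584440732840153344,
  250256053670560234985479969479085013537577386253581972666997465306904670667145705,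
  901913080682055040651525290385712551043430484,
  1339383729589319347186701295362274254858525922464037558942433899,
  366673105109364514712499812162619400244170388,
  20591877211580608102962127432366408862602075178874858358902211365972,
  16342566074867811155266832601157888394319917111504026064532,
  207988108794516,
  42141861781212083633220567723393684232972,
  11189975131511662333460374136438049607892,
  41525986152560826564395543390620866510679543106419635823426192540375,
  35491475150584297579300381481653960450807343415105182202550467873944436159085456678791733729650475950996,
  782288333993428444850553095,
  1208056290544935142748050172538412444,
  322582675328309856080523430813468737934738651796,
  9039040355692,
  975835292,
  868889996,
  531712256,
  281688532,
  296191274997389900,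
  975855388,
  28197085916468,
  21629908,
  975854748,
  826941236,
  275847712,
  986326452,
  21658580,
  21631796,
  7410088,
  1068583592,
  868882828,
  868880460,
  975853980,
  826951380,
  531699368,
  860487980,
  141638744,
  868899916,
  141641784,
  21653844,
  986337716,
  975835804,
  4640993847068,
  27096970307924,
  975835548,
  826938700,
  868882316,
  986330804,
  625621876,
  975840156,
  145380706,
  868896844,
  13437086876706,
  141638048,
  410077346,
  21648340,
  9039040376172,
  145363874,
  868900492,
  868893260,
  275853080,
  141636824,
  21638996,
  975844508,
  975842716,
  531721192,
  20500705846484,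
  531710720,
  21651380,
  141628632,
  826938892,
  544302848,
  544306856,
  21630804,
  678508304,
  678508292,
  986340020,
  145364898,
  531718824,
  826943188,
  868883340,
  544304216,
  826947380,
  145363042,
  1068584192,
  975837084,
  678507960,
  21634932,
  141627784,
  145372258,
  28472324533324,
  9230745218516,
  28472314064988,
  826937972,
  21651036,
  826956620,
  275850456,
  826945332,
  4764094572386,
  975859612,
  868902796,
  4764094573410,
  826965620,
  21628884,
  625638668,
  868888460,
  281683980,
  281703980,
  21649980,
  986338740,
  975831055,
  986349164,
  826938156,
  678510416,
  975853340,
  826946100,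
  21646548,
  868904844,
  275854184,
  709496566100,
  145366946,
  21656788,
  678506640,
  826938612,
  21646292,
  975856028,
  975854492,
  975831452,
  826937804,
  975845276,
  21649268,
  145380450,
  21631852,
  975835228,
  9039040354076,
  625639156,
  9230871035925,
  531720552,
  32320497808460,
  868880780,
  975836828,
  31976900405340,
  141635672,
  868908940,
  625638348,
  275851204,
  975836252,
  275845200,
  625620276,
  826933277,
  4764094574434,
  531693599,
  28472314068892,
  28472324530764,
  868900940,
  986328500,
  22233874058140,
  625611532,
  975837340,
  531711648,
  975831085,
  32320497810508,
  281685548,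
  145384802,
  986319796,
  826933301,
  625618036,
  975845788,
  145388642,
  9230871065524,
  678510008,
  826956300,
  826933305,
  826952244,
  275850616,
  975832156,
  975855004,
  975863452,
  868897164,
  975842972,
  986320308,
  868893580,
  826955572,
  31976900404316,
  986347188,
  986328756,
  678507056,
  868895820,
  986333620,
  975857308,
  868887948,
  868881292,
  986316907,
  868884556,
  868892044,
  275856744,
  410072176,
  986316931,
  678504420,
  868898188,
  410071876,
  410071664,
  868884108,
  410073924,
  531713920,
  868900236,
  868885388,
  868880268,
  678506936,
  678507896,
  678508688,
  868883852,
  986349236,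
  986346932,
  868891724,
  986331572,
  986346108,
  868898892,
  986327404,
  986317051,
  868890700,
  678494483,
  986318772,
  868908428,
  868876364,
  678509048,
  868884364,
  868881804,
  868906892,
  868876695,
  868876703,
  868876709,
  868889676,
  868897868,
  868888450,
  868888652,
  344770150026004251933210830138873270403357540101931852783057983385319345253385308793069161021602385777209015913677535,
  1186897502776172909265837388,
  838029431925492115122793393724770231803731810,
  732344310111709683147103554964,
  999552418668800084,
  366497328998447188,
  45808011246758220507777860779,
  19977817058302624,
  1142305313949276680860900016081406132275,
  40678613907602816539613836763354951587174941526964272614484,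
  34216682440387076724745886586814713386880666845533337534751241905662882378318055,
  49165211803299304538821,
  927492625614088276,
  18227440586417343121204817036271,
  35852505031951222384382494507505871233557973577812,
  189929501040669670883564718484,
  1322511270126052349360452755535259822677385954434226291676436620,
  643716637592,
  1521420384209913954242164097104524140326749025283521529507267774222304165,
  1147094671148833817698089744988459654269524108,
  37589224241053420295500347067591087431066513834693,
  388197081473625874647564157251632611398910693,
  34966690014215153711475354202054398366360427689694266655419,
  2090218319865516051893771832704791308803854141860508858096105531904183547102210015434973279729999289550013550272631568494999789428,
  1183021644336654686180005095152790958989718672995403849588,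
  47989059120786952816665014874283482580643339119143601966601054025690524020248393282094169,
  1289999410278572138311454935975855193,
  734265243575833755383294788170259366524953686023990265883427992638146707246207438561428005777154796916048349587200394882515366640115433218608546907357456461442889327465743614272635183807110885139674448494520470166910660536816592237651655814356349217934184489256006924454920850837808879675263785926675019876970690275788124444565965828754069624940868249053921102418796,
  1229601492454528115761699230998748372,
  2023280065577097303675131420463991845490188398032193030873940623869,
  351548315221270042838741963008356060359674711352559729932022613329171609478657764525970164660445344121600283057775818465870025623445093759821699904580779061085973297800565698271905835637689247197369446434856315667933744696632852136573858907974473460896037877775737496671269506098467421935918031830130197092013652,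
  1092221711694528869477496137269759450516,
  1354899226156633696460432641941466935719728800846078068658873666437775981,
  743719483401062627097680342761178675860,
  1369495304004646899057116844880932212594770620019773276118271374915198287634564719665891149258985569398761601128062152312231019952008504854755038598249933959557943987911835735312369846576823443836060847572195,
  690533361689209338598776366129414075046039224271378764217117822313009826302108558145195604,
  1249438859032571130391495750976709108722315837171868668623737372,
  662882423443207892018602022974278893669564687135739027387324108849801097406358622175847905329993609313410076,
  12806652966135230729812,
  733572072102214698475768144881575550376574554608231742229431240276,
  30586086769307642507219269168322740926653117802872567542354517019010828573284690161976368986501990010345927338689340654255113805806493029601968588854502188089976309909413419040577223154278954449819060110418926559031951216442589819280892685976407535864330274137212947472684585303657185188943172601024540067156301903560357570670917588120724464093891915808409659049300567378234202857235067773633682407848389808988159818037797646461817103397294881195376924066069131847407188,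
  544993310162239538341538925209020188209884737402522647481699936765320341506878487353226836713040175452980225073327066438350537029183751527977920780006815475066265376885626674190035563249088639533893303626648215172135892226659469207146744541224148642211938371555980016217746599245224809066086680458297447608578014454266576435730875134866049228318552073817552506190099505757752639529419620876463,
  4528611910102631477015323020310641108010953402105988592953190634213156788711573731351661873608036368739630907233973184649724126731151231297793686513555071229541062937783899925639071251338657382141265795837904653843559501351508,
  1102001085342010772,
  14474744903313481935942487254609644023354748142581406556569605896602234675042,
  18512548060399084474460484368546664874013331343807801583700,
  26917052821736696526404801146127459513447435571560827,
  23588198282060450602394310735661789617302590868348992094405,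
  21137779296206067245158036,
  1734496075837387873957655080141062381735131682113630815679399209953646228,
  19054394828102277444401578902781,
  17241156719350095032041501668395651083844455602260,
  691902192639316312910898353371898626176523075732081913833924842149750420,
  1272307305811403707440178214746703956,
  43302751325256502468688231134924541034065526653413,
  18421821213663147932958764317789742754810096890291407622496296375791816383237185176160775210766539287800955977561093852847748201960626455819,
  280922515456525551,
  1416563909822990712508976986188859743921396756226947824942452820,
  1230771466283009693935339676877629524,
  18328483859389403601639293296509303188,
  1602976914766016615905485978943760528569568460866172142438297367796778159,
  3934480004837940010740333065998094361433438615857522731398070450750706316510057,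
  8830588028169,
  43218761893721914811507304829359016604416841258230917016262953175401981667216365007931706069772,
  893887972605,
  7524880801808641186243825653559252468136817202346079434237695382859587852857145554352764029009963928954451583606164,
  186935096120513403399925377946801432,
  679478565,
  61895523744672472867548037813,
  32883810265346284119308274327221714499344088717204,
  933543392698603092,
  1366095992237815274472787231537941736652931301,
  32482992454391026380583636,
  14323180735398014941719984096963130620035430361236234134375539957602,
  645077472133044946939102216797030422697341416416573650891527233105423793259581418951979321955190065,
  199984664012956160642860351011827260874502353300744283002188980097085189779465509286147871497235467359849812182392333543101597440540842392863967735192963546335196547057520519070099692439472615325169171726420,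
  1220720986899326362751894827,
  2327807814890358184354922794751559281257062950700661296103110797743734579742033112153003099602341738922632199005995458550112892675170374623440395374958108575652822598254815958473438307238040688770020761249193597578524071097152460105140116217710774816877163779384405444640,
  3178246579340459900508163692654437023089077709307988,
  17711020993300383122507394080809748818059488587654821641557707527493302123924,
  8742083881860986331380149361428140595041557134815528909137055468553228712796274820401,
  140418371863036856386211225373651376776597587575304808434741641542040721620150913967984506118481714775982424697238531851697129668220157048067371283184680050722960109271114034581243765729343969957313403344591953005500796443312886188500576973984385663175132455,
  119680083273083126151,
  13743939616987,
  455011637758864522827362592604796686528277443959808445287132253717678430247613084126038162173108958834366966285893524,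
  29146799361792654955373539839307791225891684823894944835420446424980,
  84245339108331668738098244769642084601521064452235957277160832363284892053790541194480532,
  13839054637870653916925843126553003039094786077800,
  793788056841487665,
  802101511275456782178,
  16994368242304050879136493,
  40770536495289221566550696899043585405061983292931108341407734716738,
  11251288095084113888985700813978386807922851166956578157955144510801288237698,
  468028825934126583492151074356883215085197574085764245929262072464834536653705689293743329769436663897135676802366865584816433,
  7987843547668260235376,
  1127309249552319829,
  39733845772341737280936413425315944167080305184309925,
  829537692386004467534941187352550016086271725230543895956,
  617413985684,
  17072496797665419083156,
  4948104316213,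
  785596782483666625327249060693334295247,
  1206855135604080807581619613912141848376337672774542829365624959,
  1002747190099051061617986812696089777705220601041833620,
  4224614337009698921606934536461479971656489070349217631322771843492845648396864207871020,
  190874424931660884,
  7899038993953042467122099692789405715286100,
  11984365488885745733615448927350448328940,
  120070807360290771852698978266044586639044016309614612197717257119706271804,
  1816752119370443170777246516599450384268088103682620582107571290513475640328046633057894939732,
  55565277869170050472192289241552891603653623130494058514538815580326463760105761,
  1417633229701361625917839547528097891526084474218107604,
  42155518506450338694087155498526521603678351616776157684284136310540606123442085185821276686722647042347000405663128309369145814826068,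
  9386682481616939895259378144183529256024682005075149985590868716362718693856422368037694997381,
  829127312677395824914835708008835421094137966873852872067,
  134145819315341119868913410808416360946069603035299461736642317616524017078251035991858890323312910460866498682819960349304361964005409743843670501262641057653823789160467015644911487050293734094305001994220811122092395604,
  69484896939452523976711933986974019757670957271111681986619162930090175984593863015517268,
  45481772222670332745653333829332004145256764657867796335775946583156399104504032694094833503933278902985778957896084,
  463088950903338691596813693759390597,
  3762760501695095962046461373936984168093695889083276862395341591459233434475137167889487462818834994016806797533516885359338597306210668566513672127002291799807177186980146375882837973545627739540853168557201779824952808796863421972353260,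
  4911007876816823563194919257854733143025417491501109297244056958318907798975796045874058500109319632667634176759106832821579988181888153799141630810314698735488329806564016135731894948569409482925822383629140445953791823120256761396977715094174682287382765479646488967952774113125146547581631364066271642863739275403142522154550112828786411986836113251956657891192734501,
  742393217,
  317953725977835285580088681,
  7188788885676038196288735925747947668857,
  861013643490377119501578066178738464395165606673028206466125895498694679,
  19508634239613702623531788613289164160524436171069007379082960422274766358978383903338765534890222329829299401807066563987,
  35240546506114890693187160250614737798527,
  1086115990318177628200020415124879071051777407,
  17302466334321863388098458121295584258935188,
  15689272512340589965268,
  38203212421016008472357912987232,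
  25741770824055853080572551937460670037655799,
  787879489343938245229672753465993826905120015393338763368459813183415942908740273,
  460047259846208127551,
  1104685289721426083897428884,
  473553282708,
  50268328786195812483984131881563994701878189985745142288659584668113195457925972619522,
  1122742383378881347708521963919641867711435875470405125889098548318125181199354975892,
  1142560476187618598276,
  34711978260046716439736596160909049971979531847087,
  19327131463625357278682116974310788975426986326574211646798192146147897688041573002840430557089055641208919856091347444267310713070469340793613956908966147407719423457312093231372874433409288497183938060637161394957284307808203370926266849750994050304235838395793345518241956866293979631670421468265807345013123381136442091864912919504225931117678959397426868749588429051987998992277495208262562876369968742600193136045225851251087752442447270466,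
  29711387202977150571405625013518913357542368790236468649919877,
  972496605993114307029132041357177378849432291047713322616178220300,
  30106703262566507667589514417812,
  411170670402795141080000022596186123581291924,
  254645038736167175176063950664486029331297580606071315392958766716522527982091618677822732,
  15534117827115099096625379651971761264351954286214633123948354213132,
  31927129045724052,
  615055722523863789551803796,
  47255290426880950871574660778469560815887596891170335730847788,
  2597248303506902531823747846640985223271184449064103751596846460561664044280255743131929806283,
  3215237666876408031663941369078320417332206887350680439363687394688956118938881528242381445640425926703100837906252301775,
  40118895725634083397122618846478763,
  20976422671986223054596314957268158507395952255345973305464156758800741617403812078310996405770644866241246525813429248255400836021800174150498360282732518034177048722415983872914816089399068575534631624724723168573481401213827406208064595167050028106292230624927763440445628650314611391169031779001687608745809406006699046950791134720881333258580391616887168869128514338802334328514194606067004145163757994154306650052766834315786645833165462178988300956028063330551010598574590165852538681509965234983966151363912255881187179198150338394675164278886013655014096556474457808101292366952010499363959257691773385726941894352269767676230425688695132052,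
  10926804809574856746075221826515295113249498524622293404939718359043331608359185652669950144059867546243683065684225499054839179706691606013955845910028639968830297004441896528118506442580747836407567971717295175434213334094944318402578446011093932500274652202640898036730162857617259160525879979207623371518622370868125008935839090033959378037551786829082772005635951975116930356580459341625221910438623706576273451407955853803,
  1026736150445808083910715637021193275784082640447776562126729077669962309897048176881353727330868693617026158336218137162329325958910779838224467487490855775808221708818081742343949893880012193684536329080751579418502842416543307421864400720975843187961603892421321141620629573290407848232468847407854498332712998751773966135676288051407913407580372112414222854638456646997743804149331003612636019404902395354547469,
  113126118425414629981755394257549387115811197920813182736776278607774277569287518085151771440292361938786856102657818780575004201686112,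
  12320000699997328546758397280660,
  274824626252759605070853758035536663241237825011104894006989130644,
  45532566671848025745828983776803518693006528765351754695358474615011540995097892847528009968304595326530389524874639,
  48295296,
  60523162389131460199991338440820335580017736329234893389618577104829359049896454011349535660272568671062932958108052877681370881910522024312674703082979,
  27640015957589222868442306738268987183526398053679309,
  530431892677407536897987084,
  1049081872141286039475824281135899742188472583848566497977085891478541053532024581352096533930763153951688875957682293,
  118221120421653741889776138846973979152503468251490673738885013672175006594505905328631550727723855818070523408187296354343744837525204875392213266898270236381588104663601614801281549572857313726097403497677744168934621555041526305522621903620,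
  10778264722535379212364891357454705436059154373206314241921547423112830210824198899161454386857538980635908640123711477484257364,
  1163330519606721906772,
  22182454351139005816674,
  553840560564810040880167380915364677183698470919038377119240856669714598874691922629525190127957595416235520035278132733452201764492643013241488434074809620774619528149971943760081795513613977069137106819770352368402414363478422938747354657671785339691666324855947438035369152792366394927493317684562364513085941192950246311582813007578040213147049750282575306056677015865851380995481148361496928735119039474428408237885203858335715598283190397271515209016929160421497879689360262011091354651892923146721375903724604927960241096464706435834070177715070090583463535825952698271920964980606360970829080759768008214022888498686605076158872212014065725844249205919880797984326011368144214796729890937608795234642270988857585490415696471079156782685020094581,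
  81366302181398094740366136582805670020114720699647490164627669936024468,
  391043595717903045505149543484017850681741790659515526723500248877158147741776133640058531027816206897381493,
  63528185487137050450285163356973903765911649612815101408727455038899909412725667151118178451436628,
  2235199331136430005751146123621032156837019451535183689061089299608552918551206892162582391142147466526574674004,
  283050365269284545851354955344390939175050489919115885013274228646707600870071555722517467988400007008864929061903193606773471433721436707484333609572671867320943467855818272212364586760487067677091867576048797871867065375887001863649199192331521161913226074335458795591386786793471865476,
  12009792475843341054596,
  602967441854285287380357364,
  23818229024251399761390900371298,
  50516992,
  552625873053926246308822706255221244211350925680909943285346218408226585492118502457383359432251035908576139717892667051320663503393546578872166936416282594485702793309265117985440142302095568648946242646611991287169615958512895765192732311979114322569837446112454838700588405521634705797556965046967367354050414087,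
  110043764218806124209144948917449409877577693170692430496104599401954214911296131956022510359354656988038815094649044934515737108763143009256165272135047081543075955261084236110738922242463995254197472546712998903553957513519197462260,
  2455111140169892889036295287078870738595179467888667936844728447048237441055447491288380785381860709908270768619315863630022495085813477581686570668868571963030436601453645889901665684,
  1983222980927619028253500535243565815207038590290469481274165485974232079904386704841497182967427002338292736038028785434866851818061084429631332176554330764,
  10763236379284,
  4722575062424480416935,
  26238215794045857788849210131309901492242037367136340,
  205697829086136451124053556599702842765093221485806285065290921,
  253563092995888791092,
  642151940620114189389791584175830698585090393612448333713877041558476813561645398789964434431120018067694611155743071480630663996836057906926743794412165895556567652604249215889645033469834647401490220844563,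
  4234615508817944772400871943899221119691597623235204870282801102715986895685729559458026585824276980793434492380143392116124618650666263373184672662521944705977690454580792083862158446867758467664659336655371327133601571541724745702592102196552141408724574207348860359168,
  41655137918011414321034643532262621411755317724773379829930199183782914663221767921719123240808688566511459360970140244750176327723051960071744024237918943425097632109391384179668064051840284923622897785756999015536881149628954808630561937852079517471814189322270038239217171,
  13343527592507398797819102943091797111860239466263651465490750613091490136477445961320588752276615094226023895593927151954582851668,
  1413132676329977001401323205061742633137409567162779556340450693924676500,
  465496134183552058953757861407020942469627812326874440180117623277181454281784647750391980,
  1178275975264147119348034047327888515318295330847718959858150333086414033143167328729845472790158955077971062741625812869747424938053716,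
  186923003019604671867936657829032340,
  586842912890411778633449217532626526271005524062307782281264212354618884642726606791214563,
  39493207122714341463857295153106396548331550892179343787068347641858985477816803672092967391561249,
  25770519463469309473678574153901312199545216,
  1352412170402688291688,
  3934478677076654092959438687419341354828827926622745225394684509698084010623060,
  76585182388896300224816250964,
  7582549027854093646777125677506133712959904030034324057713712818424,
  696356620249887078401938068,
  11620222593265630733140682359178908328856784151407863067189960837406720005023262839138795336364693331429671382102788801805,
  17592229683368,
  9288387107982160139855338687767082433287126718555260153089892522357116282592223460436,
  856950335,
  64966474152718234442463055973516046632792362268607976050086366925296446506766744014723846066568321164493014520129169899840442777047096085980057820794547556856931540307756868506500727989,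
  54100139000733154439623843705287512780271630610461896969038555429120427789759989676778807481807259005412453620951109029461057214899862278740,
  42369853633403122304744971054800880274292687752609620262433637175892,
  326795574778849091806647970224118862420,
  252931669827439655673601160983454802487546122133978196,
  4183064664813758308747128381632357370667708780834371310280617808111588155264022683392896020267426407906124729275192388355656910169,
  45541896314294551277152513194893725132233957318996,
  55536143938119286174717924409309013378860357,
  30339277575917329574543874704664758046024,
  29310847102916857428,
  823902039358921709453575759,
  18718593027723338832700396287933360769555980027533314409228114810660619564590703194027975756997500665137102049745613900640798911518826590875073442013489263358164327734342916392545605633701831957026675193290479677495913515368127990891668307555892256058113746102919795213534098670013930547172103213472907260287130748552573,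
  46106803622621236814733911406649006203664067593811,
  39991331729775183661625196676679,
  1292750331015536674582000375477539114429439567701496665469511984028696401964839735939890087967243953656,
  32901103072545302799479164362807366911301,
  15858535756685010115106647155825875076121624614520331857667007605008726368425568719387542004950612535376345882610904046922135894339561840163028165646133299859797264643688907855970076139744592343745085841333642908648646274996646427636411580978757908710077657192231692984449747481319817838170285684845897897383962949217033648361911394320880571230164360027408619173269791804042728515029766959767225941,
  419193860424123004578650941954480481875112752757474528061549310032397733903730974683869148243297657,
  9387284930102485871507525689281801351195381463177425739488737360971419110981360776709578425721,
  4037162682528250228589778579641133301757015213531811153135130573464824859271334070558302660448144514260676061527130089154236893019122371802897729595641032457763686715823286995803854004600399291449952168479575208966690730200786771458963166650820856,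
  96356554676346488164230993773563073611605170138097889390719926663710338192639391755945386620156795638477789710586115210195932965186814237875940771083866767872094595642156577437034047259548206149614272915423050174094003838786867448930503383154892433721118344062746693314289955468323941958741326692926734613611789,
  59630110323224186704324891374048148749275271838008879,
  189408793937019918855064295828,
  557775,
  992783099551679689,
  36817021001572489271079164114105627483330964,
  31945039251059407399967124,
  15689272512340589961428,
  15335757268150932,
  785576502198335206702278342636888917625,
  35306063820438371984475769429044,
  1583524753474427503727428297239169226251061536132850390612,
  36559261970889434592211028646343063579066153860651709240916,
  77964719982736149712230032270517940570382297545758292,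
  53213407089917948328790090494360841668283505343723887059689290350159651716293432712690495725475828156504116461135693330576972452255909214140323904342020848506543922283473359704686071330279566927760161245571726409150003956570462336207598015572862989443630085073682127519753611121953913755229461235157087962656390593072394169545036170669234921400645003085151877908697599723455142320195440343944692153982211727549585525803086513908290949887260146529481234545096702177454995305059402046845924291536490935219803756,
  54326451795833133024882990593270878742872668124137898325402586222416444557178389030516027051705217205845482056262800503019932170363924044664977880648967425621785702658928591483976488917710857502090037329492117324256666064989084154438149160338432058342740487251246025512536103833387985447187626443170362282034108558009453293868852401308456919818488040938587489196666106521927997392825551948652200358669254441840812729298860877973093532173027429473139274342556416543593082374430193334780816470025446082354324598393146180239851977856620,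
  5664122168781193811931793621646537779733552163338659333026008462830753053771899427995421438090218165619873087004462529105526097368401276028313528878415762970921287000556126743821989206021394856248114878482883858316564270366589592734154960420893135650923946007864019764012661875149572718781560062105196,
  8141416389666726696358114162033600433269150230606944369613185150053868984548568993888803132336187375446147862606251170802743245904185539606793083052754193808213962737431040005369483511162203767838433070108199082819428013731462564374632000798622112903753294408225382295609401706589449316073495,
  1100022842568897149161905317741525373368295563951097940,
  300942815,
  541532523827575311887169644944322121013583393678293677304219508924830213141114924576656986332259830855861465883141633037640070088024803110007975147200094033415454326375401926465576596487046538536640559001932944829958047602114688253566116788881839250270109983664061925574583697753308825070390575074569476254733074025072040909693810580,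
  32324338782593633372956,
  1208418754624946790329706835615691282957099381599441394957178484,
  13345469482160099039103095058566367289132,
  1610832015038664195674431550354504787628011578380447611870060937097921806039442832705082188,
  23372050091185138304665,
  39414908669378893952852124826139839212875197187739,
  72534372537648715875527829233166752684455145657685320195592759336852065531800425093563105982590894617952836308277318952550557782221832429591301136575162949419466593051408637666049910921644540105623258109502423857,
  36707983037239439242205199844860834261908,
  1034198109620783696314206139028,
  31561222311018848096367252,
  42321427805859122283662923041366199934452408720573812311197,
  13611363598571172093222270228904763518464,
  726945071815,
  920880416425,
  68946061243659583657311441975108184,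
  4947671742146781885863324402914043776842585124531331581236103913694067732352179799886629855698999569371603407219333410334632292340234822806359795269354776257838422729843416277215136716976273425416372541428755824509251106922693749,
  1222887698317410453846495747112926127413853834723963933083601082869069012086407603708683315932923341545378316103937797996355935020618908230833109253171741232528073461964923704704820820992762811090219,
  33670685807396430649908934952523204178882480809158538680058423893456139808347174380596788821256236804743930743700,
  45442259559103790554678911301831090384310572104093296654452359334804,
  1843404724375017728137312450026803587154427680196136593145919699565616388320672304987250210509984148,
  38243750915656110088115080526702553530975688163653630975293908077238633278106154070641346719251002599470051907048451634531611574629076020596262471243891145362173093877651774217414247723,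
  33888603659232655274906173384165013,
  3776693346153864056988175173860923917942852920076927144202725471432527471155530743404659658549534875884303722758774414856792391214632293928306708654545059332856716801075366882529215539972582063143324452546316600972072050213650077896020113738582571184075245925434491431415039582389245652878636483186176314763205023505196,
  3311195009597711705598052409266129430060216698255449927316128107786708031664101711085584149157818683201673499383003666102715254131455875113486542491294433122140790101358745638136169511653887678202373828146872324218232714508612241045667867818619947321827575544472872318105989727503736033799654772713228776376573998231843079017,
  124533163038973516415613942996147140860344007234560917837255215523069751510281377637942647335377234588468867667754380222301653180142247161678601503785692293387689795849181430593,
  1403596101233940578380022515069568553507849025,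
  113147604258564311441954906109842247887816799710735167636679240732460630951430983423611436971448477825876502186123376328425752382287764,
  548690209254950974007286856081614179917273031654364309587079589904664980,
  70370399922184470819287465496760137289702992231533630344417013887546665325680890999264890976587248450835969753452605067377173450367336477845505088443355509940985530011,
  451633895479834757079383163329014064335409055342169484816176115871640336,
  173801892688744074358151443326099860575117563946390482459709695288781729635238544438891420524293064793550907015076715919937459197013605613343165805498772,
  34187840709290332443331330803385,
  566126816488920743921127777401317460,
  15387186093620429311665335461065609839397,
  1506792250492619074501180187791415968529,
  40175524183755838984947308,
  6877332516860967174927770682685337217575471248942894111869214332961666890735335248670341335873288278594,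
  556712341505906334056580829,
  19997392798913,
  25741770824035151355026872135011521500152681,
  38102819207803731608923557507380330722407836957268,
  7087587582593923949279173666139655179186725452383351,
  48439887314138733223744504778712019942587861880390608856465156266375307054740,
  31913486492946275629716,
  1378014052811669924366947678847397321782671860742881837,
  1195202299827600599048636862634263083,
  26208384597769732570547231089516252077781289026173200521289078014283567984259256866,
  10459796813944000406696113825447795966136021830191432986255664870148256722836,
  2365946172546500405766342216695703957588,
  381832580,
  889190923536425499577550581,
  784823614893524725,
  451044380486758551208789785179527474340277983494653103712041155261277970642544218145039131880839234471460873922567876763766607302555345237457829977248168330724698686206888000668798277683865047824635019697393479786311617850131420768861508684104644194117571959443864767287182714341107412200937509858711693501271724772453630827796045023789655176550980889198896859146779049395104712754933,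
  395158704290092643526788518228892688004129726094076232321381967969462302519084499615508727151882132,
  166579325011272800027514518822742776956332857622187140370099721244344276621837752345332144497367101166388573012423890033257299571076796073369126628243397865784629841613734185974483851249529868749740958786888987093375681928286554175697109105509799794430070868,
  264530646172705229504827,
  1321852394163916133655630477960780562549463781584012409,
  34256326023034201934235326639700,
  210989618938860732639681389495444456384496167540695665185230378183980554030317280104367210216728298128850855221319704686377491574200467384140945829302361068674073679384212,
  37385871127818416377217998553748516420465115492004512889137900683867,
  32427082083228737167684514005104788764456380924507,
  11624754498070510364470792641129038228715444650659374103544318334315797082661339937597349691973018780430493795241620,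
  189410532712752307558618760819,
  36142381900932632867315957189229340869251534576741135044692,
  1234555397310570648937718684602818448304266924,
  395159518567914243261682772289832212326367898341872736499605592146206768722784351248010985448544508,
  62373220093809795238987541,
  965555730212480221207,
  900204313,
  9477229294175289316683522955108282123631831795666100449364,
  19595386713607156698585090645444356830023264340,
  192052886028389613690755974879876453548560196823657450259681951680783219887786966832520836538005228376168640492219417341478454972376600039006829851245538550070095518944835720080752921190624471327313930520983255415278935246065422051150148168954704053790323021721259151861098032,
  6613770690692696542002137685412984289624997,
  989597966041034136442483042774591729899447264,
  2434738095215021437210390555799241139168,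
  108496462816,
  52210669304184132569553250114617615581602627950096086258519214225078053663520456311855,
  177893336228837012,
  19045250832648084,
  731637109459883397106923051924,
  20828658670082964,
  450888951,
  241454243323686077892690927107583540,
  60588503,
  1311296555793091637589997558333099581183065323062980360807975583959565259369073489259536546879384934717060951447428948479981335814040788222259814875431259430969256882660181479489144188436058785195088121341784309957458165912185523438231466855261373477805746665200662479957070200196658751200490751270709804921556355895591566278409353770419802088486876238565749774444333032450532025860247716491872813907487644701144387926130909387530939755127727014166164374049222236592253236352525207411185426026338903079004502334674436533,
  255563020193433794393224087590474686882732513962078040125835468884,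
  851788964500,
  1219601309866729752559842004698432364933303700,
  6635874825782867337010284106748840478527,
  4734469167408499501144093291645734997502732393821250363188742108378333746683031719079267593981982062416998268948525234135345421767118459355534004592357308004792961305095278807242927630911749312731630562457961168947399374043789443273263100897280,
  64424586289350441,
  842200653390677743,
  954254804555032849131544108385223221300882677433707976840512500001448959311954409219147876794506814593513692627575347101175736883703013451733004047966205168382429761814881803509693253375,
  28096927782881171748479732770672901000551947476486056900713684,
  26167303121545260518373306866515068343057384804605140,
  824159991368378976,
  525486456829419538090421093489794062224673942550650559794658708,
  1066692500600154020417491457544967212,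
  150495350769430040176815922911368894198438500744005074865434339228347085008786247534865012650029317220559398949987296646530248258373381100510474519613580045285828111739122306243623870160993478272789019289999575333618867648191687360573763592628037888218205067379487926931093653273213208142930378228989043620542356670642300873009874730614861,
  1006634837,
  5620388823839196190199463058553081046444368668463962675210533389399751257316266678949678085236303642858803779289277158367929817478063294338382488688221223199826000438752337724162563960333189384561510574072238549371308030726269807240459627545743905130329,
  5106687289301881181881285703031641535349592595437892338734399402449031422834319361659945031324377596333679231422504233656176799705989475081568841526042443364517127678288620567426348570476463378126300412899255243516677473425520812534484827021731479828052,
  44292133803915771374096212191652434479814962728641570204415260819671986589046140655520657448645418343711417734592084,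
  190855714864926031884278618483245259109610458799249746288920327524570878326392557180592150474336353210859555741304991855701208953486838440232507808941917,
  1499572912898872119431711171822356832976605215471699223,
  516777203667718670457383726280129107196042660269533993742653606075663892894317059762127338973316784569959628323856399986989870282219326465856754122206489696621956278867792869145987237077446102759151668067149872968158071141358186572524741511572637249069655162728121662471677936919,
  860062715619418982903319203313107960141181752607827829120865242921765307728321600567168613305076974452030174956718699630860419261614313003771815801296652062715096239148077247838368090291256039527709850224941583986925483464232111882320654192519498382224206552756913495890879959745627569104737471416510048398126341337616443432494472396525933684,
  1418885569431110054660822585310261231954429207,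
  3952106930997745530775605595056655601681435815437876821282878122303039615042489661182652048594778899519813918888312676795056449447430770242129743499051624494121561304624859627224108456958355042090364573917001312018475483999200017177001502480576231477986773448785983803679447138341661595573524316259446741943223756731557482036227037531962706990650514200564845669254675,
  219951791247685167375863775931489914474746678082297202562548166401200931560378741976788623636308917687867818637328391640314031811168783673982402164587123182187720185381780,
  50616956321726846083596134719843955586830466469498288864111499571796,
  579143935882731099571444729311602637024446622115858336446925828505641672078133953909924709159722779267220545299940931131789887042033206475937518891614144756442801328317436759851003969690638610144888888827806809022334128966526317949685297927099929992903424488939878840810651330477463532400473413612942152286048570505780544339114682967330716749834739606411148459325687689804195534861584042132187148248951176481174179275982572792274291661326718263001341,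
  712488441743190410299204273511,
  190777767818226835061638051685205881590807868051851913633854085625143186255280091951677946813379684343646166473647679336194179438949137121900406835386964,
  2309386816896731408205416338624,
  41070885732953679555398942353305649927605748311802576110871,
  1434707206786353461373799002712221379531771312009084678608660926098012547785312732747537810652856591179178075835760249269392873690214094878391166036421140523102728638503037859639263378052386321669646430464488647460554805800756980572180136592877654597097433056686730536723998888861414951269461461766523036903784848938072980185208357856920939794392726227257173368100429570720196991390235298363085539253683731,
  10459785364004981537727978622242679339998074039266057204278801666860803059604,
  56737953281521671517600633841233540832371913846723203511537289201295117120238033529977245463703256035100951934694940533488968491363089226569237873623628325171894078425676787029276047957045044713971572564677019674162205211838947541172378713521220918452136900206609919021968965623907451343232777373093756570142212383494637281793301466352369109842274276259322410426159020413930246405238772934620556864704501880438046693357698942736718760532,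
  835368884870572448679970196,
  113592972108660598019153816097657724677444803842456138800962235725769336335104175622431738939496254454500589379512572471186130747761286011956559222286144645471418107795115996970914161515508,
  41952059301584510266830995923202418822377889522658975445440596,
  31561221799301510426690617,
  158740767540868021325373771284653672467038603344596838598873781390571481121252634619145004395652021107128358095721418287874829,
  1434594014107673317502677674318803691359735605384970642750331892,
  37973387371343745333800375026967552613364,
  25068458934969877249236479774319450441909667,
  2130852527556269324075010944418566588786851033595176218311282666637410113531284632622300707501674524838997374195078740,
  1601146677681952842833594267766837977450636101370917540250958838090276210571287528074386883345304397702119384700430281127141102987479757761608959761491700347331841402775395892121123246841745196720103581282630186070676,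
  3388352731587705635552817548347042826240192492852551357068846720694463084194051057916035919074730386625968062176841172680959256470546029128045468997158826401881215250188262521850020918829982070327722073238896725163195451701130305914806205428770333531649079007316,
  4225178871364610062267347494877458628170182190280754647022525804798454740917647079381175875982701724963,
  5230518093677718207235137030050641515943686351348028821921253328626668540908704912256121028302536896229547560739902212840027096915,
  2308831126629464345479676794048,
  35738297804803596850352183110132002295542657996692,
  3412617461478438936039122641784147170599921736775958939031956,
  2111701531145501095498225190156059449532123768212572902771840357569937148750509206465872939807507410556686390685991665,
  7772865707880537157450512089351015667409525328895324329556,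
  1016808002244284150648535144341699421864605268,
  2637024032265902613307614521571838022435998641049242228368422729422282185793072648374487198695617461276654254900215284556246049713858681320422804,
  53905203084353797652252525823676941805718739271200127818182127600713108,
  9858293920309384272834639359858424877235498850164018915060,
  85651032959854228860076737253836530378244323790510217250347810304366938912522180031739153153167097455351760194929110472768100050495458320853048709397004848576403637137966126692138053797636187510737810560278023788969461110236237951926032387956934563,
  72301848106019724165095957516393139446945908223257966480348023576402445166712982875506409,
  3664270176448350368833188931461982545936065931164768303869236872501652,
  1123336018957563209904708126641,
  159387642160102186015899209275068758724009261972,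
  7077515821395243886514843534609211173077850659811030499322334608598294006557605663644561260636951303874178410553137625407449516973207292075825447364547091953087230029926433822617907228165707479679016618193144004080725256522720408339263874223991025725473710124226552497399383752089061038021660867063874158705417010463210644887464911497634746093075938418162208674264481935,
  161054389898358369766670570498602315897255850446996196606040875973003924199382016977064266661042131005651345247200780923569345,
  740407929176,
  6159554771601388972096076334761917,
  163256695403073172,
  645504611792347333389,
  541778657551283916102402855321461470787689703312863636,
  12613675434618385656383682252439524507212495975928089863766031761799815128352911751699093932202308915551850290265433520679325926114419081544222445786612089270643575529359914834758243484215056514653488431638862770382629260962236070615450431,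
  5069815438315706189394947819650805065225255501718064420668861949920142399309346111814839331983678766615251870069900271170782606392711678352126154356621898620105321332947237741558969785772551095680641503709543165402975443775339769457050099672669446187610347519725208692129633294836,
  3708953433381268,
  473806964174930403315641390539978129342905941358425061501179782953945441680389998663929447148956759190996295254896314139902439764378982824423371860,
  18747435749627214665545751217986401830333,
  34694797302676,
  18227007759580924779169187738148393832582470024212570834831895799691061907383683290646922479932524287371773459,
  289610900287203979558761690099216411746251430264321686834645461724922981182912308058657999395282206719202228933902918545924020880362359851790281531482748185331749162130000523467063701009758765603316,
  915302256369701890352054298616578326675157816024295621556579383782437144568548876068938085128847743250733365680531920647544620966947005286790670852820696321758805513716,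
  31321939117829962122942618463442572373451514949320550758910686116569908997424020,
  4400280901318886136277239647026389063796687,
  191704051449479701080773511772353132181543497550365754714620247527249255042957337755004389072275365572851296275262854274692672812027725246353549152549749955269661762763485909274431182643994178726531061796228280762015366828057492601313329538459048522022238256168070548,
  231499593843076959687912505062141514443468523319282102080,
  14391265904751815101631009043088520716324675736142746473370618683935530388866728180364027669352446332633169266931809687117739943842664289404357,
  12770738991368637224460243425596163826984683624586781097801549779,
  55698529470906573,
  48397886529937457767325049744071124625528334786619645007635868224173412321084085910639184200835884350847046361507763085288914214915841182505287131867381129420133860585498330218945176564978697816808284629776938009063795715645830467027150519088937813109817517549158356576424118623350093450447580564,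
  6533156858805374513585420559215215200900844146543592956522062503032509687746233691781589455750244805134173859548753891332401138208372237511822187494647236559,
  22054397119348025641051698863454258788488029068116632695192536114968986983106832105982542244153345733484182216697573352992880454586411616107205816489486584037219088328777416252138536969949606969867,
  14036941014017220694577298871935156097428,
  7770064042130736529033768220495014435510226243544693884993930433488649952475080142183492797050166862635717254100364263295545341564456489235093785718647419400481848566466897614798537743246352509664470393970353880319825033655987671906219402116046507230163799989046676,
  25920029,
  26176872813244723234900,
  827538617405033168,
  26577300476752,
  17910558244846129283145268859164,
  15914998901518104161307188659343,
  67555219552205460,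
  138700196,
  14207082184674083772434031163101406302612,
  52247473237564572190990707394195613775137361108290644,
  21990601656155,
  32486681762666775044570324,
  744490733,
  38274380491432151379359515050971325432084909666708,
  4259198336337014227610368918706424766708116,
  594490312092725908,
  1673309448211440386113781007312555944161299119072108479119670658739315941206109751877472688476188153496338080514145824444646544281897272599,
  659446939770766635785765392453576794039339488952058811,
  43035913642594748958897389711131433921431072100143908810228645,
  27191453276664806508365,
  647533430906600724416745921297032470441677895500378578631577481037108814014104691855196425,
  10033067302656,
  78349826478901199573,
  333379451434714506038221420,
  1451417929401,
  28334991556625193500248,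
  1043711089473717539,
  35176732585711854365270082668403490561428,
  260914033002590360579726602419314068,
  936379617,
  165284090827353227501,
  9727434162369630093091912154795647346060475403413182939315306995649295700587920927322134724825577081137438521970070487134606389798899424849245667820511742841743007566778147122037265122925813041286743573,
  1043279471468289223156199573331234066972302724,
  28630076399280821666011,
  2451362052047453,
  23043072,
  431934879534488343851991449712853079,
  1444484555131309464134275778259977846298580776878835975889340074457999531488666533534597845756391080500704988347293531311779906852918868,
  1337975065169877384759892516753371932776416833300886104865772452485967052742983921416793556117003021651055263482849,
  51317659947924300877529888677641694008075023997317033613164852120549012,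
  1139175236602442015126287176136887928595,
  64597373352313669,
  74880911339,
  900438712477968468,
  1223793748875816254316936366852905766406959160697535232340190520528362340560286922514487728604503999295,
  773017496583424712074483556098322273118823223922561831558413489188977748,
  60130509,
  1514983302915699050763282677169255762481366366528270291030042231063392841171012697537014864707567412622529311232777296556916887580,
  541614115429283787807888020,
  877995618270236119099229471345460070333853027766146998622519330434129914537347529346677393449383378486709211289377000052716313720342109129166876,
  25017008791346688,
  25844880928923732572244,
  719928645140886969916306818740137902120126954146142015507283348,
  935105450810393093058600324,
  348857498448511914865995582674706164,
  365334399224202900437492483418725593025226896148961979130404691559247002303762805827372147302273254495,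
  563990102197623272081642327043296092598023466508502382340586675554078855114491866602255945231365951054395475181579583062980682316203819157132884,
  29856992056211573835105,
  40851256224587473924421601765190281925430629824364957653396,
  1298008621068273647947695329324229045339805332,
  2492911893358310796062155626100185555177477269285229234154048960778847839314895182607472641808160673907344448880346033468461721827307453802778705648250025734456886393801338180960204252012900244,
  117703675607215302431070525736480677830775346622426072306744975145368953635570823,
  355713455416248190559667179387303735739007363295656931984532999283693810851696020,
  1745164137019266401272917458744924186185885061331395071400130184702004038706945918043424013,
  1979316184142657463524753241817138604321738758247836042412501484924007118742423000428243866887305753619202865,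
  863937840395362567153617885089182469316660091987428957,
  39547231483555315485409088298081713783601,
  16269760940833849796359284909341155663764,
  729606366883610240,
  739717488257031828,
  222684780557738228597492800086203602706330488045075680148,
  1386837050521641086177664151441072718363064387245100939518039124,
  1193816732561525170462644880958272572789362580,
  20794063833106255,
  1061471871959229518952862440604794375242261890140817341795731221787286867685881548884,
  39685918517709410950384380719554268959952097803682666278292,
  397545709690546005696831736911270240540286436054402773,
  864723332191470228,
  1240705700986018213806269187597799652992525705616711540,
  972527247489996884,
  18563949730976142450882071689469555665446635221,
  30889911638610836,
  23346821620270776232136820869694883,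
  73711321644151917101048994525589707530281694195535635002898306982924858057137480109322046767662276752291049725624669,
  836114711981148388618669188791250453923,
  59016152773554648482913964336450018493285110468886356708279007583155706420922418195238376426912592514005631080020,
  49817900758084376189329024755117238024851381729973710494500259,
  46536263350951534136466692776419937066517294581731221393185450909292,
  883832374988539917,
  443931328640967988218815029699037203978284948,
  1147603003681575316,
  37417621971005524,
  26663179049472,
  1585988767948183175334851521998987774437470365878718144294568455558731366238929726216749399879718361100192867887995796,
  18008202218383278150486060743897069011593613233324839881978266932762450997140,
  4850792382795853762989094235606949193049986446707902567815778544571008664605242484411422823029669225496,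
  3452369721786059251443723894827185461575040286601108,
  913279393399625300,
  374434267749800394166365934850877804954397517978147082772594068,
  54102007,
  1657525951916326656453396108518002079111026347880800318620840141048251592370067265550280537296995171,
  2058891497218598729857360163695976412374389195391876129026198667289528901312566682773260752845163175021065954062084427912555587476605740493938925566160921664773101770771256647970433122716574528742992312550588056282712511329791540858455718492848330936676596755936111587093340179967431566864677101208381340067586635452944596884516641023816697348220683247709405877487849024591261005258304046619737307090001636474573629657093049687722068,
  363071563,
  97795082943633593219946140131863375293765747392005777364210748482380977139747953998478762376828447187447532369033229887807109690456621387167977249616052961245778384532020706186422672376088245817511879597717016784748010187638687128511572016449857333901320243708614064388686873781473220520678686671211200944374945,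
  30625428267414026250340657173110187102612,
  14969458881612921782268068020406790945113623009700726573075,
  1499291612929493150947815325836261083216811122258788137004256415000885083333329691,
  47656117564128501667526005687167672535399917945058767990997782713260059365279047223461,
  895231348104132180,
  1642213415787292458802278047028671136663151055043708098524199183974067450288240771465332820,
  233971176859338710518418728729995345122163409280249916875650175428729803412368557915051814527043773425615757410129145220131210190782738973722431030897210743322680581720181909884552507962769284122528661919268618852215401934253891546532926927001824633296939329935846576194603092,
  58335397445444903472839033854689495570932340214463685822014345168230132081871160683797780290680859477794951197172369189899294921938092820492,
  1150579481597574663171015385706694067227469908,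
  616785754451734931201669402044689030924074002733273265452455159466527492193206955325174072303300654586042656067127142718284783214774033295991262452470711597719474805410831241304986423360024561436187939497697676008164991365717287525952678015168774630307413237443429285836491963630031,
  28537935579390639080623,
  502543650461135164458771051685080154502522553578474247850491655742178662978410030507204316466811066356723870061721426590641282189151316,
  33739422292998946618138907145795202296337778727133485597861,
  165284090827353229964,
  76077636843049848514903144850068239387275663414077623764316500583961008005682529169467683072053208931802122728488259553084042918334198510608706735801597863817571849968509982197584883507284,
  1232813301377242179434176649475250814992519060,
  85822478744306786697616169607714270383986134339694676,
  2337277299161148821998107259860567647280338133718423829332675981119334987620205347930560378047514711821983023799992643543039708260453789407636885479877289526595795962781606266309747134699213632954471996936228965996752369979444104185633541140835074163552386640969986594173067780685945435834626686929068993040838408537938455631890779460298456553793907671219738540339610568774687926483927496116684201038203600969052343658647290643585846278684927949359542183709780,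
  5272631767953522545469305324838660762761399121955667113278390706899103,
  95093415507748737858999096449240359114921726373004180,
  22329773328206229013530797,
  80270714041643668,
  78079083005653394217499232491,
  18968915755370509948196356783236314812029479266397785850242243523870263662956792564023178182036,
  1493169657138917689237407894259385923508662390093040310053175459220,
  926638336186778821,
  13345469483101088213692365692906861370828,
  4446731654581504458307435327840538403954324487566696342151059161378869774420031086940532300345947986004,
  8398587198830403805658371328245,
  2466864720176,
  1203935752057305956635217782889848729055965864791907107499029372749002142144216891104142559483,
  9005454792855181522368224332744391865656153363140657037326219748446292,
  33164655087774938834814092,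
  1285603031284823551453494625358733344743212152294890508,
  5279576193289542798594189922197066625924060913547040518762035590989450537551685816711621087118699447038806517839143799182639361003817787347277006455213459537248635524532315811902179333753151120022055327540836865622402334370452599370004243810316,
  34283946956385314562171646309406614357631,
  338692185,
  1206024367760569954993412080174723411259577940,
  3428554148419246730365375441105203987434874087985383071675066282469518833390762845147438952921763774026538480277958653440031448898502351267901906772518720317482276912821983499965123462836934029377408928987459952242426504235484301034615338417751531314956310558712729880455512374008655034865867169485160471069161829972,
  1066692500575519071557356259916797612,
  1653296076623266848482542190346611208661299299081766574628525700327188825127285415850094704775907412,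
  502103443793768627218631129392281820533658070864783647351797630526700948,
  279185411,
  36227476230624981762608278213288762050442780521558303274004462176373,
  533733010621305023893697221574404435711195813203549474,
  707722725475386060880063306661328790888034566203831028466439406477368442016647572,
  815948749499488757490918414853912433294010583783491883275658890928304976145664714114027151425161620,
  193233925844783087707114393346887657876,
  505948852107674773992162548688706501327211924,
  189499284476878666322155413575714358446282262093561855027004496388853206213886998663307987061,
  39070900100449868028760267510575972773535720571273621,
  21597983565532107500615502131664752222420417357597018444076869517720950557076,
  2567367189658711459105047,
  5505321704396238504837603932030001344570484078966786140218703044260624098875059705485475386231276639173930702230782537353595508628,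
  137738675147733392984405769108,
  39158044457337405781477533777278021286150529850974013290641920273040560491306325262228,
  294767912734787251299761373310065350546996319204903807599658235011133439212957819967877339223043988,
  1476056865895398267015478760302628347784153506584345152218493294077464854612,
  414064675890964564,
  13572561451090561,
  1294702277434213658288163019568276089588939443650325102328712072833206179964871770024874261251250575780376756245748123957,
  256304541137831749675124981,
  1626156846882413996868439804843163249176856092639198352504320861817935630058365526792730266148563003228029667,
  1563196589157301724132072367920035800120065131288112499700400979,
  249231617485524964355597235215663805,
  973602063009218000238297877905268030964499131,
  681808982592547693204,
  244212847971467727878274168,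
  206394076662206438621829440316507857,
  5201673558906727818301651151913901200043325143081128625365855453043971117736614156958791662841732223299755885181988028771558622819222844254817021290683787609652716036005978889610548058188787234345617265749428646269852778003201645552794961423241990612052,
  100870611754209186755725800352298070334909987653846234383213697860365826436386666064285434578818166882470523508772648118754996282515020312455194346199,
  11052909124604796995008431874811582908119734038420,
  42100737782597747806275564714516097075668632772944174490708,
  26167302975194020356353953844430346905090335072727124,
  2603419463838734919182104232081,
  23595335,
  14185324115286909938561063964953508631932808156848020,
  80618449988228035868599837039082888044542812264432555023850956464631154679594270174733183900981711215177839830547553058091071961410097886404961706391092975603319250645197215545096830207407448097508419533411171521008635988,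
  24052685080697,
  261497313344408917695435198320365836470947630297862078205777306094227091387176742285120599649471134450953545361008642982321451370410859164179893096497295674859900402548820,
  50876905439460361366890656282466850032674578324668500,
  4098080938048385804724363879381076,
  1082065675656967849222985332602507903499209843126702164,
  31561221614967647601428825,
  1660371999549255881516630913746825363835868968554825331059647470060,
  25601092559404902856263737,
  7170499688873880048029891226051257082120368820308,
  397239552632267304627762335287760883920162196,
  2577009427302239201363961730244857695231743200392412912464864955583883595784112919590744689660869020403477611697095513040936895793,
  12854061439154251003139158971682173267286860941541643981601994786161301441948202288866232457199410701531405836120980,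
  207316246405430242138642028858814077556624526466282034093395806018023474490937794106459830324917651258446056461828613154411180249772728764463200232436179618666231546740171706838759741023489278052721774121596492912141627817092568185112824566096415634919942020886786248890885725405083529113941511473775449365894436067034328129204670967823767862562937077921167400493846462820881515020737397897923393238437029291687107727080773850410428763938127257729340654098819911270836136522078103611878011369474741146077497686840455316170148236051558311287848404887097190638091282761503265083150753227252752,
  70170930339975320999463562730779896635248276386119049123916889164029,
  12628553800252349991753482353184008183899209095060,
  35684756752555299938491541908172078188364420909675156,
  196969205358759213527111863774799196498698616731522680735625053352234897492,
  416731588893022569136020,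
  48404732641509700964427838269165513054080413496308405448405101809884488737548755184910184146322781056739860928492365000032850991673066962003238051410413780977655092417905790174182921178587538096771,
  1818750568541705278308079332560418391534613092598134991332318890900,
  1952868552867007645184093228665951096296171456819338010526213493528456876116,
  15505647511781687331080619933831845417209657761071927,
  32553824087673193613912774269420,
  476609522285584037278687955337,
  25051662489002525590217,
  31019119768129300043156,
  13862891,
  3255302058193770674949969792540592277585,
  25033213237923149515151,
  2637484204045255561142202193595970743317863365154592761077828391353076441533179185716104159321938177965291209997,
  3334912691470282198004778595692053537175607007206271328937314687871128858231858219112705160643002672327590483955475965571994807748602391451609844126874790683464326235547666864969583455483844972260662924316358700318721619096473695500349355502363637368674885958285684751254717429396500061292875014186621888670191946831682529594639820886245981458004674840975872215533329770696830679000703503350318315109831620464696034337251829870860405311747148799906248684868958008554117108619486410569686484577875991593044,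
  6494150131689020301972,
  4327061953206928727032247984023414098207557690664903004156703681757368158281,
  1322471006881762178972308879770586872622973811625843146894320078674872796131283276114984395710911607116265274134781515406682139179732240472331987839198397722719318891898405529287330173947895399710602818856480731507635083859823187598119320808776668908578856860103414512461387001661143883770463886411323098396615871143467570142614352734526183942741866327522835740652632553423801171778863555,
  2835272173441763442682649669827704783299,
  44200856766450457728928009160962124345932259793203207403051768654161445379235888301638565,
  46210972760806057089697097367988295819184467597273746303137979784235273,
  1588301604517281406248940218847953409114899570008572396261033840867489590930812975390588292339309078906541570677260219022752639148417359671454881096771977909183481877,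
  1209833488256409324945922452,
  65752313524033647056410083562720779470085017591872760980897074746651823936055165559588965851323919380954135510792508394342217529218362989126767395715635770307400633770353249140345405293904779910093171505831541642067658387584385539611096639876397909047177377357897228279214393656784813432177843385753434193421054425751296429008097769531039370165956066878487568889432554783776218556336561824253465992226566663828720176050020246795086082067383241132678143838017240733094205577561615385717466058013170083838947879804342528721056518673147811963692569825248372,
  75475248,
  67737615897037177504503309736167914106000137398356978476468962341426107279274367996009779787976058366284918675918136245650166054416983893866580,
  27361793,
  81311124,
  4141448521766378455962964221791216684907246164902526924527227451341133522079590340278769950100,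
  1054644822757929172658786743141142063397706273144732474935581775724512774267208137,
  362513740747780978308733702661735450713365330922203814663809506098361692429689974275160588255719118253593325761477005611196419120327256509584376542125943886449486322306617552515199954887319697651604,
  688183482022221868805227975,
  3543875242375436821599726732878445397260691310133,
  38397131940117422328849532005460475045836500620832148,
  702546246771049962176951028034452,
  4710625957827501763798543404240398022709244727288547164390353722967546859087785854587,
  66420915,
  5058011385157439665050029992400870647094698881877372975851960405313301261142079213271549345909,
  108151168062269921288842195096791553454639553,
  9002374788440952408157,
  5058445721470837732292081472268972676102298763338250418220692733095260424682140794996665228236,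
  440697008109108292129651610140893251797,
  292457479076450388,
  3509896932914735612710249136969287070100212949848785093710611874985,
  40124739233998913377925155354935169069540154456406313871295101960084,
  24847310629797715060438363137174126595225914617421403497845987274850482751957222554149336728713905716628,
  42041991750673181743101495118945325392190946574544829288796643089359037201070060376164374147318820353679848790525061992460786652644456113242603,
  52979607614073691525160004317536445882691873268134239070194137,
  15526912371231191,
  10367568693891322059508778945515751933742049013844,
  16671895234521351437387387,
  18942465676472347173416515083596698601581976261728,
  337671875328341574671951424436097696502482598604418114122818202308501440612191091273349460480794082058142537769583439845466071659878077362760545319635213546370023683000773181240721870455137,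
  2000806337286363122798190547752640032448829738676733203092147291785276107370010218693604691970373216319620038092237995308694305775122690110157263547148312053954100,
  1529503608666867790951022379068252471969119685547456916,
  263433715355212756430189436284035546283249748,
  596522857442488416767648981182819016804579072899836556158245705385070390400706183371909593905888427132971585256476509851363965192109653786511217714807957548527790253261846887867530773692490737093700419269847707797237007635577012275388313212818776503113526936043,
  67699040840759477234664581067573890462962253730798407308407158825026289253802390063338908673448365931116135720087041503506847539498644,
  31560529653805445868914046706066438017368336260380,
  403752660388978356325474577692955572808196472258858115166515867908730772,
  177961388803079545616717468331180994024435135884163228968748475735132360631299601529754001443017572617945425,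
  7219055820808392542095283491191578501172824479240918523489584130383722774312805341222801060768063272088083024168204426501399661488338764267,
  988075749677653033639,
  5058583972776973206218983790605090118208766300357090571831077998121144490590068408703150647380,
  21942506307418437302462195261083722881945418600709880827427590096897728401348224111482364617481412804953,
  8791863265768721373538491814501228598174235630676,
  7219038247581667110345945807484278928399722918484212259575076886800463782185821907786528026266540346588091929109328132791862748028430609492,
  617439544724,
  32068706337139445038616440079493,
  78795075740572145872228950752359011005080033410541803108454078978987145876049812,
  300943485,
  12422860481405324273868286319524376216546518763811,
  1650362018784,
  328827930222710509204245005,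
  8936865661472932743739172813734579799567652369898311794134811149437981797685502774402311397705250715898867332555820882823639193860750315187138999462669786484358010772,
  314438006741169381840001337248884114201025520028875588855554439463606362123614456186085610553312145931923533406100283609612707637221192821368569442098618406341365348793555435149204,
  10007905129896215236960603778118195201675020210728036973137596670580846352276,
  68730175959231911243144311893629661314870464898089108134494274357557594849215895910261268182126034766979563911222249642322758627422695106981646986324,
  480372287664784969510356421162869553669109661525370843465164208788592119114392448685465520818107914743763966539106789417564430068033299535335139655510952742479745761076212321947878356213623274986194728905946170118480022843711772325196925568594785534271317827346190101555319375049016884332027331252967671630381531090491702578301574240803112853318867996925401320172170163387736784069055624444978754643047996996771090919113594831291197006030827247567299322146147487209979856705049397745427190480049586979268926517428831504473834035296993451372615974263215654681324241875093566104517536265512227616759008180056467100606484398080220757479373964763081338843038658320635660913748,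
  81364148,
  81364141,
  81364045,
  81363869,
  81364117,
  81372340,
  81363297,
  81371010,
  81371828,
  81363175,
  81389748,
  81387700,
  81390772,
  81370292,
  81369268,
  81364529,
  81363945,
  81363211,
  81372834,
  81371756,
  81364119,
  81372780,
  81363225,
  66635668,
  81383298,
  81364127,
  81363399,
  81381026,
  81364635,
  81363583,
  81363613,
  81363383,
  81364115,
  81394868,
  81364025,
  81393844,
  81394796,
  81363771,
  81392236,
  81394284,
  81364819,
  81365079,
  81365309,
  81365379,
  81365401,
  26863002248867065628465894496869462272042360661928463715688425458634105457209554208511889385421193705252256109235724006819647579524149072618761428804090882827689621886692882793416712362366499571860770843089503399644508487468738846958028502339647332316465598328762408968032677866387532016790309066826411302616560066408177281113194160395166592957980320362310609562931468939207825602134426310045308230869504403943995104418236567409965925681,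
  1535773250363860351876016766020016642391906727205604287437453760557179296400103707211617900,
  719587863,
  1076750006992627880621422617142881451897608218419456451430613191608742224055418222467703823185503074358247924652543929166448655733827102072210290469394224337289719451290796330829056614415591024388565129225326247692282302257288163264750689510311422008641386782674209982614513138076848950197661882057772782198944169117755405544880046372109312322060940602117525420686451384135090281655616716241180588206712707130700400386129583226481350934341907761847806598924516803741923,
  1080117948559549448379973503283,
  29175399573166611849059851503848712872143355946086285378525647972026626819434307733589553770098769794758048095879663027354762452765160236081606604635205239333,
  867299824955121791720536605123584271277142328995621120493374781653085876858258151,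
  1801396705173371997659021183213748361975263875462947341039069299866096847087212171388732992240205569417715871536092722042163379773517311613274450798641863289622876,
  4692951596057723257688327469141000002778890869584702202740611819605387711736071334884048924023574905038995861385015297453012934987458172883113779978149762826793515047509088277997020739307859873148500219230820110021534720233447745460168558475432849882487562757446654730452275431890922567365568959986261600628892973545720399745585921620,
  76273568,
  13849430251494668633780074156583900762179007817322371969998924314166353294267393595207056691787955675455708342580317487460586472354586064194181,
  23191250003826155910781295692834710055152678367347181013705629611256142725871766735493,
  201919259459556160541139298782653111407358879358226094726626193652961571280452991816818930529952661245274980718267068932098207979715566665976916523728811958963547489696707460837143330810229922728153,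
  744329235985850504482720268812572592431726694234463971065072388006718072649378111172660067528088955989010915039700299814629806908648887605562432212507148062671360816717122708482538666916158985398237612302109931204102104474864938920715737564906088058767531408712959201434151836276,
  1464978528117484476144256307769588087939749142622186822786648945650537358868547754080714489641231502129346888198572691293932537076230259953139877369801129428063176476342937741166613109491068223748419638052275766523502559496515483925276539382451301537829298612213121470149151093896240767317342597252464945580023690738748437529941984568289765845289608277992507297702140392041328393998691103383014182729491591084686162740919827066447838353618577075057828821818751199160040796834052235384177566927335855278142900598847624674422799901024992852,
  4671516972021096072662319747698363427774252647946596534880553,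
  8425446135232485389123391491985122232334411949273496150276349495863,
  9713878031086295417840265264908938543131278844160310673909885245802718553685459863857,
  30748249329803145481887735311864165855608617226948046307845334244770699618944884399428945892573532916859276016235729704689316086983919540012,
  175239343739199695778579391019414332910053488882042949924725665802934891313393320548400681826938649086644124650097171624376950988535920298785191011019861772770458304241225601536644,
  6197939507674971525298885546000215001406255817541453146904256536064023996923870469736300223413285624581172030530248905667349466322563819979581378652637795682643566418987924502145375456121351717429575945328516581525453607335716530602967262248994823,
  8632166717436301372981171578739469863302603424818085764463868140842367886315215293725642260396481291860948731482263263070636465427737348212688051791647096916,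
  10775033617927501110324825786987,
  407069260895057029209333750786207297243523153388012233,
  10775038375633280669554451974177,
  379114467925160162281941617190931893770188760,
  15378641867834254561285449773096918614864542260209678115089623412781575047327,
  31198709393752,
  54029017759119790148641353027379624497811239717131525838916523077066245157169238344914186296419627826855150006920958924616542226591805559727871438066620288981433005763631297816595395781697719186134493719920822257675557432386484525644946861314393236554359028066879254722134620279805978301528273905237155121506822355491293512615744696456773602669401932085683518379208006041307519126037,
  9822065201064039090443837777635552349233569214961250943480171367248061582530781296663352406117573883176734234666509803499776512639763723310041879356581489660087386196,
  37046757638600169883695,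
  92180538584224624700389409486476127422238983585542849526555160,
  102780371811497405458740612574280823596919636545022071230773170859314410035224475919209725194080648819374737268926469816860775561374339538032265365760789858662619972939960582635675263281186808098750978617709638011100567258134112832592936958957210181836509131187237599807489607764160101808901690149139347831345102656068639812056053831282724626557541219838696635433413024514460192963225928266213104452229327157360183441422126080683366450204352473681990439634697163860,
  55350260102700155863236410105184897675490352442013000460601707005968546726070236093487071692338421695658731328297243601219745115072091114468871998692263922532402838576764799725024372174217175220326699538778033563632537609540821740873482132,
  15378641867834255163887216370218271943100327537182761377769199647640929437855,
  25004557,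
  67559968,
  1663295030287352574412737949075437,
  1474439471534591415965254750641324374214287842045229890665479525617516628,
  211431059601276742449313419730864146642169686007186256476283001796912482025411739157243540362120204780101518301857901,
  34903611977761481,
  854400411140628570805402040777562027291628001442867802534550924062601784817913636221833166178852640,
  557522281447290956158440145008432024987531348,
  2964691603712,
  373524625172867675838506422080530753627187946342902204753205228494992788487882931549655063305099714984576606768633732953036822074422817629798486441349822532695401711288676871429186372240683,
  9292805520240940552242079528492551889474342379824518511995184694724309355320205302165163281956163078298679522931644340652546197045,
  2170191722684621865859713683482963756993428439488964895472554977703928902562344779415011204577335689829804508611478831,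
  61682554418401724227430768696186129105011439247164256559979527876706540019535690605289891360378096583983,
  554799603897001553234321111170406280787730099587989627787669460,
  299663366663619290270505815957092570726838250326281446354591623956397151119398693025620003569379509477311682895968204829412601960205212141369033404709504361089815537583940512167379084935864187120973431986802994651790102466648383490590170053934715086973966741607209552130,
  1598914258931944354499863178164679654548599868595021943818722476842454003352830861,
  3157296956890712298122656856330974132166973758873274156788601951560897551272767236102312069212516209058058522574795753750073447512329481723840769906868167056420027219268357377038044735676716100772175918543146684552397546335554097644584175156487604112269991876485550444911062844735096553999265746502315910827433536799491037483284661359699092667883040235558920329109068117357717951346545475556203908535618605239595380941213351921823452196105181626516839320383444,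
  245358524590281805116876412967760255639051326098061129283484192872771385643944831477780851720569531855525525304158735848399247666579159,
  12239654917664528001876178479393338108873482910447998531706766822218211136255737332660948623055869005057645125387930224347510046008975655004200769839164414369806978024407658044465057186104478029,
  7438819854799493649875779273538494027540289222893388778291972025314288725807119964041947512068420904942479258432088897359762459179,
  97600179300636050688566440417551205295928091484034231146617967945009194963378511625808049491074369571371927640761643275529599253056298747911331375042665151103014316165357578398106388813,
  1645150172141568519886465268695048190082994939366356995602384437,
  151551675791065282907068403227179317481734686016292194405602441966456508137342517,
  249391974654631372640496960186525322607158465044416734224567500385726664583798927466853718261281468608308000559189330702265129193165447907772749,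
  1578721722324958744640685187732,
  45907460601358647065327785439553447296137850242949319114644,
  33400880743391545705569133049386277418580,
  1112443086123034865776502638548047074000614061951628626228821588,
  246514266478787783798500191376276151480773948962415858931238610657796809711666819217303232078456752052993941453017479326878612296620070069452571633545757569921376008836172537046500164465177451169144885657279270296026865228261682567921603397724481622413702009120798744813944739807561306340594935588570639525449029973407287873370294863129856294731943234083204634386336421957119948988004386251606692530502249946348691236912896588351587890448050152096587298427971434305731663141513106949464527719579160225979638762421988655079822550549848908728154309127098470391178196064802108,
  3736310075270173890015275186518503542298565963024,
  1488887810252321667895578047061410239935567539715840585198179345121691844484089966719472320558685214638361831915003426934472464857520095865595498500546251163119979542149920672091460252215626112845371824703635287692819057188313115368241643608956831056919973940245367841215712947177732960506292070354464414289149141057987915140086060559766199261177403982399963746758266018410384265066793249891675433494938291753438852696467191325641219459382836900221982932213185027684579085054070784836729730481021604468028,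
  29745928688162161984586644,
  1903524413680834840789,
  39523872471791931400904105803891124441451257,
  48242983807361082246516543444979703874690254482196643200916,
  995512150456964872989500577284617687036706106605389979867257471300404384788882617339012461615299422264182969311940106835855817773463375768862416025900105048259222960991707247791761504650550917856321126535178477965994558305597936077016129928798842347362966685585996407991544605003194742980640776750607551030600324160879237632299920919817952392727954706226651190272085437894169325810850169069071654281100366932232726161178760254209178556449988632017255656293100655155157855583369567218604733332,
  349695238200940288084,
  40990855567127484879554450470271759465605947106798062517988698754945575968508,
  48332748684487399515542393451209866582580040674322340981881233148263792080678675939717,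
  566552739254189765674605581266694966464334320191230164985215244529790771540,
  33789905921781191589796892890438445418644348995015641708268,
  18219851320069,
  1002938054911615917190648199580197339612580159809297064859115213683849562705,
  832985493065464809915803032,
  58553744582352916858916297916190498707086055128517554583821881562888217841936439324290038592811475134931726672332059915896310094324526031917637178730758969598249876468816709490703765926623668915301429810079521997224342931639861456564665845050412709533656596909916246388565275101368573436064929044484952754241316724524148460950984724754172369524970799048348019602690283374084755488029402600764,
  3640114749281680778287154561078269546178666466700000446878982639048761908188804161750886730501609598872282914982852214165396270454804814175721140253077075767509724632495926593774088983159893123096162022370587197669348876120965879897624595007701041763865540784115979572404576288804428223648981580059774050442439345244373165225993886973852862075652478566620533402983511947717012030067018140407992506537907081588836866975816069790849997989855742869717645313647150825396170979415356,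
  226997016412856839898684481104666181471936851688032718640475101893787920678286229168518248696681829992039350852798453528260056,
  119652373977354235023719490478722424930044305,
  795722420627174710749596296382545573243035708047373624390868267590745335280227313694836849,
  3418830736353428961597263447837,
  21062597098130058296454065215529568569043653976971421608355139987392,
  1980640688459092995750477556025312895063303777552,
  12658472933477209399254993509388252548852893770459216736117692915032040744700537207417860621838262358492503679451499231890477446791979051985485860327061065230814774287663197484899627191177343312,
  183366729574313083170559594183757029465373244515068892953760962330008828992041811617431751300056779,
  79962104010487642543118837024914675988597251,
  24116062328553813794076428290343429529827271914307093424231837118266906337984925330150922803348854871762071485627914058135292826479992919465601367559827441667522291911854064438033593545822402564291444497770499105591630154074955072709459780492936116837820316625663089931876244,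
  3281757969692281745729978600639800236298122204235286157643959389348435676116492130758683666687943858530702452567966575,
  93273738286421187638302616952376567712014590274275036136025274280139479478250849435642388578177143931029,
  922312500760970272549961636157064471,
  51527859835737705065363987774623755723028742149781479343847734693903164401223877875483162475891501,
  35607653241635101299162876489428649008002,
  4358576654147684882682020710078331427873586615965828933745511354621911078267631139056026682801554326832819772667346104962026185468774448144022447218689711809778161579634641218779361569423148279889808008595608438540511509384476988121940597329584323910241831144806970254971661857578788719796375830477128582864938541924588369426009315242548979381812802945599451878098538431818820570337941385590900728785478125822349784242529624209067322468875031655305399991741010989786862912643218541112398555362096,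
  1211008049163520138232827620426503038572694799352961992929247957178136354120711691622034001211892639055605765288944792685662477023072359451688067287069022191063373101849390339675790214281239776916306921481134393080699573548150361413092379549435008644470631102963036658991405642799778552497039022027968867669550157642713665938300711360,
  1250080656366352508558656758550741075856810939332878286648693582565831252,
  2648817381520756724685583164377155678750838140682322655468535779762012110827297225246196679478372051826592102011037623056357870211052863165315429996969415054343196558952391241949134527874199834007588827188456314607966084696196422064006640788305595662078578013878434763860020057363878795206407949002958884423084272068255556468306352677651505965301811008739924494332320125918315216784836807781834983724556311652967381321255763636257265,
  5025195320846397208386310645954311526885577902456785862500299861195759003420316970230655680993070312685960854166863731586257825567000532271586394542508593840927760650036628398677555041134505923830888381262767540940023846303823790421109902038463767739432008414162561462501363477811150701834437016693713580867710267783054323788381240696621657354281370194192226312473023061701028312724360019361601522854972572274200440129385819481394640489503310309608068999080315266593522083002140910980687436226732082700475804299348,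
  58431779560686533816418485758239469614939930852377460436963534926297700356437148893951385784768084958005072385052,
  910599887925007764,
  6685059049885597944479729607784830896915131787922797958772157114180725098872224652739232599678121385175169729043920172863351095255430889181685671571113834333515843978257383146445562112298847156743160598897300,
  1288807193188467208902967474606378901254804930130563209687065216132372881844783319834202592272042825612115464397202294639269880962200039679230266412121469644959498759166321686907265735145881376358610664856057850742220400747664203681701079062551494447961675215184368179620874718269736772054343535627112672298849662226447427136241957211366830669469921909478942039298426755547045625280332620678964293724148228618531826867572178916989531357202823241042274877760136908068642572888125223352874171271241186408507740303805656096172753458696949465237,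
  40610591130592515008616537815244063006196,
  664275287,
  3114691327075345108020561395268584059493937315266969682694085636217813934386140824423623910747010688571922925335030341500011290479493759642952092134461669602874101221382651626454063301196141718644381763891091267882902667111458326024003366293378686183487654032698125932944952922724135857148327402150691313,
  20755432283579745364003867879426137342985934446018491902844703857752016337671872713530016913167213497880885610992337612222584928916056958181731087278438097357987682312775085319911115647036585857033253797666932756472730271518698198707777472614406442008039429728260279068111641304165009318725126474569505777802510106770711888120341781117742200248079243849776166033740161712475381919083151643738771054114056395790839410878172163120340987294260171068590028692,
  11963112786654755954247962468835107723550497500002487954801539224724783007521547211680259977547153452512362491478797077898565096009013215066044877004746153678607606298632831450559285567,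
  65753304099124285091845425727589896018391676182563374399392336820868435543269346119518701853555180148629722308758880460730330536711496075727446251161810948319914420248815024672091306918845376767592471500505612437,
  3640114761671138753362651014876687075779282757269801633029619705833841412020884990440208154938622963299218111132461906103050229406773661983765622644099444695209357439837594113828419970119511981110075927334487699963469513134045466449551795941033562102281036113134073801798294977613245570808595451580706606252386957414153689575448268494507444874268488940012295979876028867938508423459153720816167775494708743653893669977803738714404568583559611876657821301356584883434907716289211,
  32885394306267601452185495600789161923458,
  196274599673900445012541944052651548183940405529575001660433066782229459241332551184667327375552009410539719123475863488702876995262131652305589284526638568930505072442880777811583245230581951272816569386325614190604332691921577732170999941629932004415890522497445700185098758358306694559916351160827297106825335536078523785148811448443048637619954012348698902882041400847663225932075824031819328647294315264877320570969440480692708193604749201040625325869111782826206367703609263820363817879396299848402636135379440397915361093422165959820075732,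
  4072017594650885873996975325553968841588877033432,
  35046495751019236955990750395958681405413344284674637674066983789251646939352206905756767211846021605928420371101507565603532156457807415012760832645520477904934443514222912436250252329366971979882776703595168935735931958172726201865981233479326478426186460738181739388447538429221517049613146077520469623485680951789983,
  4520346900119130884498175756843372028145409866421981639505957355480,
  197065644634852386474559789,
  695050238508453428901233479760403179029020747878272433469155008417503155459824636079945116871030826334625818241231531534183478072415319055124329157604121169577277861008418567757832357658976680254671133,
  334816181383465819073716579435808015328515415873213564253430562522644861690694030638371423451935804237113100250394806702455886248485414731040072748359590558492196500,
  850837431582814495097052519078919973134386341057397894393039011860562058756514801717035712039754180453301229715695700,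
  770132990752944013813592711704033367566852306613999570855753572260578403191792553959471104559410837676785628692234394185957012,
  798247083117353747195173174037139980488546216486752583468845623,
  19943363430562692471199741721895428039455512938891932884613119513030357516144224129524,
  109707043535821222856506253882573638910668001889934470229007333420449447251018136168183923020468770190960351886562623593843329910230023736246694852707763322074966157743341528609162324037805380120696396509788250763452870850064141298907801143489253229331682541141226831104414876535187310537311761092063146231199064926937761582038764801520581158786480786299100805794462028852874300708745069175277670176913368831746684790808265202253334652727889604071758411533322029929,
  96654611242289439,
  147660865695604537311406488615623200604622063881853288399459648129436204984296465198164639494053454871916290972479516505770579774817232649252153568361631599302733584337446178392797983248459768524122471000755377504292261622497905497811754930774329132697937960938939036494960521113335353639878616828963714031397318357581974347325799681077771250440651574960505160854060776667630352373071129318941339760406727589496715484607602284416185241164910442109131994724473567189630393558249496785465761345557925339957327764,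
  34501558204500,
  30610265220715307478231254646477066130990331679736882366276974541362027782099444519042281810107223861272213059166476,
  148122733844794444534957582083881180029808245922964524396702237266285972,
  139440311721738510714833190477913032477690269629125737222963221298005170129617197509590859074346586319243160176414821458156867205932788902676264443440516120492911092668410580532811937575491623783235596035791998014010426211066487140143636879165497308741507636271929628,
  72488099086647166750010317227833432664823376908439028758312335619265694478000004926143813232409857088568144800275900325724983734162485745315037685895686245030211440617664398777790916986444767512189656268884962491888896794114299741396628374852558729032177505349249388886536925082160122563057748691113838564581662712552199391945779479645200790189301159541104879257064778778995059272976533217821170972799631543128828809268,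
  6362895722886036460953609691445546010275792093292357573203538622286044526058591714355611067943927417191,
  3640891573377457536646323471625,
  7961858122089024342727064941890263902304449511109078736936897821368099029977641021187171446892474556899160707745821912202312932216513703543694504277986632556561718452940554627176849264197548392290649077079871482588208321419295406126677450754544435163231612438915069082365383696427082529601923778637927525480977958146413658819882661857114601902054925181552290760345617167511647600875402065775516253660937812140146636042610993383396031254834678432269801367004022829688508493785030913395649734475435763087869470651259645480411549576986540210130139166708865107777665577926117696404,
  41335117646753338867274637758637550700159320903707762549630427595547,
  1327940174628368079706452927186041766212012235,
  46398116929024400814774909855227027447697786118384372,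
  645309809839107182248952905667189861480388830916987742099944124214730786223498605276751079399387468988952638023753149748996634908882366124597227724641724507844795114800008719339134804415928932843282718295338731149685699845390801140268631481023710878419315576568439130111025477018273109634652823134880425340887706056539075948803877779917533877754594583808340141470438279293129910482372815,
  3500529715913235350262937289150957333068165757461038247308516979298134183074990148434375363276267941284898385267459918641207582944859200571646036046925855959659167642577099586601778542853656617517288470557671899194406761793352596,
  1103481621206437946974688052,
  2013758191077174732372561059320889063958467023898552914112928752965253217146323736593081128012810752409653365558125103394850725228818109595155624166210611894788164397,
  9841715549804962913592171570194836875005678332550007096812622818966087609842980539796309126506555336176607518710918756770750606478849196665422989674620067879004259840566107635615377611182461911298625950210402208375704423779415192352512106792395563031623799650799843349419273078132282334379344543365865120654693447467612142380712784097185675216611520449721836226863005855702410350315998775520109169035857852528589823878303167165693228091828211641184459824579567180943069242394292171478801717942268086200087500118901298739466238850787590975966422351785242408337663157687198600685157687736426842196,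
  1857412075299643472005413928599959293261415715,
  6441595237185623703255971938624581925112860156316278852182218896692768704615792721615820120597071530015,
  345387717820343296714043951653806998543634838481746388548920154499618943890338471527716712145662380610081478950956241988913547737766172669580290578423992524299702776918299521947122061174288632422516306354578129020504228309322755263592313056652516435702780487024231307699510594060801506051307154401992149972367442314166794777293238153873583,
  1520278014973881150637954183107770943838723606616568072367,
  136964677992378291665412728371791314762350109001686292699699569834971078737289848683961177566067277249513048549514920193143044325218794465465550560744477047339158721123116362747788018940623373790154297140995139706376814739,
  27562875687283284114203651104567559162041,
  5861700939192745032082545402149635667870137896939412,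
  87953719375256014015985827198904331220935848480566275154310205329550327649143329962392065313897215919078105212023942564872606534440471918108365060572465,
  3954766772734551410318020659208954342736,
  54140838093031751987633549775329169659523967458135822067110499455639056200491282970262547004985917835481,
  25496541432540520979800462405929584501223440821621630586118264682092871655103168918638276882495354726739110089434265508468933389858960623088986917356890561693005736683444948540620144789,
  1165057301713851815685250957495398071128448467741739305629350378155762810894606439384975134603552917044348180023873490192415197972923453082736643226282168427297351778245002793037873512277908272375744680626605039375740856690606134701748441372778849968334707316910458338338871821092832608406636655528362876706115276602924171962778913042625415789106145426870648916,
  29595424181581843533213593028307209087373237940628,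
  1943273519565001078374671298050466697947663127890582892064205825039808440347706796218848327779189133114823974800990262891552874795346408579415976372778599873759640098301610615807205651682914295805484969854942805203504672762798165472150710308788532632989369045952495868512204073615671296535389890485709117332173614469776428024811862427525831663311075910280673558540912172915596128919620137,
  9200085915975479613433525283507072542144827395434238651284543952047303327017825004716701115778408239985236461426013205415856333946131880859244982461506925166000443174345216574824416361,
  600768860849670049819642161126378107725893969590049812670005326809119402334540959484578046417699691,
  38422323622158662659294922862783460129456402336297,
  250625443121306856064050146813419982543014694172557683764713001372858104188358405975541125997901276138305544635993388539112077301736027612673729481515446899633308912486613,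
  14914130225930094674338610158696946965858184034483784160124155828964480237332556445522148493289529289548867862184131617395318700136672389174179754358773033134522918441733973537245557757036115574177458936337707865533022547978175307358800284684090757697503584671146467966132310526185457116069126980778483492445506965882422327233919932576780201042217549759242532835989148434199064411148563884947409077,
  6576885676453761014182948461117567431649253131923,
  6695126106517335949465446253945,
  10569324758633533823470537599590667422841632056567124766859693357403968417180133618024171158839613350707413483007079165047631542527924987076572931422661512650638866096858719412130624591683311720978208222254379389034820453286188788236829332088478773007262019351489147492993075964584192827447982666276310262757809881781310307914438582737599615503942672005627512418715769977783012589339684768398787055830267466819692315816096770650987420957637474768772789625833343222789196266602746336223766309784170800932178842497531115718275101356353069748510252274840897120033446967124908320575273348647996317310560895161,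
  90331230841403601926328946635878726036,
  5704795835089665982987029841623,
  17441812388167059693456368657512225007794051946236336708330459465240247701552971079074543243001426754704057562041368554919237839339761438388999296581556768850802952873071885280663570322521332441432490704992077648373558594389858144,
  1782441782066627850903451828824940235624366705706327324760034287870036761972307840667197076,
  400455540907108503167097198226865261386310223407321817827016884548262437877021813562799320688061491992420470292341555607982481404374171612536293488280274765727119885873611309906075130530091,
  8754313126156313929395979758268191497820992035915637094993206028509209274795833989230347458585111605786792430040185461151255772613744822605,
  2756690431830950628776730474316503,
  322490422540500117092026271996504722008742053866522615045930017250130984428672407094516400768679533274890168218451461644973981013280979912704350407530545606456759562318469752771589757425480558123326401318225102347186685336922659780902569844012635988600611591537447795663521704252449186296212645100018990069254328695706775331900383971019242685775411161047578483211633818481847255785126478321347959535878896987726900163388341740742012896427442955076091430719909585714006641318888492819668250653306973110806643114885785811603045148569648019575983412858900280271050920370449129358481351825593307079777388,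
  3914771818788515381483383784084830947673,
  877499505891161404163723325728911764,
  28537899550318834483937,
  44866614400027257037308211563018039464298422344102625912585077309652068705535878877020232037718084191107,
  58464661599553594762631154617614443726972272003224555062142666714848450615932096504309757209527254881040957651930618049038208853604771760918759233892043602838215086668830992725246202077806464198784317616747047609698438262940599513281021371689693155182713334310187226294820135115390660755201746263845241829840083514893248823376674115932783406896397278418033259916540397826723256700820,
  3013603893251983942950209596498731856521480169339901966168397896881308477760077940095957943019689277336393589288669605046439177432962951149221099361126023741567631741982835451541272440998921821536173999119280791436832151696909243050984622807061298720703311956977543091363855175679905103204973759933126414967864574447045136222364952989448221073404340105228302924915637732002713109279711726928391584753075372971921776201436388292354501153262479,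
  8761616037214185183175897857857749462716789648553563028470752542785304965611373131261387594884897178375924758756943390804983538674749147538809642393949034563942623756849787959312989135093645500249232851543729260541311370027780214797825598883547381341197067938140050567683340371332736899124270732628821483269742593190522582005808335525224770284332819734166252603439357314822115153557573062066853781528980020753396588281606422501565629985044051992397620516081023103413771332935364686295894347879292442959674110971260040364756836919927822338304051300174152386925546081698580136433,
  961719849137931186219999839742515126531264404,
  17903512362287465257516226072778649195793627495593710712521204256382115469666287852502696551274015254087957653226336431069238595364175688486511924114677214738475134539102093711754578992421378523710436966097936353256393427802261516,
  167640408206621662955591097165877594926831085895352231606482765963641508557308602198213076802477919937940246255418144536794371013625761504669023035045517283436775644461814816474665542218231547115569239745280292508959678305019202261205425861671166898687394500676368353935836368340362783863155668424017295853087473013789469563929979488926710434001087387467720809381003657713,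
  965555730212480223244,
  1554444138009076308200987975824474613866230005038992873804591789252154790011798626355290632596,
  79769250580293452571047436630338275098398497735895562531731198174460876668053225475253908191021740203727425945367918018175567846167585037607872795792718254374305401101539339639272579037791925036646326947209128238841728588266132071253163191122255120009749838978241187506711165570469192615238532772781922627356947542664205943147722957081202364621796679298268926544786068992006042236998213728107509705103530473045489221955,
  85651580617197350218893964145349874610603996829337781994853177060202397023693250300888582814773944545581405801921493885131718146412303017763731564168089617485877754944126469965858818774993413916746663720516611534245995929363229986790824136610690643977234453529612637930913820221584871202531574585408532818287964190453736966181242033540652452823725708008420698434177220146534340729820132839685688433012884083339093425980117145492,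
  249019540546735770652651848687495143020802565240224548070289287285243716075341472429245674004736850366060847058590707931654232264821966189450073362071588500919335120401944110523034992100915625843629167592646069024538586171752512615361958929272823718473242290441283659756116223075282996973032072229487675749349634403723540395070248829829007275116408672334759937037240024972197227974283243492541802841947885044308300717458374921556529685760888967778077115463658890199455297921496703188317721028161835791269395025496300151960970761061110435885663202252651117161349987,
  61733728565813218467230857752743047177698198161686239492711998896080155392020498038037640908551148018323537495004661022905,
  39519101265849502171360114888107795374703115055290772,
  7885256726770827279700520002321523037386822070281165931398660831521980846094265769405908009086959984083806431742617338403344630852057070622317179203093530431,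
  55463189614500558053949750583706744290355800575103941598862468025034596231407109702000400443322532893546011820217,
  12210091729536945085976537009270771783753685918888425138949084178411783592831254195011405786256882378650708560658787424910219014002425611381553729995558433481616222100886061335777975264733805462190820521738481754682981878501802236614273938590224348798626169820285937,
  139631175361396919827193340669648550942457213708922406861316292472104715998944976646844551346424011126420565789153323470444232323299699080364790918712766387158332292709519285871871862327072440172499011726460708606249280242948540940632382254218378384345053227601041730251609424414043062045115299,
  2057042421237474067510287052317321011794336904489467915964864658179907688046835972381027349788906380323794857319247964024157685396044110655604005671390378473641940734845617880945395727178621074666118354708986646471774517646897558069476683353834659369017019096021617794929815098082807329827149956001996488819568921093263016641475979424921902937224963598100111918755048397536092511940309934285655021,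
  1554444178742048974085606196981969375225526357847466954574390137925466063055320081207941244820,
  31632768266531125781549955350958398769131903907614355130912642846118894123072159533014780811040429217722571683060493624205453080386987320154552736154731952878499615527070505080067002240987169751044062237876724339678174258428605346390421629374523747649277593362412679017406505646090046948535634615076671,
  371783617704887999331235900075195433016447528501950132285217637401016229878254174480927971648250761651865725925580258876165734245928295366111522685076265536776561928542261262730441032713927432474431159479822116823593822414737441213317156540980813475163792110583512067127444752400391142874061189832720210852490324854581014712188528358570111064242847087822200113934371485319205021117986106275983372910572538940874918396247283499070598779763718221030763627681609869286626788166650146227425023405846153870955272475340119807561288174040743353582106770158320673636741276606676459346088427788317590866680475743024891183104149,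
  91268337463406991133332852852438436536164742424622242457083015823437791686829921819979163486115625300426273778956716147666210668919809413534740715290492051181742763447067214755,
  3666229476059592513478901587981018032122866423924656799433383750938606257996116,
  3161027730682506199590956030657768943364366967181232072265731316234645659904986663594593790937182807642812037872472440165217699716186504094807121663883325003642536249648830483454449539887448380274014851384470808705417129704332956474378028838337093044031,
  1062372554052093058627009428,
  79769430366113718721770463448029952075485886462627935615978715759128736145489865895407609670838001862613529144108987801986823026151867709194234374405013936621099557417558229737159022901291772574720740105868079203228726743406890944044698711381562110744521047188267991613512023577253821999514813017193325294930008712461763710337986147648438763564570156661581821522127366583163221736418190706822515942952676063793044655109,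
  1141965520099427757248540024531859729429094386157139210988957117506864809112601302723879714440849568385883132198625688705610765455204809018338799394606717996182416347948751623474019783024742670341984879428743159481205,
  5324577160800162678718211795493035698781435969710048341244142513427041489607864625755812915781221638650751665645495850074723485500211356784950834051803007502683687646169193723607581576429239033972309868991585035630121693547477418681550015683474747786062640529981397262174633970108130109288447907802980691096291251330770784448987329326271864823042186803178974344608707527862405615390261296240181252193144027554420511496113192950987122857764566250333652588835498566808984209240661324320879248839148475283070478057969,
  232643460120324104223905806282401215978681504027881541331229332705644399672959811200753736540959876926851286123940155,
  917809318799084948164237831237453101874131091290681154317990655463184503622273871715573525301351789593741470710611494127797434748811754727347141845810055882329843637403466955061108815730079437962182574425938038429198606153350394806213608607626623462445782590701252741211759120490343397619140672131346529717243577410528965832214025490055435235775724488575174545117111666316067010500377533197294009441436140004819782272437068475255805410517387908872937588811127765498875854951025828810882756390422472949909,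
  3258630492082104660158795214488518926161522502680232665128056345844108769248100839925879303735468636956433602891421682320515180654001418016453931543267879820293200270049210438126603,
  1554361085028595873831748027357418613788846684344051688376069296380826199627447225243851129315,
  2935909030282804635930493993858094493968760650994431266237789832983031986615240845125113183342186924850805361532540962057257715367710364349875129260704490326316776957393692474289965552667240099629056584116934875798940348667973987455584369350093806984380889592492550602945938617154280706063843532371927195111322890189746723879975227863574906167798648784685912425669607073718086723062422904955957573255653915369038287083824819629685968237887985,
  3914701996763031666692232093573635409523,
  101482513,
  101483447,
  101637780,
  5875474316904769207754420972582373138332639120799143534157109827650780573216742481812,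
  602201309086734577416087281671198270018158602028921692229830184869704550324658847711490768004920663121638244280466837124592637670004209016651436895793164207137405050094981355182357592045455752871186556374094793624552487484594958414900,
  221972282003426021102030174350791050667128009392345184606198487941144950123996158215112000657825799463372081,
  8365206985894763543122825829680439469867082943510535265908740670289984638882715796671169810082202724752196583209810461035524732645413179744527019877266175430656234874931840571036339647382638894952193112850375755961671247296804344588969856735654305459200495322537924314196169790855141663390741730582172846475053469687096009802900356203427209257158194091260773857942546114872343550537194818722854959553922751071891286380127441023273509301956750693451527812651718257079104038554352156569694894160325296472410242009814943648867616977566534525898221358678765144882107015924,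
  9010167617427712438331425999688431447916425326205675650314003759701360422415961106543972913185715756784963121501922719015368968051263033428,
  6773960685682995692019640741059005245259682895593148746527552886869131158480545083656163090597398853940,
  421388016112221044967281450556806476581785714291235868515715267528399836741887823740453770810872972063987140175891598661415151823085989629201646683161462714386943984705318286371613348773972,
  13764986218225204189535384624037793089256273520659334355836780034114211012024903884507073908608673622536181897034758613199232890232604270375251320998263735561799049532778927650944450557402570326806513313675311930308213407756976941395612103597929404571809075756545780304708988952594105199031573586999859898348888343645565944387293535199292820918049601158234643892331227969899520771686217985213630270734113101690896560622630243531303243405619563667142223879137395041467137744424577737416246841008757805567706532163480745509856529859984999557291827587010029477252783819184440565365490992899431716083402044599982298287072272475005519153,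
  166991023679565431586222241849387176806124717957458153315685552140814579,
  3834018210494450340709486464033,
  125630083288428680238495940473053856,
  391224438607910823246371969128210915322047182969428523696517149574977748245077647318499836393689859653042109384778438061557044346377225602402788556116128004952379727487472517132884549498062597293941233745568613581467968336000515300296642623115556654639445916783178600940900511346244346767663025452632169009730134050586477290608530121720450594702681959399534395517749907628106754020215950804346039894963706708589213263179289355262756296084991175512641526644651174909718137351388365269514152188684472903075475397704592201286969454563668897545519850487291865502308290468199492940978925785122899646700397791984591722644341,
  3824530670097541361158616280723503319699018575245583414149950261367518872907336025344084271597625527384919001456446120957394278816592607386349575627849302607813543347445733836442768852823146901946858211550976950379576284970597695026775510772308061552609742468731282685792053482686195199435500482708382971766639960613143597576718193042362566018590767370762593141061434843923115106363205365070317294788441864023953869010081642422020726271175265962985843921843590225592817,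
  13798801619012039446841427796003811580292981483637715320568187539236614890272022525816115825084510258780316418978792115594994828966729386528788938409949997833114471552054133786538906441308578708,
  989009030821197876133564203242342080791493963596595832237613232552944108762745932122352666374688047426601810053038795810726200005822007421878477454834322792576703697532389560797484794655412796285080165095023143959769754228061161432936530219102070296164957809271615142699204773653073352383550587765,
  144486683593406810416431788166418245073166642778394382387189224451575518656855425532488395266232494313129388810788685645590458816915631491388501793134475468831808993234699968528627410895039471150843017775177081355127476964977683847112187484097270602071970698871766360628086477570215902431805078153128699797871732791766179866690643039280332132210802034207912998717799969339619504268584618804551891802742115544692956809258199877819999732558822613712510634224042970768101606823461262711105147660,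
  8385757163303482397560409876619079474896351029692440848733015989529808659518822963854759739637717113173282947792239652493247251413,
  692931852896285384099343725195645237209379204999072586669715522907139471807233206706708432621356612687788031163917699947798451635319394693671751924623860546469058313778963759897487560956894755772016231298072877905066546863428430942716472591991756686293,
  102859609,
  102859193,
  102859463,
  102860885,
  102924355,
  102999700,
  103217812,
  3886012601629142414427643284116,
  6406673785975990862033292400298391847239619986612939748419937789863197655058098144320337624468,
  42567231614577905696273854842226594153315,
  9812480555276719921593023143084393679134236341212382401045073265636107779829789825967167670936300126881713651236123655144538271241373097892929878447493893332131287263112123907451989778232065227442937839438726240852059242939057199021199583143346720011124076429331806345493154781321125662858167106242280827106102710979238670948547811416956473915265393351992422775639462289686920428417642559071224176043274939179195238647463319219332495241596294489599851786293954607352582931910023259347372765014617037341235995456718954465879124364132666706245748542759290996769724578680847419799067788419,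
  136726913317577609196476224178572156717140628,
  365495971591307024886621735503924479527763274647739974136070686275337246423299910604585279438394893371666763095220833679376409150621011072365828396647266597459860677616532,
  8499684044696287590603176450208830950408984484020009848981208110600239546533775809903725986613139665288883673540818579394524875723,
  9668350505623228450691487816374856480106781365473738853338916996387744739234395752240684148975641188724034094813590170440835146486579790417389953940,
  321108834541316172483288808943513651635334922275116600301390694101177818000294690986155605634995089571245562297000131149870599925128017891398260343053260,
  295054641895240126058700189708705336917321208663139003092618316540153342872143425056173223822724931568467008051891155219427229741732962943902612,
  6848941666873289388400326719841420432061347640050378241059750750605981386209838299522626544807480483625092638256829405511994382728135405975193149213713291248149398406366214414507805811284727201686911802779429852990360157702723515993737968475846004715874526902211423752047346031611154553257845538503863857748851628429791699473405528146927311724009431719318151909049003605539281127187545954105144898052994098717205663611898032800583840130826765991711212072581672570278678596115598275281515074329064095351939430590710751547618575042408574747509,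
  224984658359002074057498754128584010320715060717176892189541740211920448514940807732621619855988800076546739,
  9004353085181889273687589334862881300565147170072168092525291290913122845742081228196844059501660210855513583134135684268494799749008480012,
  104169577,
  104169625,
  430917838409329422454191461701044518996803100121828932430088374037449678540853663403941176713402370789498290238135297774127076842240026922354931767523375868484331160688513795640695953256451875789748021793940397799920500386708035450222966001578826875728712018134573890339539325826239445975262496382598576900133964972734216022714957894120368173012078377503592875531807041621235096855815316020652084015431974569772909887127350748236691957954970978813556226514831586928520612275377623772023540820277260771874241899869943413019405470640992466744167167933849834272575890064308991680397327301328352064116964401574403580233780626588977,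
  321108978145369539684198754277705681221339203844584097543670372390184359916084696445729041039981130415277059308007574982185915159160000714958903398466171,
  104431685,
  104431719,
  3422118510797,
  104628229,
  3428560598184,
  3432857311892,
  139078940905929173260430549966626618222839083,
  155526292439542230120878334974316551960978514987397116055554503,
  601425547538395609142343861434580992963626105985644074142086009759340151478728581265175254974868092262582274670807271486974397673373929672936344244170916688036442607714944556909581290584467877392428779243889468840355925697667155135617,
  274968754125951709168510337905103053983767569444746323397550580477496176936970295831835078399015865616447574416165014844956191364221417,
  7273664517262001032545327661729645248453356738254065983163692232535264342166110228191031986018551171258823837369,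
  212203270995454121278973175625722409693101792474312685971047811888965056382534704942233971581421081,
  3952861212696060358861503826435,
  5231310869555880051974958223665086664265170343909015515785123180215335392814103856344545678808157961300659440139222604500222014438760558854937996739383509586862180103700328738882106533779150687043219904050939445569234136210689599893754350584707628284005653121624842998492880860515483624421914074825870485443091780061479379131518648757680112804143761211985410911465711149197349277564695821603882536448807778524917242938550941331357073310822625632755833007278953498028319694209502998638407559512288474852436,
  227855540977171651757002555110645635098618754550343834961736596100645253716468151137684538851771286794152280400729375050865790987516491251386790134637935838337934632608539774885319958395167887627875967547604931932876528000180517811626190500429244177854290526246551435749751416699062406064293535693507146496095910148048982340493617351556588858361503372664745275535884605393527672688073247332171656717581116142411827891972761222801312839273580803871855281908168290127645083614789002984190091734815990596330203651224162448022821389292333364897383989,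
  317017346025902911730799742917423080784490327773426665564660910962267739561351856171980347554756333358984639716799797041235270130999396598261848235182567,
  12859751580030673294089024768116640232609914497602281391361787051162583958967285650776928265111897587316284225166601093004184249642081352285134897765751063532507595786641603362695939637,
  464142132543128838491058958331798492703803872554123033672820361012048269244969200832446445341208442316113176398695988245217731922642765556979786843225022799947576464933803276689230632690047643026997,
  155827663819319334431424239262793901465233902180429273234701972,
  316812659216003215359981357299412036032969536010255338158709470900894713564266431106326242891925532332369291228400204293590575191231822494374598881708597,
  5482697858513630650255925958236391933516349608844530289899770237274946679892,
  35292053411014657620982680158354933899245560983436002801903848953450146068821003393185429821105792930374048578528294306206374195551518286567107975822563319795104599868638660271601517325431819373520498213198135594079762092890809443023399669046526965331432423844788909631026682935176384458184605321584745899794068,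
  11745172930431493,
  2115789981571720005012,
  160347100446359158143795162822979321945281758802198080955878559,
  325200585289133238956450018946671233360223194877031878486803341657165590274366549321152103869403975671354415358192782481982248599456102463127062093365739,
  160045741326265669544485717260278247169349393910245943988192771,
  125633081862273867311585324968325204,
  166995084923787510415083441018724075441224648450184990558975882065120148,
  6879110259250862855477523567003078549954598681008905184393794173029364768051149433197201614457157089172,
  6787249066285642936323919169319126828833910270936475607901343103125123818021120474667818147846367540116,
  6787249066285642926610752561787621300508699211683039596908014536867720461064439814543518000324459234449,
  880004900913982052119942316473457936593221831160050142364198653085268333563182161474289391250634519201323656451387436863575038162886264970155937664531460173486209759295873101912196758393771775986663158841111717578223263640949224359011279009436490050973974906944582452281008828616230377053815443017133056161800728917827480057528982131900210642416935668344345181592721559988755851951791651455162664854413722438224007236720345653938730156772286458236016424487824492030686369862069609000958545811336685492800787080418735434324480972220030450985887320510726260396313994199982280595992112851330656273252891054772554797763194607693600411545330634316148549400030846726771095972880376828858671575403507179836669876120559051640,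
  5959090911706787741362367506164267049035276480497910028259687472827204776382852823444,
  9115394093951772687404418392451762966615329284219577307801628983173954279731332376081435420319035152143517623198238747584461761503059616469162827482792080064622545990217883357000111124800154959846200240866487557602042824392193543831115370632853589441998468613892779871998531065636432586081090041256156130184300560330860695021202019106039195585172951010639631709962416653713412269210584768647041288843267044877172269983016647002489133011868078222149666961599776977841931474296013701109416300793206797400158173472962883239641581461352591408982742290792183198116352042137201771651,
  6321120264566140084153296680111899829852629134854120335404369929715071846322199051147902159343,
  304200622193539719319044886450105763910706149884401320724127540429449696389552119295592642762497675875295392754013900287304510498773679380430420,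
  32059499942775997,
  398273436826739643762459780796340413062516234657276280910965336612554029897139248139363338488800390330678698746941578897676491905607929168267943016013646190699005803680085936799885,
  1315467428456838149130656772888990428440397725837283877735094963902649509170880412765860662693705925549284732990225589554420541548716093701419429766127338785220739010683961842872878064806034609467304712843055932700544982413801976833944496616082576730788001926611621896712466605697068860553870547974621306305067482365887549101727550653,
  6398522713449452404353194197614542976556508280565611916321661177227424751805085531577080480561,
  4749356009110360021211770622650268986291049832535240087148,
  536802268070357401750392483616978771634778760163035812512249298162362820823073102067904870215342392239369025763020724213592166787560162846876532071460089569683283364539901480997288344058634379364727808089157601823439,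
  9799471756845629903827727122326266568685745587561979754037354840502527023677950179236051734497911018761525021950673341859911264291233576554356180267,
  5546302843177498581448984861518073241175482036004945854744593677510618547499,
  147183541054220136142264936487953693537789122739583348,
  179309525814670128526542879560108179990905457983249156595706491583680876932373300,
  211674758605836557326693225165333775469119353476599147592187468218007621398776924142198423885959900171242772109395512549346162264530221216164784452401388284376707040869032593513095830107904646949630533817869045064380102565873574651392502201158352066658668491402419164836229240887341904597730461537702210119662583259623184929164258438448455278222979109824024309962841380227359281776020279665690004809475006281479339785517356544517729325925245489399651105067539239028633908255526871288111552800139530603319059458828129608049696701339272757,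
  5359563869417114802891604556663661227314975415755818833543449674699,
  8521341395081805211841855578097836829639996770563769855575974715438580848517548554509883078585604865841766717084540389596357854069,
  2760933202121570041829505977031979938204107339828260873099664420858255033054866968584890979593838271944094786147109698330455535270987379551567371440926408887374539309900326859843381644531491289666873975875200427220455769339541741009520510961623284910483988458737601548285958418075133655189618351568147232832477012438995060624613530070856425116294231326857130240786634056067364717464855832051691707173210870757517174888465927,
  195889145040667545476532621022643272099381532967311420690734141916806407593856155067090219,
  46254061721788750254098938208103783995634363972428315772530289678373478623009260510806820163577238488016596797430852404500540871890821044737462501788087200548876700126743860354994873794514056092462508182440601900660335723434367312292204810470227624633931813143146833361766746700705129456788199179472949182829585358721075024503445062235624601683509,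
  498368829560240410568247882478467301567679987340870429529953123470317703283785972035437006923280449013669159290639518598018852999637192339351141089664703696415039910272206416909738722046407198808460228278224,
  259555030827348129850585428511975628312698031707351873135714635215877897996497099308495004079233239397100756229854444827314741,
  125633277180295546494413514153636948,
  125714260740279179356426583427233744,
  4859812255405954327539226647153436028860427442425583221235779665161461693918277908440475467311364851882807976506496078058562645004499477233865422741621693010236505517861002788440603333247322695670249510636917516537827488152021636477712637686909058483060657498077168652903079807210510249491522492006340705088071593386972612946563815670757972360144141525015133831332469216958624692286951382241158793078579154324343079251604691115130543752777302257628650873011898354744639829484530510550339808791093,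
  6406676272747446093206667746004641710445009022176292462135940501002878286098910361272820828725,
  5875619173578680911231132391062869157967913587088617134119092818789338978164823327949,
  166995009234598330725691184283369976693322851150362597802494305944901716,
  244653916461549493871961791880548483560423642777597854968455750592138210025933673576913113446488247361555960826720340,
  432266361241406056200836474577517538386804733945524614151154998477004243076212774737872339208373777782575430344030461005201721569976195475721087749927588414884895979833742111672373731586132,
  15171125252868800176020402598972750043339944427400488941722488998808522523319597386030601070956800092938701814286937763039337369867866317599957125059230997131627637412852206737398441651906874553056357795265524568920325097364464589419986632352049260362164071560997739857688790125296820250354164632760781842357486698084656835847919893727373587490824754966870794086467312303374840911974126361381238693536979358430138849335268647652145767895854613674549243690576834268095712097854668968653118264543178798157597572179786053404606032424766161572839154937395015963533112372725416972063091586876454883429533230939225762034653268802214163040734675829,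
  8402203244278547414561691197027494528844959168088338594289843844196062815363667729057064115466295208131109100608088691815415607948,
  21188084517132195486376745661384092079922629645419706867163802749080701759414237445780900670809808586987688607111944275603833643825090500926270833792871903416590074943550748021102008168372905573220295005813034079316420351774239705020209068329534325,
  108757377,
  108757559,
  3828964311981182715167,
  108956347,
  3570300408800,
  3572448134903,
  3572445788336,
  3835886767074314062303,
  3581038146644]

set_option maxRecDepth 100000 in
theorem check_steps : check (mask [pX 0 4 5]) (axs.map mask) steps = true := by
  decide +kernel

end FiveHole

namespace FiveHole

/-- In a sorted quadruple, the second point lies in the triangle of the others. -/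
def sJ (P : ℕ → ℕ → ℕ → Prop) (a b c d : ℕ) : Prop :=
  (P a b d ↔ P a c d) ∧ (P a b c ↔ ¬ P a c d)

/-- In a sorted quadruple, the third point lies in the triangle of the others. -/
def sL (P : ℕ → ℕ → ℕ → Prop) (a b c d : ℕ) : Prop :=
  (P a c d ↔ P a b d) ∧ (P b c d ↔ ¬ P a b d)

/-- The point `q` lies in the triangle with sorted vertices `a b c`. -/
def sIn (P : ℕ → ℕ → ℕ → Prop) (a b c q : ℕ) : Prop :=
  (a < q ∧ q < b ∧ sJ P a q b c) ∨ (b < q ∧ q < c ∧ sL P a b q c)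

/-- The triangle with sorted vertices `a b c` is not empty. -/
def sN (P : ℕ → ℕ → ℕ → Prop) (a b c : ℕ) : Prop := ∃ q, sIn P a b c q

/-- The meaning of the variables. -/
def sem (P : ℕ → ℕ → ℕ → Prop) : Vr → Prop
  | Vr.X a b c => P a b c
  | Vr.N a b c => sN P a b c
  | Vr.J a b c d => sJ P a b c d
  | Vr.L a b c d => sL P a b c d

/-- The valuation of variable numbers. -/
def valu (P : ℕ → ℕ → ℕ → Prop) (j : ℕ) : Prop := ∃ v, tbl[j]? = some v ∧ sem P v

theorem valu_iff {P : ℕ → ℕ → ℕ → Prop} {j : ℕ} {v : Vr} (h : tbl[j]? = some v) :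
    valu P j ↔ sem P v := by
  unfold valu
  constructor
  · rintro ⟨w, hw, hs⟩
    rw [h] at hw
    cases hw
    exact hs
  · exact fun hs => ⟨v, h, hs⟩

theorem lv_pos {P : ℕ → ℕ → ℕ → Prop} {j : ℕ} {v : Vr} (hj : j < 990) (h : tbl[j]? = some v) :
    lv (valu P) j ↔ sem P v := by
  rw [lv, if_pos hj, valu_iff h]

theorem lv_neg {P : ℕ → ℕ → ℕ → Prop} {i j : ℕ} {v : Vr} (hi : i = 990 + j)
    (h : tbl[j]? = some v) : lv (valu P) i ↔ ¬ sem P v := by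
  rw [lv, if_neg (by omega), show i - 990 = j by omega, valu_iff h]

section lits

variable {P : ℕ → ℕ → ℕ → Prop} {a b c d : ℕ}

theorem lv_pX (ha : a < b) (hb : b < c) (hc : c < 11) : lv (valu P) (pX a b c) ↔ P a b c :=
  have h := tbl_tri c hc b hb a ha
  lv_pos (v := Vr.X a b c) (by have := h.1; unfold pX; omega) h.2.1

theorem lv_nX (ha : a < b) (hb : b < c) (hc : c < 11) : lv (valu P) (nX a b c) ↔ ¬ P a b c :=
  have h := tbl_tri c hc b hb a ha
  lv_neg (v := Vr.X a b c) rfl h.2.1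

theorem lv_pN (ha : a < b) (hb : b < c) (hc : c < 11) : lv (valu P) (pN a b c) ↔ sN P a b c :=
  have h := tbl_tri c hc b hb a ha
  lv_pos (v := Vr.N a b c) (by
    have := h.1
    change 165 + tri a b c < 990
    omega) h.2.2

theorem lv_nN (ha : a < b) (hb : b < c) (hc : c < 11) : lv (valu P) (nN a b c) ↔ ¬ sN P a b c :=
  have h := tbl_tri c hc b hb a ha
  lv_neg (v := Vr.N a b c) (by
    change 1155 + tri a b c = 990 + (165 + tri a b c)
    omega) h.2.2

theorem lv_pJ (ha : a < b) (hb : b < c) (hc : c < d) (hd : d < 11) :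
    lv (valu P) (pJ a b c d) ↔ sJ P a b c d :=
  have h := tbl_quad d hd c hc b hb a ha
  lv_pos (v := Vr.J a b c d) (by
    have := h.1
    change 330 + quad a b c d < 990
    omega) h.2.1

theorem lv_nJ (ha : a < b) (hb : b < c) (hc : c < d) (hd : d < 11) :
    lv (valu P) (nJ a b c d) ↔ ¬ sJ P a b c d :=
  have h := tbl_quad d hd c hc b hb a ha
  lv_neg (v := Vr.J a b c d) (by
    change 1320 + quad a b c d = 990 + (330 + quad a b c d)
    omega) h.2.1

theorem lv_pL (ha : a < b) (hb : b < c) (hc : c < d) (hd : d < 11) :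
    lv (valu P) (pL a b c d) ↔ sL P a b c d :=
  have h := tbl_quad d hd c hc b hb a ha
  lv_pos (v := Vr.L a b c d) (by
    have := h.1
    change 331 + quad a b c d < 990
    omega) h.2.2

theorem lv_nL (ha : a < b) (hb : b < c) (hc : c < d) (hd : d < 11) :
    lv (valu P) (nL a b c d) ↔ ¬ sL P a b c d :=
  have h := tbl_quad d hd c hc b hb a ha
  lv_neg (v := Vr.L a b c d) (by
    change 1321 + quad a b c d = 990 + (331 + quad a b c d)
    omega) h.2.2

end lits

/-- Monotonicity of the signs of sorted quadruples. -/
def Sig (P : ℕ → ℕ → ℕ → Prop) (a b c d : ℕ) : Prop :=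
  ((P a b c ↔ P a c d) → (P a b d ↔ P a b c)) ∧ ((P a b c ↔ P b c d) → (P a b d ↔ P a b c)) ∧
  ((P a b c ↔ P b c d) → (P a c d ↔ P a b c)) ∧ ((P a b d ↔ P b c d) → (P a c d ↔ P a b d))

/-- The pentagon clauses. -/
def Pent (P : ℕ → ℕ → ℕ → Prop) (a b c d e : ℕ) : Prop :=
  (¬ P a b c ∨ ¬ P b c d ∨ ¬ P c d e ∨ sN P c d e ∨ sN P a c e ∨ sN P a b c) ∧
  (P a d e ∨ ¬ P a b c ∨ ¬ P b c e ∨ sN P c d e ∨ sN P a c d ∨ sN P a b c) ∧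
  (P a c e ∨ ¬ P a b d ∨ ¬ P b d e ∨ sN P a b c ∨ sN P b c d ∨ sN P c d e) ∧
  (P a c d ∨ P c d e ∨ ¬ P a b e ∨ sN P a b c ∨ sN P b c e ∨ sN P c d e) ∧
  (P a b e ∨ ¬ P a c d ∨ ¬ P c d e ∨ sN P c d e ∨ sN P b c e ∨ sN P a b c) ∧
  (P a b d ∨ P b d e ∨ ¬ P a c e ∨ sN P c d e ∨ sN P b c d ∨ sN P a b c) ∧
  (P a b c ∨ P b c e ∨ ¬ P a d e ∨ sN P a b c ∨ sN P a c d ∨ sN P c d e) ∧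
  (P a b c ∨ P b c d ∨ P c d e ∨ sN P a b c ∨ sN P a c e ∨ sN P c d e)

theorem all_axS {P : ℕ → ℕ → ℕ → Prop}
    (hsig : ∀ a b c d, a < b → b < c → c < d → d < 11 → Sig P a b c d)
    (l : List ℕ) (h : l ∈ axS) : ∃ j ∈ l, lv (valu P) j := by
  simp only [axS, List.mem_flatMap, List.mem_range, List.mem_cons, List.not_mem_nil,
    or_false] at h
  obtain ⟨d, hd, c, hc, b, hb, a, ha, h⟩ := h
  have hs := hsig a b c d ha hb hc hd
  unfold Sig at hs
  have x1 := lv_pX (P := P) ha hb (hc.trans hd)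
  have y1 := lv_nX (P := P) ha hb (hc.trans hd)
  have x2 := lv_pX (P := P) ha (hb.trans hc) hd
  have y2 := lv_nX (P := P) ha (hb.trans hc) hd
  have x3 := lv_pX (P := P) (ha.trans hb) hc hd
  have y3 := lv_nX (P := P) (ha.trans hb) hc hd
  have x4 := lv_pX (P := P) hb hc hd
  have y4 := lv_nX (P := P) hb hc hd
  generalize P a b c = p1 at *
  generalize P a b d = p2 at *
  generalize P a c d = p3 at *
  generalize P b c d = p4 at *
  rcases h with rfl | rfl | rfl | rfl | rfl | rfl | rfl | rfl <;>
    simp only [List.mem_cons, List.not_mem_nil, or_false, exists_eq_or_imp, exists_eq_left,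
      x1, x2, x3, x4, y1, y2, y3, y4] <;> clear x1 x2 x3 x4 y1 y2 y3 y4 <;>
    by_cases h1 : p1 <;> by_cases h2 : p2 <;> by_cases h3 : p3 <;> by_cases h4 : p4 <;>
    simp [h1, h2, h3, h4] at hs ⊢

theorem all_axJ {P : ℕ → ℕ → ℕ → Prop}
    (l : List ℕ) (h : l ∈ axJ) : ∃ j ∈ l, lv (valu P) j := by
  simp only [axJ, List.mem_flatMap, List.mem_range, List.mem_cons, List.not_mem_nil,
    or_false] at h
  obtain ⟨d, hd, c, hc, b, hb, a, ha, h⟩ := h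
  have x1 := lv_pX (P := P) ha hb (hc.trans hd)
  have y1 := lv_nX (P := P) ha hb (hc.trans hd)
  have x2 := lv_pX (P := P) ha (hb.trans hc) hd
  have y2 := lv_nX (P := P) ha (hb.trans hc) hd
  have x3 := lv_pX (P := P) (ha.trans hb) hc hd
  have y3 := lv_nX (P := P) (ha.trans hb) hc hd
  have x4 := lv_pX (P := P) hb hc hd
  have y4 := lv_nX (P := P) hb hc hd
  have z1 := lv_nJ (P := P) ha hb hc hd
  have z2 := lv_nL (P := P) ha hb hc hd
  rw [sJ] at z1
  rw [sL] at z2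
  generalize P a b c = p1 at *
  generalize P a b d = p2 at *
  generalize P a c d = p3 at *
  generalize P b c d = p4 at *
  rcases h with rfl | rfl | rfl | rfl | rfl | rfl | rfl | rfl <;>
    simp only [List.mem_cons, List.not_mem_nil, or_false, exists_eq_or_imp, exists_eq_left,
      x1, x2, x3, x4, y1, y2, y3, y4, z1, z2] <;> clear x1 x2 x3 x4 y1 y2 y3 y4 z1 z2 <;>
    by_cases h1 : p1 <;> by_cases h2 : p2 <;> by_cases h3 : p3 <;> by_cases h4 : p4 <;>
    simp [h1, h2, h3, h4]

/-- The combinatorial core of the theorem. -/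
theorem comb (P : ℕ → ℕ → ℕ → Prop)
    (hsig : ∀ a b c d, a < b → b < c → c < d → d < 11 → Sig P a b c d)
    (hpent : ∀ a b c d e, a < b → b < c → c < d → d < e → e < 11 → a < 5 → 5 ≤ e →
      Pent P a b c d e)
    (hA : ∃ a b c d, a < b ∧ b < c ∧ c < d ∧ d < 5 ∧ (sJ P a b c d ∨ sL P a b c d))
    (hT1 : ∀ a < 4, P a 4 5) (hT2 : ∀ a < 5, ¬ P 4 5 (6 + a)) : False := by
  have hall : ∀ l ∈ axs, ∃ j ∈ l, lv (valu P) j := by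
    intro l hl
    simp only [axs, List.mem_append, List.mem_cons] at hl
    rcases hl with h | h | h | h | h | h
    · exact all_axS hsig l h
    · exact all_axJ l h
    · simp only [axN, List.mem_flatMap, List.mem_range, List.mem_map] at h
      obtain ⟨c, hc, b, hb, a, ha, rfl⟩ := h
      by_cases hn : sN P a b c
      · obtain ⟨q, ⟨h1, h2, h3⟩ | ⟨h1, h2, h3⟩⟩ := hn
        · refine ⟨pJ a q b c, List.mem_cons_of_mem _ ?_, (lv_pJ h1 h2 hb hc).2 h3⟩
          rw [List.mem_flatMap]
          refine ⟨q, List.mem_range.2 (by omega), ?_⟩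
          have e1 : Nat.blt a q = true := by simpa [Nat.blt_eq] using h1
          have e2 : Nat.blt q b = true := by simpa [Nat.blt_eq] using h2
          rw [e1, e2]
          simp
        · refine ⟨pL a b q c, List.mem_cons_of_mem _ ?_, (lv_pL ha h1 h2 hc).2 h3⟩
          rw [List.mem_flatMap]
          refine ⟨q, List.mem_range.2 (by omega), ?_⟩
          have e0 : Nat.blt q b = false := by
            by_contra h
            have : q < b := by simpa [Nat.blt_eq] using h
            omega
          have e1 : Nat.blt b q = true := by simpa [Nat.blt_eq] using h1
          have e2 : Nat.blt q c = true := by simpa [Nat.blt_eq] using h2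
          rw [e0, e1, e2]
          simp
      · exact ⟨nN a b c, by simp, (lv_nN ha hb hc).2 hn⟩
    · simp only [axH, List.mem_flatMap, List.mem_range] at h
      obtain ⟨e, he, d, hd, c, hc, b, hb, a, ha, h⟩ := h
      cases hcond : (Nat.blt a 5 && Nat.blt 4 e) with
      | false =>
        rw [hcond] at h
        simp at h
      | true =>
        rw [hcond] at h
        rw [Bool.and_eq_true, Nat.blt_eq, Nat.blt_eq] at hcond
        have hp := hpent a b c d e ha hb hc hd he hcond.1 hcond.2
        unfold Pent at hp
        obtain ⟨h1, h2, h3, h4, h5, h6, h7, h8⟩ := hp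
        simp only [cond_true, List.mem_cons, List.not_mem_nil, or_false] at h
        have hac := ha.trans hb
        have hbd := hb.trans hc
        have hce := hc.trans hd
        have had := hac.trans hc
        have hbe := hbd.trans hd
        have hd' := hd.trans he
        have hc' := hce.trans he
        rcases h with rfl | rfl | rfl | rfl | rfl | rfl | rfl | rfl <;>
          simp only [List.mem_cons, List.not_mem_nil, or_false, exists_eq_or_imp, exists_eq_left,
            lv_pX ha hb hc', lv_nX ha hb hc', lv_pN ha hb hc',
            lv_pX ha hbd hd', lv_nX ha hbd hd',
            lv_pX ha hbe he, lv_nX ha hbe he,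
            lv_pX hac hc hd', lv_nX hac hc hd', lv_pN hac hc hd',
            lv_pX hac hce he, lv_nX hac hce he, lv_pN hac hce he,
            lv_pX had hd he, lv_nX had hd he,
            lv_pX hb hc hd', lv_nX hb hc hd', lv_pN hb hc hd',
            lv_pX hb hce he, lv_nX hb hce he, lv_pN hb hce he,
            lv_pX hbd hd he, lv_nX hbd hd he,
            lv_pX hc hd he, lv_nX hc hd he, lv_pN hc hd he]
        exacts [h1, h2, h3, h4, h5, h6, h7, h8]
    · subst h
      obtain ⟨a, b, c, d, ha, hb, hc, hd, h | h⟩ := hA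
      · refine ⟨pJ a b c d, ?_, (lv_pJ ha hb hc (by omega)).2 h⟩
        simp only [axA, List.mem_flatMap, List.mem_range]
        exact ⟨d, hd, c, hc, b, hb, a, ha, by simp⟩
      · refine ⟨pL a b c d, ?_, (lv_pL ha hb hc (by omega)).2 h⟩
        simp only [axA, List.mem_flatMap, List.mem_range]
        exact ⟨d, hd, c, hc, b, hb, a, ha, by simp⟩
    · simp only [axT, List.mem_append, List.mem_map, List.mem_range] at h
      rcases h with ⟨a, ha, rfl⟩ | ⟨a, ha, rfl⟩
      · exact ⟨_, by simp, (lv_pX ha (by norm_num) (by norm_num)).2 (hT1 a ha)⟩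
      · exact ⟨_, by simp, (lv_nX (by norm_num) (by omega) (by omega)).2 (hT2 a ha)⟩
  have hwf := List.all_eq_true.1 axs_wf
  have hgood : ∀ x ∈ axs.map mask, Good (valu P) x := by
    intro x hx
    obtain ⟨l, hl, rfl⟩ := List.mem_map.1 hx
    exact good_of_wf (hwf l hl) (hall l hl)
  have hd : Good (valu P) (mask [pX 0 4 5]) := by
    refine hgood _ (List.mem_map.2 ⟨_, ?_, rfl⟩)
    simp only [axs, axT, List.mem_append, List.mem_cons, List.mem_map, List.mem_range]
    exact Or.inr (Or.inr (Or.inr (Or.inr (Or.inr (Or.inl ⟨0, by norm_num, rfl⟩)))))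
  exact check_sound hd hgood check_steps

end FiveHole

namespace FiveHole

/-- Twice the signed area of a triangle. -/
def D (p q r : Pt) : ℝ := cross2 (q - p) (r - p)

theorem D_eq (p q r : Pt) : D p q r = (q.1 - p.1) * (r.2 - p.2) - (q.2 - p.2) * (r.1 - p.1) := rfl

theorem D_cyc (p q r : Pt) : D q r p = D p q r := by
  simp only [D_eq]; ring

theorem D_swap (p q r : Pt) : D q p r = - D p q r := by
  simp only [D_eq]; ring

theorem D_self (p q : Pt) : D p p q = 0 := by
  simp only [D_eq]; ring

theorem collinear_of_D {p q r : Pt} (hpq : p ≠ q) (h : D p q r = 0) :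
    Collinear ℝ ({p, q, r} : Set Pt) := by
  rw [collinear_iff_of_mem (p₀ := p) (by simp)]
  refine ⟨q - p, ?_⟩
  have key : ∃ t : ℝ, r = t • (q - p) +ᵥ p := by
    rw [D_eq] at h
    by_cases h1 : q.1 - p.1 = 0
    · have h2 : q.2 - p.2 ≠ 0 := by
        intro h2
        exact hpq (Prod.ext (by linarith) (by linarith))
      refine ⟨(r.2 - p.2) / (q.2 - p.2), Prod.ext ?_ ?_⟩
      · rw [h1] at h
        have h3 : r.1 - p.1 = 0 := by
          have : (q.2 - p.2) * (r.1 - p.1) = 0 := by linarith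
          exact (mul_eq_zero.1 this).resolve_left h2
        simp [h1]
        linarith
      · simp
        field_simp
        ring
    · refine ⟨(r.1 - p.1) / (q.1 - p.1), Prod.ext ?_ ?_⟩
      · simp
        field_simp
        ring
      · simp
        field_simp
        linarith
  intro x hx
  simp only [Set.mem_insert_iff, Set.mem_singleton_iff] at hx
  rcases hx with rfl | rfl | rfl
  · exact ⟨0, by simp⟩
  · exact ⟨1, by simp⟩
  · exact key

theorem D_ne_zero {S : Set Pt} (hg : GenPos S) {p q r : Pt} (hp : p ∈ S) (hq : q ∈ S) (hr : r ∈ S)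
    (h1 : p ≠ q) (h2 : p ≠ r) (h3 : q ≠ r) : D p q r ≠ 0 :=
  fun h => hg p hp q hq r hr h1 h2 h3 (collinear_of_D h1 h)

/-- A halfplane containing a set contains its convex hull. -/
theorem hull_half {S : Set Pt} {s t : Pt} (h : ∀ x ∈ S, 0 ≤ D s t x) {x : Pt}
    (hx : x ∈ convexHull ℝ S) : 0 ≤ D s t x := by
  have hc : Convex ℝ {x : Pt | 0 ≤ D s t x} := by
    intro x hx y hy a b ha hb hab
    simp only [Set.mem_ofPred_eq] at hx hy ⊢
    have : D s t (a • x + b • y) = a * D s t x + b * D s t y := by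
      have hb' : b = 1 - a := by linarith
      simp only [D_eq, Prod.fst_add, Prod.snd_add, Prod.smul_fst, Prod.smul_snd, smul_eq_mul, hb']
      ring
    rw [this]
    positivity
  exact convexHull_min (fun x hx => h x hx) hc hx

/-- The signs of the four triples of a sorted quadruple do not alternate. -/
theorem sig_core {p q r s : Pt} {α β : ℝ} (hab : α ≠ 0 ∨ β ≠ 0)
    (h1 : α * p.1 + β * p.2 ≤ α * q.1 + β * q.2) (h2 : α * q.1 + β * q.2 ≤ α * r.1 + β * r.2)
    (h3 : α * r.1 + β * r.2 ≤ α * s.1 + β * s.2)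
    (hA : D p q r ≠ 0) (hAE : 0 < D p q r * D q r s)
    (h : D p q r * D p q s < 0 ∨ D p q r * D p r s < 0) : False := by
  have e1 : D q r s - D p r s + D p q s - D p q r = 0 := by
    simp only [D_eq]; ring
  have e2 : D q r s * (α * p.1 + β * p.2) - D p r s * (α * q.1 + β * q.2)
      + D p q s * (α * r.1 + β * r.2) - D p q r * (α * s.1 + β * s.2) = 0 := by
    simp only [D_eq]; ring
  have e3 : D p q r * α = (α * q.1 + β * q.2 - (α * p.1 + β * p.2)) * (r.2 - p.2)
      - (α * r.1 + β * r.2 - (α * p.1 + β * p.2)) * (q.2 - p.2) := by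
    simp only [D_eq]; ring
  have e4 : D p q r * β = (α * r.1 + β * r.2 - (α * p.1 + β * p.2)) * (q.1 - p.1)
      - (α * q.1 + β * q.2 - (α * p.1 + β * p.2)) * (r.1 - p.1) := by
    simp only [D_eq]; ring
  generalize α * p.1 + β * p.2 = f1 at *
  generalize α * q.1 + β * q.2 = f2 at *
  generalize α * r.1 + β * r.2 = f3 at *
  generalize α * s.1 + β * s.2 = f4 at *
  obtain ⟨x, rfl⟩ : ∃ x, f2 = f1 + x := ⟨f2 - f1, by ring⟩
  obtain ⟨y, rfl⟩ : ∃ y, f3 = f1 + x + y := ⟨f3 - (f1 + x), by ring⟩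
  obtain ⟨z, rfl⟩ : ∃ z, f4 = f1 + x + y + z := ⟨f4 - (f1 + x + y), by ring⟩
  have hx : 0 ≤ x := by linarith
  have hy : 0 ≤ y := by linarith
  have hz : 0 ≤ z := by linarith
  have hxy : x = 0 ∧ y = 0 := by
    generalize D p q r = A at *
    generalize D p q s = B at *
    generalize D p r s = C at *
    generalize D q r s = E at *
    have hA2 : 0 < A * A := mul_self_pos.2 hA
    have g1 : A * E * x + (A * A - A * B) * y + A * A * z = 0 := by
      have : C = E + B - A := by linarith
      subst this
      linear_combination (-A) * e2
    have g2 : 0 < A * A - A * B := by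
      rcases h with h | h
      · linarith
      · have : A * A - A * B = A * E - A * C := by
          linear_combination (-A) * e1
        rw [this]; linarith
    have k1 : 0 ≤ A * E * x := by positivity
    have k2 : 0 ≤ (A * A - A * B) * y := by positivity
    have k3 : 0 ≤ A * A * z := by positivity
    constructor
    · have : A * E * x = 0 := by linarith
      exact (mul_eq_zero.1 this).resolve_left hAE.ne'
    · have : (A * A - A * B) * y = 0 := by linarith
      exact (mul_eq_zero.1 this).resolve_left g2.ne'
  obtain ⟨rfl, rfl⟩ := hxy
  have e3' : D p q r * α = 0 := by rw [e3]; ring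
  have e4' : D p q r * β = 0 := by rw [e4]; ring
  rcases hab with hab | hab
  · exact hab ((mul_eq_zero.1 e3').resolve_left hA)
  · exact hab ((mul_eq_zero.1 e4').resolve_left hA)

/-- Positive orientation of three indexed points. -/
def PP (p : ℕ → Pt) (a b c : ℕ) : Prop := 0 < D (p a) (p b) (p c)

theorem sig_of {p : ℕ → Pt} {a b c d : ℕ} {α β : ℝ} (hab : α ≠ 0 ∨ β ≠ 0)
    (h1 : α * (p a).1 + β * (p a).2 ≤ α * (p b).1 + β * (p b).2)
    (h2 : α * (p b).1 + β * (p b).2 ≤ α * (p c).1 + β * (p c).2)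
    (h3 : α * (p c).1 + β * (p c).2 ≤ α * (p d).1 + β * (p d).2)
    (hA : D (p a) (p b) (p c) ≠ 0) (hB : D (p a) (p b) (p d) ≠ 0)
    (hC : D (p a) (p c) (p d) ≠ 0) (hE : D (p b) (p c) (p d) ≠ 0) : Sig (PP p) a b c d := by
  have key := sig_core hab h1 h2 h3 hA
  have e1 : D (p b) (p c) (p d) - D (p a) (p c) (p d) + D (p a) (p b) (p d)
      - D (p a) (p b) (p c) = 0 := by
    simp only [D_eq]; ring
  unfold Sig PP
  generalize D (p a) (p b) (p c) = A at *
  generalize D (p a) (p b) (p d) = B at *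
  generalize D (p a) (p c) (p d) = C at *
  generalize D (p b) (p c) (p d) = E at *
  clear h1 h2 h3
  rcases lt_or_gt_of_ne hA with hA | hA <;> rcases lt_or_gt_of_ne hB with hB | hB <;>
    rcases lt_or_gt_of_ne hC with hC | hC <;> rcases lt_or_gt_of_ne hE with hE | hE <;>
    simp only [hA, hB, hC, hE, not_lt.2 hA.le, not_lt.2 hB.le, not_lt.2 hC.le, not_lt.2 hE.le,
      true_iff, false_iff, not_true, imp_self, and_self, true_imp_iff,
      false_imp_iff, and_true, true_and, iff_self] <;>
    first
      | linarith
      | exact key (mul_pos hA hE) (Or.inl (mul_neg_of_pos_of_neg hA hB))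
      | exact key (mul_pos hA hE) (Or.inr (mul_neg_of_pos_of_neg hA hC))
      | exact key (mul_pos_of_neg_of_neg hA hE) (Or.inl (mul_neg_of_neg_of_pos hA hB))
      | exact key (mul_pos_of_neg_of_neg hA hE) (Or.inr (mul_neg_of_neg_of_pos hA hC))

end FiveHole

namespace FiveHole

/-- A good labelling of the points. -/
structure Conf (A B : Finset Pt) (p : ℕ → Pt) : Prop where
  memA : ∀ j < 5, p j ∈ A
  memB : ∀ j < 11, 5 ≤ j → p j ∈ B
  coverA : ∀ x ∈ A, ∃ j < 5, x = p j
  cover : ∀ x ∈ A ∪ B, ∃ j < 11, x = p j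
  ne : ∀ a < 11, ∀ b < 11, ∀ c < 11, a ≠ b → a ≠ c → b ≠ c → D (p a) (p b) (p c) ≠ 0
  sig : ∀ a b c d, a < b → b < c → c < d → d < 11 → Sig (PP p) a b c d

section conf

variable {A B : Finset Pt} {p : ℕ → Pt}

theorem PP_cyc (a b c : ℕ) : PP p b c a ↔ PP p a b c := by
  unfold PP; rw [D_cyc]

theorem Conf.swap (h : Conf A B p) {a b c : ℕ} (ha : a < 11) (hb : b < 11) (hc : c < 11)
    (hab : a ≠ b) (hac : a ≠ c) (hbc : b ≠ c) : PP p b a c ↔ ¬ PP p a b c := by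
  unfold PP
  rw [D_swap, neg_pos, not_lt]
  exact ⟨le_of_lt, fun h' => lt_of_le_of_ne h' (h.ne a ha b hb c hc hab hac hbc)⟩

theorem Conf.perm (h : Conf A B p) {x y z : ℕ} (hxy : x < y) (hyz : y < z) (hz : z < 11) :
    (PP p y z x ↔ PP p x y z) ∧ (PP p z x y ↔ PP p x y z) ∧ (PP p y x z ↔ ¬ PP p x y z) ∧
    (PP p x z y ↔ ¬ PP p x y z) ∧ (PP p z y x ↔ ¬ PP p x y z) := by
  have h0 := h.swap (a := x) (b := y) (c := z) (by omega) (by omega) hz (by omega) (by omega)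
    (by omega)
  refine ⟨PP_cyc _ _ _, (PP_cyc _ _ _).symm, h0, ?_, ?_⟩
  · rw [PP_cyc y x z, h0]
  · rw [← PP_cyc z y x, h0]

theorem PP_ne {a b c : ℕ} (h : PP p a b c) : a ≠ b ∧ a ≠ c ∧ b ≠ c := by
  unfold PP at h
  refine ⟨?_, ?_, ?_⟩ <;> rintro rfl
  · rw [D_self] at h; exact lt_irrefl _ h
  · rw [← D_cyc, ← D_cyc, D_self] at h; exact lt_irrefl _ h
  · rw [← D_cyc, D_self] at h; exact lt_irrefl _ h

theorem PP_pt_ne {a b c : ℕ} (h : PP p a b c) : p a ≠ p b ∧ p a ≠ p c ∧ p b ≠ p c := by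
  unfold PP at h
  refine ⟨?_, ?_, ?_⟩ <;> intro e
  · rw [e, D_self] at h; exact lt_irrefl _ h
  · rw [e, ← D_cyc, ← D_cyc, D_self] at h; exact lt_irrefl _ h
  · rw [e, ← D_cyc, D_self] at h; exact lt_irrefl _ h

/-- Points of a triangle, combinatorially. -/
theorem Conf.sIn (h : Conf A B p) {x y z q : ℕ} (hxy : x < y) (hyz : y < z) (hz : z < 11)
    (hq : q < 11)
    (hh : (PP p x y q ∧ PP p y z q ∧ PP p z x q) ∨ (PP p y x q ∧ PP p z y q ∧ PP p x z q)) :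
    sIn (PP p) x y z q := by
  have hne : x ≠ q ∧ y ≠ q ∧ z ≠ q := by
    rcases hh with ⟨h1, h2, h3⟩ | ⟨h1, h2, h3⟩
    · exact ⟨(PP_ne h1).2.1, (PP_ne h1).2.2, (PP_ne h2).2.2⟩
    · exact ⟨(PP_ne h1).2.2, (PP_ne h1).2.1, (PP_ne h2).2.1⟩
  obtain ⟨n1, n2, n3⟩ := hne
  rcases lt_or_gt_of_ne n1 with k1 | k1
  · rcases lt_or_gt_of_ne n2 with k2 | k2
    · rcases lt_or_gt_of_ne n3 with k3 | k3
      · exfalso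
        obtain ⟨s1, s2, s3, s4⟩ := h.sig x y z q hxy hyz k3 hq
        obtain ⟨a1, a2, a3, a4, a5⟩ := h.perm hxy k2 hq
        obtain ⟨b1, b2, b3, b4, b5⟩ := h.perm hyz k3 hq
        obtain ⟨c1, c2, c3, c4, c5⟩ := h.perm (hxy.trans hyz) k3 hq
        grind
      · refine Or.inr ⟨k2, k3, ?_⟩
        obtain ⟨s1, s2, s3, s4⟩ := h.sig x y q z hxy k2 k3 hz
        obtain ⟨a1, a2, a3, a4, a5⟩ := h.perm hxy k2 hq
        obtain ⟨b1, b2, b3, b4, b5⟩ := h.perm k2 k3 hz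
        obtain ⟨c1, c2, c3, c4, c5⟩ := h.perm k1 k3 hz
        unfold sL
        grind
    · refine Or.inl ⟨k1, k2, ?_⟩
      obtain ⟨s1, s2, s3, s4⟩ := h.sig x q y z k1 k2 hyz hz
      obtain ⟨a1, a2, a3, a4, a5⟩ := h.perm k1 k2 (by omega)
      obtain ⟨b1, b2, b3, b4, b5⟩ := h.perm k2 hyz hz
      obtain ⟨c1, c2, c3, c4, c5⟩ := h.perm k1 (k2.trans hyz) hz
      unfold sJ
      grind
  · exfalso
    obtain ⟨s1, s2, s3, s4⟩ := h.sig q x y z k1 hxy hyz hz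
    obtain ⟨a1, a2, a3, a4, a5⟩ := h.perm k1 hxy (by omega)
    obtain ⟨b1, b2, b3, b4, b5⟩ := h.perm (k1.trans hxy) hyz hz
    obtain ⟨c1, c2, c3, c4, c5⟩ := h.perm k1 (hxy.trans hyz) hz
    grind

theorem vertex {S : Set Pt} {a b c : Pt} (hb : D a c b < 0)
    (h : ∀ x ∈ S, x = b ∨ 0 ≤ D a c x) : b ∉ convexHull ℝ (S \ {b}) := by
  intro hx
  have := hull_half (s := a) (t := c) (fun x hx => (h x hx.1).resolve_left hx.2) hx
  linarith

theorem D_last {p q : Pt} : D p q p = 0 := by rw [← D_cyc, ← D_cyc, D_self]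

theorem D_last' {p q : Pt} : D p q q = 0 := by rw [← D_cyc, D_self]

theorem pent_vertex {a b c d e : Pt} {S : Set Pt}
    (hS : ∀ x ∈ S, x = a ∨ x = b ∨ x = c ∨ x = d ∨ x = e)
    (h1 : 0 < D a b e) (h2 : 0 < D b c e) (h3 : 0 < D b d e) : a ∉ convexHull ℝ (S \ {a}) := by
  apply vertex (a := e) (c := b)
  · simp only [D_eq] at *
    linarith
  · intro x hx
    rcases hS x hx with rfl | rfl | rfl | rfl | rfl
    · exact Or.inl rfl
    all_goals
      right
      simp only [D_eq] at *
      linarith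

theorem rot5 {a b c d e : Prop} : a ∨ b ∨ c ∨ d ∨ e → b ∨ c ∨ d ∨ e ∨ a := by
  rintro (h | h | h | h | h) <;> simp [h]

theorem pent_edge {a b c d e q : Pt} {S : Set Pt}
    (hS : ∀ x ∈ S, x = a ∨ x = b ∨ x = c ∨ x = d ∨ x = e)
    (h1 : 0 < D a b c) (h2 : 0 < D a b d) (h3 : 0 < D a b e) (hq : q ∈ convexHull ℝ S) :
    0 ≤ D a b q := by
  refine hull_half (fun x hx => ?_) hq
  rcases hS x hx with rfl | rfl | rfl | rfl | rfl
  · exact D_last.ge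
  · exact D_last'.ge
  · exact h1.le
  · exact h2.le
  · exact h3.le

/-- Convex pentagons with empty triangles give divided holes. -/
theorem Conf.hole (h : Conf A B p) {c0 c1 c2 c3 c4 : ℕ} (l0 : c0 < 11) (l1 : c1 < 11)
    (l2 : c2 < 11) (l3 : c3 < 11) (l4 : c4 < 11)
    (h012 : PP p c0 c1 c2) (h013 : PP p c0 c1 c3) (h014 : PP p c0 c1 c4) (h023 : PP p c0 c2 c3)
    (h024 : PP p c0 c2 c4) (h034 : PP p c0 c3 c4) (h123 : PP p c1 c2 c3) (h124 : PP p c1 c2 c4)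
    (h134 : PP p c1 c3 c4) (h234 : PP p c2 c3 c4)
    (t1 : ∀ q < 11, ¬ (PP p c0 c1 q ∧ PP p c1 c2 q ∧ PP p c2 c0 q))
    (t2 : ∀ q < 11, ¬ (PP p c0 c2 q ∧ PP p c2 c3 q ∧ PP p c3 c0 q))
    (t3 : ∀ q < 11, ¬ (PP p c0 c3 q ∧ PP p c3 c4 q ∧ PP p c4 c0 q))
    (ma : c0 < 5 ∨ c1 < 5 ∨ c2 < 5 ∨ c3 < 5 ∨ c4 < 5)
    (mb : 5 ≤ c0 ∨ 5 ≤ c1 ∨ 5 ≤ c2 ∨ 5 ≤ c3 ∨ 5 ≤ c4) :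
    ∃ H : Finset Pt, DividedFiveHole A B H := by
  classical
  have hmem : ∀ j < 11, p j ∈ A ∪ B := by
    intro j hj
    rcases lt_or_ge j 5 with h5 | h5
    · exact Finset.mem_union_left _ (h.memA j h5)
    · exact Finset.mem_union_right _ (h.memB j hj h5)
  have cyc : ∀ x y z : Pt, D y z x = D x y z := fun x y z => D_cyc x y z
  have n01 := (PP_pt_ne h012).1
  have n02 := (PP_pt_ne h012).2.1
  have n12 := (PP_pt_ne h012).2.2
  have n03 := (PP_pt_ne h034).1
  have n04 := (PP_pt_ne h034).2.1
  have n34 := (PP_pt_ne h034).2.2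
  have n13 := (PP_pt_ne h134).1
  have n14 := (PP_pt_ne h134).2.1
  have n23 := (PP_pt_ne h234).1
  have n24 := (PP_pt_ne h234).2.1
  refine ⟨{p c0, p c1, p c2, p c3, p c4}, ⟨?_, ?_, ?_, ?_⟩, ?_, ?_⟩
  · intro x hx
    simp only [Finset.mem_insert, Finset.mem_singleton] at hx
    rcases hx with rfl | rfl | rfl | rfl | rfl <;> apply hmem <;> assumption
  · rw [Finset.card_insert_of_notMem, Finset.card_insert_of_notMem, Finset.card_insert_of_notMem,
      Finset.card_insert_of_notMem, Finset.card_singleton] <;> simp [*]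
  · unfold PP at *
    intro x hx
    simp only [Finset.coe_insert, Finset.coe_singleton, Set.mem_insert_iff,
      Set.mem_singleton_iff] at hx ⊢
    have hS : ∀ x ∈ ({p c0, p c1, p c2, p c3, p c4} : Set Pt), x = p c0 ∨ x = p c1 ∨ x = p c2 ∨
        x = p c3 ∨ x = p c4 := fun x hx => by simpa using hx
    rcases hx with rfl | rfl | rfl | rfl | rfl
    · exact pent_vertex hS h014 h124 h134
    · refine pent_vertex (b := p c2) (c := p c3) (d := p c4) (e := p c0)
        (fun x hx => rot5 (hS x hx)) ?_ ?_ ?_ <;> rw [D_cyc] <;> assumption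
    · refine pent_vertex (b := p c3) (c := p c4) (d := p c0) (e := p c1)
        (fun x hx => rot5 (rot5 (hS x hx))) ?_ ?_ ?_ <;>
        first | (rw [D_cyc]; assumption) | (rw [← D_cyc]; assumption)
    · refine pent_vertex (b := p c4) (c := p c0) (d := p c1) (e := p c2)
        (fun x hx => rot5 (rot5 (rot5 (hS x hx)))) ?_ ?_ ?_ <;>
        first | (rw [D_cyc]; assumption) | (rw [← D_cyc]; assumption)
    · refine pent_vertex (b := p c0) (c := p c1) (d := p c2) (e := p c3)
        (fun x hx => rot5 (rot5 (rot5 (rot5 (hS x hx))))) ?_ ?_ ?_ <;>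
        first | assumption | (rw [← D_cyc]; assumption)
  · intro x hx hxH hxc
    obtain ⟨q, hq, rfl⟩ := h.cover x hx
    have hS : ∀ x ∈ (↑({p c0, p c1, p c2, p c3, p c4} : Finset Pt) : Set Pt),
        x = p c0 ∨ x = p c1 ∨ x = p c2 ∨ x = p c3 ∨ x = p c4 := fun x hx => by simpa using hx
    have hqn : q ≠ c0 ∧ q ≠ c1 ∧ q ≠ c2 ∧ q ≠ c3 ∧ q ≠ c4 := by
      refine ⟨?_, ?_, ?_, ?_, ?_⟩ <;> rintro rfl <;> simp at hxH
    obtain ⟨q0, q1, q2, q3, q4⟩ := hqn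
    have str : ∀ i < 11, ∀ j < 11, i ≠ j → q ≠ i → q ≠ j → 0 ≤ D (p i) (p j) (p q) →
        PP p i j q := by
      intro i hi j hj hij hi' hj' h0
      exact lt_of_le_of_ne h0 (h.ne i hi j hj q hq hij hi'.symm hj'.symm).symm
    have m01 := (PP_ne h012).1
    have m02 := (PP_ne h012).2.1
    have m12 := (PP_ne h012).2.2
    have m03 := (PP_ne h034).1
    have m04 := (PP_ne h034).2.1
    have m34 := (PP_ne h034).2.2
    have m23 := (PP_ne h234).1
    have e01 : PP p c0 c1 q := by
      refine str _ l0 _ l1 m01 q0 q1 (pent_edge (fun x hx => hS x hx)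
        h012
        h013
        h014
        hxc)
    have e12 : PP p c1 c2 q := by
      refine str _ l1 _ l2 m12 q1 q2 (pent_edge (fun x hx => rot5 (hS x hx))
        h123
        h124
        (by unfold PP at *; rw [D_cyc]; exact h012)
        hxc)
    have e23 : PP p c2 c3 q := by
      refine str _ l2 _ l3 m23 q2 q3 (pent_edge (fun x hx => rot5 (rot5 (hS x hx)))
        h234
        (by unfold PP at *; rw [D_cyc]; exact h023)
        (by unfold PP at *; rw [D_cyc]; exact h123)
        hxc)
    have e34 : PP p c3 c4 q := by
      refine str _ l3 _ l4 m34 q3 q4 (pent_edge (fun x hx => rot5 (rot5 (rot5 (hS x hx))))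
        (by unfold PP at *; rw [D_cyc]; exact h034)
        (by unfold PP at *; rw [D_cyc]; exact h134)
        (by unfold PP at *; rw [D_cyc]; exact h234)
        hxc)
    have e40 : PP p c4 c0 q := by
      refine str _ l4 _ l0 m04.symm q4 q0 (pent_edge (fun x hx => rot5 (rot5 (rot5 (rot5 (hS x hx)))))
        (by unfold PP at *; rw [← D_cyc]; exact h014)
        (by unfold PP at *; rw [← D_cyc]; exact h024)
        (by unfold PP at *; rw [← D_cyc]; exact h034)
        hxc)
    by_cases d2 : PP p c0 c2 q
    · by_cases d3 : PP p c0 c3 q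
      · exact t3 q hq ⟨d3, e34, e40⟩
      · exact t2 q hq ⟨d2, e23, (h.swap l0 l3 hq m03 q0.symm q3.symm).2 d3⟩
    · exact t1 q hq ⟨e01, e12, (h.swap l0 l2 hq m02 q0.symm q2.symm).2 d2⟩
  · rcases ma with m | m | m | m | m
    · exact ⟨p c0, by simp, h.memA _ m⟩
    · exact ⟨p c1, by simp, h.memA _ m⟩
    · exact ⟨p c2, by simp, h.memA _ m⟩
    · exact ⟨p c3, by simp, h.memA _ m⟩
    · exact ⟨p c4, by simp, h.memA _ m⟩
  · rcases mb with m | m | m | m | m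
    · exact ⟨p c0, by simp, h.memB _ l0 m⟩
    · exact ⟨p c1, by simp, h.memB _ l1 m⟩
    · exact ⟨p c2, by simp, h.memB _ l2 m⟩
    · exact ⟨p c3, by simp, h.memB _ l3 m⟩
    · exact ⟨p c4, by simp, h.memB _ l4 m⟩

end conf
end FiveHole

namespace FiveHole

section conf

variable {A B : Finset Pt} {p : ℕ → Pt}

theorem Conf.not_tri (h : Conf A B p) {x y z : ℕ} (hxy : x < y) (hyz : y < z) (hz : z < 11)
    (hn : ¬ sN (PP p) x y z) (q : ℕ) (hq : q < 11) :
    ¬ (PP p x y q ∧ PP p y z q ∧ PP p z x q) ∧ ¬ (PP p y x q ∧ PP p z y q ∧ PP p x z q) :=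
  ⟨fun hh => hn ⟨q, h.sIn hxy hyz hz hq (Or.inl hh)⟩,
    fun hh => hn ⟨q, h.sIn hxy hyz hz hq (Or.inr hh)⟩⟩

/-- If there is no divided hole, then the pentagon clauses hold. -/
theorem Conf.pent (h : Conf A B p) (hno : ¬ ∃ H : Finset Pt, DividedFiveHole A B H)
    {a b c d e : ℕ} (ha : a < b) (hb : b < c) (hc : c < d) (hd : d < e) (he : e < 11)
    (ha5 : a < 5) (he5 : 5 ≤ e) : Pent (PP p) a b c d e := by
  have hac := ha.trans hb
  have hbd := hb.trans hc
  have hce := hc.trans hd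
  have had := hac.trans hc
  have hbe := hbd.trans hd
  have ld := hd.trans he
  have lc := hc.trans ld
  have lb := hb.trans lc
  have la := ha.trans lb
  have sabcd := h.sig a b c d ha hb hc ld
  have sabce := h.sig a b c e ha hb hce he
  have sabde := h.sig a b d e ha hbd hd he
  have sacde := h.sig a c d e hac hc hd he
  have sbcde := h.sig b c d e hb hc hd he
  have pabc := h.perm ha hb lc
  have pabd := h.perm ha hbd ld
  have pabe := h.perm ha hbe he
  have pacd := h.perm hac hc ld
  have pace := h.perm hac hce he
  have pade := h.perm had hd he
  have pbcd := h.perm hb hc ld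
  have pbce := h.perm hb hce he
  have pbde := h.perm hbd hd he
  have pcde := h.perm hc hd he
  unfold Sig at sabcd sabce sabde sacde sbcde
  refine ⟨?_, ?_, ?_, ?_, ?_, ?_, ?_, ?_⟩ <;> by_contra hcon <;> apply hno <;> clear hno <;>
    simp only [not_or, not_not] at hcon <;> obtain ⟨r1, r2, r3, n1, n2, n3⟩ := hcon
  · have kabd : PP p a b d := by
      clear * - r1 r2 sabcd
      grind
    have kacd : PP p a c d := by
      clear * - r1 r2 sabcd
      grind
    have kace : PP p a c e := by
      clear * - kacd r3 sacde
      grind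
    have kabe : PP p a b e := by
      clear * - r1 kace sabce
      grind
    have kade : PP p a d e := by
      clear * - kacd r3 sacde
      grind
    have kbce : PP p b c e := by
      clear * - r2 r3 sbcde
      grind
    have kbde : PP p b d e := by
      clear * - r2 r3 sbcde
      grind
    refine h.hole lc ld he la lb
      r3
      (pacd.1.2 kacd)
      (pbcd.1.2 r2)
      (pace.1.2 kace)
      (pbce.1.2 kbce)
      (pabc.2.1.2 r1)
      (pade.1.2 kade)
      (pbde.1.2 kbde)
      (pabd.2.1.2 kabd)
      (pabe.2.1.2 kabe)
      (fun q hq ⟨h1, h2, h3⟩ => (h.not_tri hc hd he n1 q hq).1 ⟨h1, h2, h3⟩)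
      (fun q hq ⟨h1, h2, h3⟩ => (h.not_tri hac hce he n2 q hq).1 ⟨h3, h1, h2⟩)
      (fun q hq ⟨h1, h2, h3⟩ => (h.not_tri ha hb lc n3 q hq).1 ⟨h2, h3, h1⟩)
      (by omega) (by omega)
  · have kabe : PP p a b e := by
      clear * - r2 r3 sabce
      grind
    have kace : PP p a c e := by
      clear * - r2 r3 sabce
      grind
    have kabd : PP p a b d := by
      clear * - kabe r1 sabde
      grind
    have kbde : ¬ PP p b d e := by
      clear * - kabd r1 sabde
      grind
    have kacd : PP p a c d := by
      clear * - kace r1 sacde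
      grind
    have kcde : ¬ PP p c d e := by
      clear * - kacd r1 sacde
      grind
    have kbcd : PP p b c d := by
      clear * - r3 kbde sbcde
      grind
    refine h.hole lc he ld la lb
      (pcde.2.2.2.1.2 kcde)
      (pace.1.2 kace)
      (pbce.1.2 r3)
      (pacd.1.2 kacd)
      (pbcd.1.2 kbcd)
      (pabc.2.1.2 r2)
      (pade.2.2.2.2.2 r1)
      (pbde.2.2.2.2.2 kbde)
      (pabe.2.1.2 kabe)
      (pabd.2.1.2 kabd)
      (fun q hq ⟨h1, h2, h3⟩ => (h.not_tri hc hd he n1 q hq).2 ⟨h3, h2, h1⟩)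
      (fun q hq ⟨h1, h2, h3⟩ => (h.not_tri hac hc ld n2 q hq).1 ⟨h3, h1, h2⟩)
      (fun q hq ⟨h1, h2, h3⟩ => (h.not_tri ha hb lc n3 q hq).1 ⟨h2, h3, h1⟩)
      (by omega) (by omega)
  · have kabe : PP p a b e := by
      clear * - r2 r3 sabde
      grind
    have kabc : PP p a b c := by
      clear * - kabe r1 sabce
      grind
    have kbce : ¬ PP p b c e := by
      clear * - kabc r1 sabce
      grind
    have kade : PP p a d e := by
      clear * - r2 r3 sabde
      grind
    have kacd : ¬ PP p a c d := by
      clear * - r1 kade sacde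
      grind
    have kbcd : ¬ PP p b c d := by
      clear * - kabc kacd sabcd
      grind
    have kcde : PP p c d e := by
      clear * - kacd kade sacde
      grind
    refine h.hole lc la lb ld he
      (pabc.2.1.2 kabc)
      (pacd.2.2.1.2 kacd)
      (pace.2.2.1.2 r1)
      (pbcd.2.2.1.2 kbcd)
      (pbce.2.2.1.2 kbce)
      kcde
      r2
      kabe
      kade
      r3
      (fun q hq ⟨h1, h2, h3⟩ => (h.not_tri ha hb lc n1 q hq).1 ⟨h2, h3, h1⟩)
      (fun q hq ⟨h1, h2, h3⟩ => (h.not_tri hb hc ld n2 q hq).2 ⟨h1, h3, h2⟩)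
      (fun q hq ⟨h1, h2, h3⟩ => (h.not_tri hc hd he n3 q hq).1 ⟨h1, h2, h3⟩)
      (by omega) (by omega)
  · have kace : ¬ PP p a c e := by
      clear * - r1 r2 sacde
      grind
    have kabc : PP p a b c := by
      clear * - r3 kace sabce
      grind
    have kbcd : ¬ PP p b c d := by
      clear * - kabc r1 sabcd
      grind
    have kbce : ¬ PP p b c e := by
      clear * - kabc kace sabce
      grind
    have kade : ¬ PP p a d e := by
      clear * - r1 r2 sacde
      grind
    have kabd : PP p a b d := by
      clear * - r3 kade sabde
      grind
    have kbde : ¬ PP p b d e := by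
      clear * - kabd kade sabde
      grind
    refine h.hole lc la lb he ld
      (pabc.2.1.2 kabc)
      (pace.2.2.1.2 kace)
      (pacd.2.2.1.2 r1)
      (pbce.2.2.1.2 kbce)
      (pbcd.2.2.1.2 kbcd)
      (pcde.2.2.2.1.2 r2)
      r3
      kabd
      (pade.2.2.2.1.2 kade)
      (pbde.2.2.2.1.2 kbde)
      (fun q hq ⟨h1, h2, h3⟩ => (h.not_tri ha hb lc n1 q hq).1 ⟨h2, h3, h1⟩)
      (fun q hq ⟨h1, h2, h3⟩ => (h.not_tri hb hce he n2 q hq).2 ⟨h1, h3, h2⟩)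
      (fun q hq ⟨h1, h2, h3⟩ => (h.not_tri hc hd he n3 q hq).2 ⟨h3, h2, h1⟩)
      (by omega) (by omega)
  · have kace : PP p a c e := by
      clear * - r2 r3 sacde
      grind
    have kabc : ¬ PP p a b c := by
      clear * - r1 kace sabce
      grind
    have kbcd : PP p b c d := by
      clear * - kabc r2 sabcd
      grind
    have kbce : PP p b c e := by
      clear * - kabc kace sabce
      grind
    have kade : PP p a d e := by
      clear * - r2 r3 sacde
      grind
    have kabd : ¬ PP p a b d := by
      clear * - r1 kade sabde
      grind
    have kbde : PP p b d e := by
      clear * - kabd kade sabde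
      grind
    refine h.hole lc ld he lb la
      r3
      (pbcd.1.2 kbcd)
      (pacd.1.2 r2)
      (pbce.1.2 kbce)
      (pace.1.2 kace)
      (pabc.2.2.2.2.2 kabc)
      (pbde.1.2 kbde)
      (pade.1.2 kade)
      (pabd.2.2.2.2.2 kabd)
      (pabe.2.2.2.2.2 r1)
      (fun q hq ⟨h1, h2, h3⟩ => (h.not_tri hc hd he n1 q hq).1 ⟨h1, h2, h3⟩)
      (fun q hq ⟨h1, h2, h3⟩ => (h.not_tri hb hce he n2 q hq).1 ⟨h3, h1, h2⟩)
      (fun q hq ⟨h1, h2, h3⟩ => (h.not_tri ha hb lc n3 q hq).2 ⟨h2, h1, h3⟩)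
      (by omega) (by omega)
  · have kabe : ¬ PP p a b e := by
      clear * - r1 r2 sabde
      grind
    have kabc : ¬ PP p a b c := by
      clear * - kabe r3 sabce
      grind
    have kbce : PP p b c e := by
      clear * - kabc r3 sabce
      grind
    have kade : ¬ PP p a d e := by
      clear * - r1 r2 sabde
      grind
    have kacd : PP p a c d := by
      clear * - r3 kade sacde
      grind
    have kbcd : PP p b c d := by
      clear * - kabc kacd sabcd
      grind
    have kcde : ¬ PP p c d e := by
      clear * - kacd kade sacde
      grind
    refine h.hole lc he ld lb la
      (pcde.2.2.2.1.2 kcde)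
      (pbce.1.2 kbce)
      (pace.1.2 r3)
      (pbcd.1.2 kbcd)
      (pacd.1.2 kacd)
      (pabc.2.2.2.2.2 kabc)
      (pbde.2.2.2.2.2 r2)
      (pade.2.2.2.2.2 kade)
      (pabe.2.2.2.2.2 kabe)
      (pabd.2.2.2.2.2 r1)
      (fun q hq ⟨h1, h2, h3⟩ => (h.not_tri hc hd he n1 q hq).2 ⟨h3, h2, h1⟩)
      (fun q hq ⟨h1, h2, h3⟩ => (h.not_tri hb hc ld n2 q hq).1 ⟨h3, h1, h2⟩)
      (fun q hq ⟨h1, h2, h3⟩ => (h.not_tri ha hb lc n3 q hq).2 ⟨h2, h1, h3⟩)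
      (by omega) (by omega)
  · have kabe : ¬ PP p a b e := by
      clear * - r1 r2 sabce
      grind
    have kace : ¬ PP p a c e := by
      clear * - r1 r2 sabce
      grind
    have kabd : ¬ PP p a b d := by
      clear * - kabe r3 sabde
      grind
    have kbde : PP p b d e := by
      clear * - kabd r3 sabde
      grind
    have kacd : ¬ PP p a c d := by
      clear * - kace r3 sacde
      grind
    have kcde : PP p c d e := by
      clear * - kacd r3 sacde
      grind
    have kbcd : ¬ PP p b c d := by
      clear * - r2 kbde sbcde
      grind
    refine h.hole lc lb la ld he
      (pabc.2.2.2.2.2 r1)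
      (pbcd.2.2.1.2 kbcd)
      (pbce.2.2.1.2 r2)
      (pacd.2.2.1.2 kacd)
      (pace.2.2.1.2 kace)
      kcde
      (pabd.2.2.1.2 kabd)
      (pabe.2.2.1.2 kabe)
      kbde
      r3
      (fun q hq ⟨h1, h2, h3⟩ => (h.not_tri ha hb lc n1 q hq).2 ⟨h2, h1, h3⟩)
      (fun q hq ⟨h1, h2, h3⟩ => (h.not_tri hac hc ld n2 q hq).2 ⟨h1, h3, h2⟩)
      (fun q hq ⟨h1, h2, h3⟩ => (h.not_tri hc hd he n3 q hq).1 ⟨h1, h2, h3⟩)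
      (by omega) (by omega)
  · have kabd : ¬ PP p a b d := by
      clear * - r1 r2 sabcd
      grind
    have kacd : ¬ PP p a c d := by
      clear * - r1 r2 sabcd
      grind
    have kace : ¬ PP p a c e := by
      clear * - kacd r3 sacde
      grind
    have kabe : ¬ PP p a b e := by
      clear * - r1 kace sabce
      grind
    have kade : ¬ PP p a d e := by
      clear * - kacd r3 sacde
      grind
    have kbce : ¬ PP p b c e := by
      clear * - r2 r3 sbcde
      grind
    have kbde : ¬ PP p b d e := by
      clear * - r2 r3 sbcde
      grind
    refine h.hole lc lb la he ld
      (pabc.2.2.2.2.2 r1)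
      (pbce.2.2.1.2 kbce)
      (pbcd.2.2.1.2 r2)
      (pace.2.2.1.2 kace)
      (pacd.2.2.1.2 kacd)
      (pcde.2.2.2.1.2 r3)
      (pabe.2.2.1.2 kabe)
      (pabd.2.2.1.2 kabd)
      (pbde.2.2.2.1.2 kbde)
      (pade.2.2.2.1.2 kade)
      (fun q hq ⟨h1, h2, h3⟩ => (h.not_tri ha hb lc n1 q hq).2 ⟨h2, h1, h3⟩)
      (fun q hq ⟨h1, h2, h3⟩ => (h.not_tri hac hce he n2 q hq).2 ⟨h1, h3, h2⟩)
      (fun q hq ⟨h1, h2, h3⟩ => (h.not_tri hc hd he n3 q hq).2 ⟨h3, h2, h1⟩)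
      (by omega) (by omega)

end conf
end FiveHole

namespace FiveHole

section conf

variable {A B : Finset Pt} {p : ℕ → Pt}

/-- A point in the convex hull of three others. -/
theorem Conf.in_hull (h : Conf A B p) {i j k m : ℕ} (hij : i < j) (hjk : j < k) (hk : k < 5)
    (hm : m < 5) (mi : m ≠ i) (mj : m ≠ j) (mk : m ≠ k) {T : Set Pt}
    (hT : ∀ x ∈ T, x = p i ∨ x = p j ∨ x = p k) (hx : p m ∈ convexHull ℝ T) :
    FiveHole.sIn (PP p) i j k m := by
  have str : ∀ s < 5, ∀ t < 5, s ≠ t → m ≠ s → m ≠ t → 0 ≤ D (p s) (p t) (p m) →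
      PP p s t m := by
    intro s hs t ht hst hs' ht' h0
    exact lt_of_le_of_ne h0
      (h.ne s (by omega) t (by omega) m (by omega) hst hs'.symm ht'.symm).symm
  refine h.sIn hij hjk (by omega) (by omega) ?_
  by_cases ho : PP p i j k
  · left
    refine ⟨str i (by omega) j (by omega) (by omega) mi mj (hull_half (fun x hx => ?_) hx),
      str j (by omega) k (by omega) (by omega) mj mk (hull_half (fun x hx => ?_) hx),
      str k (by omega) i (by omega) (by omega) mk mi (hull_half (fun x hx => ?_) hx)⟩ <;>
    · unfold PP at ho
      rcases hT x hx with rfl | rfl | rfl <;> simp only [D_eq] at ho ⊢ <;> linarith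
  · right
    refine ⟨str j (by omega) i (by omega) (by omega) mj mi (hull_half (fun x hx => ?_) hx),
      str k (by omega) j (by omega) (by omega) mk mj (hull_half (fun x hx => ?_) hx),
      str i (by omega) k (by omega) (by omega) mi mk (hull_half (fun x hx => ?_) hx)⟩ <;>
    · unfold PP at ho
      rcases hT x hx with rfl | rfl | rfl <;> simp only [D_eq] at ho ⊢ <;> linarith

theorem sIn_sub {P : ℕ → ℕ → ℕ → Prop} {i j k m : ℕ} (hij : i < j) (hjk : j < k) (hk : k < 5)
    (h : sIn P i j k m) :
    ∃ a b c d, a < b ∧ b < c ∧ c < d ∧ d < 5 ∧ (sJ P a b c d ∨ sL P a b c d) := by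
  rcases h with ⟨h1, h2, h3⟩ | ⟨h1, h2, h3⟩
  · exact ⟨i, m, j, k, h1, h2, hjk, hk, Or.inl h3⟩
  · exact ⟨i, j, m, k, hij, h1, h2, hk, Or.inr h3⟩

theorem Conf.nonconvex (h : Conf A B p) (hc : A.card = 5) (hA : ¬ ConvexPos (↑A : Set Pt)) :
    ∃ a b c d, a < b ∧ b < c ∧ c < d ∧ d < 5 ∧ (sJ (PP p) a b c d ∨ sL (PP p) a b c d) := by
  classical
  unfold ConvexPos at hA
  push Not at hA
  obtain ⟨x, hxA, hx⟩ := hA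
  rw [convexHull_eq_union] at hx
  simp only [Set.mem_iUnion] at hx
  obtain ⟨t, ht, hi, hx⟩ := hx
  have hcard : t.card ≤ 3 := by
    have h1 := hi.card_le_finrank_succ
    rw [Fintype.card_coe] at h1
    refine h1.trans (Nat.succ_le_succ ((Submodule.finrank_le _).trans ?_))
    simp
  have hts : t ⊆ A.erase x := by
    intro y hy
    have := ht hy
    exact Finset.mem_erase.2 ⟨this.2, this.1⟩
  have hce : (A.erase x).card = 4 := by
    rw [Finset.card_erase_of_mem hxA, hc]
  obtain ⟨s, hts', hsA, hs3⟩ := Finset.exists_subsuperset_card_eq hts hcard (by omega)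
  obtain ⟨y1, y2, y3, n12, n13, n23, rfl⟩ := Finset.card_eq_three.1 hs3
  obtain ⟨m, hm, rfl⟩ := h.coverA x hxA
  have g : ∀ y ∈ ({y1, y2, y3} : Finset Pt), ∃ j < 5, y = p j ∧ m ≠ j := by
    intro y hy
    have := Finset.mem_erase.1 (hsA hy)
    obtain ⟨j, hj, rfl⟩ := h.coverA y this.2
    exact ⟨j, hj, rfl, fun e => this.1 (by rw [e])⟩
  obtain ⟨i, hi5, rfl, mi⟩ := g y1 (by simp)
  obtain ⟨j, hj5, rfl, mj⟩ := g y2 (by simp)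
  obtain ⟨k, hk5, rfl, mk⟩ := g y3 (by simp)
  have hT : ∀ x ∈ (↑t : Set Pt), x = p i ∨ x = p j ∨ x = p k := by
    intro x hx
    simpa using hts' hx
  have kij : i ≠ j := fun e => n12 (by rw [e])
  have kik : i ≠ k := fun e => n13 (by rw [e])
  have kjk : j ≠ k := fun e => n23 (by rw [e])
  have go : ∀ i j k, i < j → j < k → k < 5 → m ≠ i → m ≠ j → m ≠ k →
      (∀ x ∈ (↑t : Set Pt), x = p i ∨ x = p j ∨ x = p k) →
      ∃ a b c d, a < b ∧ b < c ∧ c < d ∧ d < 5 ∧ (sJ (PP p) a b c d ∨ sL (PP p) a b c d) :=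
    fun i j k h1 h2 h3 h4 h5 h6 h7 => sIn_sub h1 h2 h3 (h.in_hull h1 h2 h3 hm h4 h5 h6 h7 hx)
  rcases lt_or_gt_of_ne kij with a1 | a1 <;> rcases lt_or_gt_of_ne kik with a2 | a2 <;>
    rcases lt_or_gt_of_ne kjk with a3 | a3
  · exact go i j k a1 a3 hk5 mi mj mk hT
  · exact go i k j a2 a3 hj5 mi mk mj fun x hx => by have := hT x hx; tauto
  · omega
  · exact go k i j a2 a1 hj5 mk mi mj fun x hx => by have := hT x hx; tauto
  · exact go j i k a1 a2 hk5 mj mi mk fun x hx => by have := hT x hx; tauto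
  · omega
  · exact go j k i a3 a2 hi5 mj mk mi fun x hx => by have := hT x hx; tauto
  · exact go k j i a3 a1 hi5 mk mj mi fun x hx => by have := hT x hx; tauto

/-- Sorting a finite set of points. -/
theorem exists_sort (S : Finset Pt) {n : ℕ} (hn : S.card = n) (f : Pt → ℝ) :
    ∃ g : ℕ → Pt, (∀ i < n, g i ∈ S) ∧ (∀ x ∈ S, ∃ i < n, x = g i) ∧
      (∀ i < n, ∀ j < n, g i = g j → i = j) ∧ (∀ i j, i ≤ j → j < n → f (g i) ≤ f (g j)) := by
  classical
  let e := S.equivFinOfCardEq hn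
  let g0 : Fin n → Pt := fun i => (e.symm i : Pt)
  let σ := Tuple.sort (f ∘ g0)
  have hmono : Monotone ((f ∘ g0) ∘ σ) := Tuple.monotone_sort _
  have key : ∀ i (hi : i < n), (fun i => if h : i < n then g0 (σ ⟨i, h⟩) else 0) i
      = g0 (σ ⟨i, hi⟩) := fun i hi => dif_pos hi
  refine ⟨fun i => if h : i < n then g0 (σ ⟨i, h⟩) else 0, ?_, ?_, ?_, ?_⟩
  · intro i hi
    rw [key i hi]
    exact (e.symm _).2
  · intro x hx
    refine ⟨σ.symm (e ⟨x, hx⟩), (σ.symm (e ⟨x, hx⟩)).2, ?_⟩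
    rw [key _ (σ.symm (e ⟨x, hx⟩)).2]
    simp [g0]
  · intro i hi j hj hij
    rw [key i hi, key j hj] at hij
    have := σ.injective (e.symm.injective (Subtype.ext hij))
    simpa using this
  · intro i j hij hj
    rw [key i (lt_of_le_of_lt hij hj), key j hj]
    exact hmono (by simpa using hij)

end conf

theorem tangent {v : Pt} (hv : v ≠ 0) {c : ℝ} {A B : Finset Pt}
    (hA : ∀ p ∈ A, dotp v p < c) (hB : ∀ p ∈ B, c < dotp v p)
    (hAn : A.Nonempty) (hBn : B.Nonempty) :
    ∃ a ∈ A, ∃ b ∈ B, (∀ x ∈ A, 0 ≤ D a b x) ∧ (∀ y ∈ B, D a b y ≤ 0) := by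
  classical
  let w : Pt → ℝ := fun x => v.1 * x.2 - v.2 * x.1
  obtain ⟨⟨a, b⟩, hab, hmax⟩ := Finset.exists_max_image (A ×ˢ B)
    (fun z => (w z.2 - w z.1) / (dotp v z.2 - dotp v z.1)) (hAn.product hBn)
  obtain ⟨ha, hb⟩ := Finset.mem_product.1 hab
  have hpos : ∀ x ∈ A, ∀ y ∈ B, 0 < dotp v y - dotp v x := by
    intro x hx y hy
    linarith [hA x hx, hB y hy]
  have hcmp : ∀ x ∈ A, ∀ y ∈ B,
      (w y - w x) * (dotp v b - dotp v a) ≤ (w b - w a) * (dotp v y - dotp v x) := by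
    intro x hx y hy
    have := hmax (x, y) (Finset.mem_product.2 ⟨hx, hy⟩)
    rwa [div_le_div_iff₀ (hpos x hx y hy) (hpos a ha b hb)] at this
  have hvv : 0 < v.1 * v.1 + v.2 * v.2 := by
    by_contra hn
    have h1 : v.1 = 0 := by nlinarith [mul_self_nonneg v.1, mul_self_nonneg v.2]
    have h2 : v.2 = 0 := by nlinarith [mul_self_nonneg v.1, mul_self_nonneg v.2]
    exact hv (Prod.ext h1 h2)
  refine ⟨a, ha, b, hb, fun x hx => ?_, fun y hy => ?_⟩
  · have h1 := hcmp x hx b hb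
    have h2 : (v.1 * v.1 + v.2 * v.2) * D a b x
        = (w b - w a) * (dotp v b - dotp v x) - (w b - w x) * (dotp v b - dotp v a) := by
      simp only [D_eq, dotp, w]; ring
    have h3 : 0 ≤ (v.1 * v.1 + v.2 * v.2) * D a b x := by linarith
    exact nonneg_of_mul_nonneg_right h3 hvv
  · have h1 := hcmp a ha y hy
    have h2 : (v.1 * v.1 + v.2 * v.2) * D a b y
        = (w y - w a) * (dotp v b - dotp v a) - (w b - w a) * (dotp v y - dotp v a) := by
      simp only [D_eq, dotp, w]; ring
    have h3 : (v.1 * v.1 + v.2 * v.2) * D a b y ≤ 0 := by linarith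
    by_contra hn
    push Not at hn
    have := mul_pos hvv hn
    linarith

theorem exists_conf {v : Pt} (hv : v ≠ 0) {c : ℝ} {A B : Finset Pt}
    (hA : ∀ p ∈ A, dotp v p < c) (hB : ∀ p ∈ B, c < dotp v p)
    (hgen : GenPos (↑(A ∪ B) : Set Pt))
    (hAcard : A.card = 5) (hBcard : B.card = 6) :
    ∃ p : ℕ → Pt, Conf A B p ∧ (∀ a < 4, PP p a 4 5) ∧ (∀ a < 5, ¬ PP p 4 5 (6 + a)) := by
  classical
  obtain ⟨a, ha, b, hb, hAx, hBy⟩ := tangent hv hA hB (Finset.card_pos.1 (by omega))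
    (Finset.card_pos.1 (by omega))
  have hdis : ∀ x ∈ A, ∀ y ∈ B, x ≠ y := by
    rintro x hx y hy rfl
    linarith [hA x hx, hB x hy]
  have hab := hdis a ha b hb
  obtain ⟨g, gm, gc, gi, gs⟩ := exists_sort (A.erase a) (n := 4)
    (by rw [Finset.card_erase_of_mem ha, hAcard]) (fun x => - D a b x)
  obtain ⟨g', gm', gc', gi', gs'⟩ := exists_sort (B.erase b) (n := 5)
    (by rw [Finset.card_erase_of_mem hb, hBcard]) (fun x => - D a b x)
  let p : ℕ → Pt := fun n => if n < 4 then g n else if n = 4 then a else if n = 5 then b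
    else g' (n - 6)
  have p1 : ∀ n < 4, p n = g n := fun n hn => if_pos hn
  have p4 : p 4 = a := by simp [p]
  have p5 : p 5 = b := by simp [p]
  have p6 : ∀ n, 6 ≤ n → p n = g' (n - 6) := by
    intro n hn
    simp only [p]
    rw [if_neg (by omega), if_neg (by omega), if_neg (by omega)]
  have memA : ∀ j < 5, p j ∈ A := by
    intro j hj
    rcases Nat.lt_or_ge j 4 with h | h
    · rw [p1 j h]; exact Finset.mem_of_mem_erase (gm j h)
    · obtain rfl : j = 4 := by omega
      rw [p4]; exact ha
  have memB : ∀ j < 11, 5 ≤ j → p j ∈ B := by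
    intro j hj hj5
    rcases Nat.lt_or_ge 5 j with h | h
    · rw [p6 j h]; exact Finset.mem_of_mem_erase (gm' _ (by omega))
    · obtain rfl : j = 5 := by omega
      rw [p5]; exact hb
  have coverA : ∀ x ∈ A, ∃ j < 5, x = p j := by
    intro x hx
    by_cases hxa : x = a
    · exact ⟨4, by norm_num, by rw [p4, hxa]⟩
    · obtain ⟨i, hi, e⟩ := gc x (Finset.mem_erase.2 ⟨hxa, hx⟩)
      exact ⟨i, by omega, by rw [p1 i hi, e]⟩
  have coverB : ∀ x ∈ B, ∃ j < 11, x = p j := by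
    intro x hx
    by_cases hxb : x = b
    · exact ⟨5, by norm_num, by rw [p5, hxb]⟩
    · obtain ⟨i, hi, e⟩ := gc' x (Finset.mem_erase.2 ⟨hxb, hx⟩)
      exact ⟨i + 6, by omega, by rw [p6 _ (by omega), e, Nat.add_sub_cancel]⟩
  have inj : ∀ i j, i < j → j < 11 → p i ≠ p j := by
    intro i j hij hj
    rcases Nat.lt_or_ge i 5 with hi | hi
    · rcases Nat.lt_or_ge j 5 with hj' | hj'
      · rw [p1 i (by omega)]
        rcases Nat.lt_or_ge j 4 with h | h
        · rw [p1 j h]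
          intro e
          exact hij.ne (gi i (by omega) j h e)
        · obtain rfl : j = 4 := by omega
          rw [p4]
          exact Finset.ne_of_mem_erase (gm i (by omega))
      · exact hdis _ (memA i hi) _ (memB j hj hj')
    · rw [p6 j (by omega)]
      rcases Nat.lt_or_ge 5 i with h | h
      · rw [p6 i h]
        intro e
        have := gi' _ (by omega) _ (by omega) e
        omega
      · obtain rfl : i = 5 := by omega
        rw [p5]
        exact (Finset.ne_of_mem_erase (gm' _ (by omega))).symm
  have inj' : ∀ i < 11, ∀ j < 11, i ≠ j → p i ≠ p j := by
    intro i hi j hj hij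
    rcases lt_or_gt_of_ne hij with h | h
    · exact inj i j h hj
    · exact (inj j i h hi).symm
  have mem : ∀ j < 11, p j ∈ (↑(A ∪ B) : Set Pt) := by
    intro j hj
    rcases lt_or_ge j 5 with h5 | h5
    · exact Finset.mem_union_left _ (memA j h5)
    · exact Finset.mem_union_right _ (memB j hj h5)
  have ne : ∀ a < 11, ∀ b < 11, ∀ c < 11, a ≠ b → a ≠ c → b ≠ c → D (p a) (p b) (p c) ≠ 0 :=
    fun a ha b hb c hc h1 h2 h3 => D_ne_zero hgen (mem a ha) (mem b hb) (mem c hc)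
      (inj' a ha b hb h1) (inj' a ha c hc h2) (inj' b hb c hc h3)
  have mono : ∀ i j, i < j → j < 11 → - D a b (p i) ≤ - D a b (p j) := by
    intro i j hij hj
    have zA : ∀ x ∈ A, - D a b x ≤ 0 := fun x hx => by linarith [hAx x hx]
    have zB : ∀ x ∈ B, 0 ≤ - D a b x := fun x hx => by linarith [hBy x hx]
    rcases Nat.lt_or_ge i 5 with hi | hi
    · rcases Nat.lt_or_ge j 5 with hj' | hj'
      · rcases Nat.lt_or_ge j 4 with h | h
        · rw [p1 i (by omega), p1 j h]
          exact gs i j hij.le h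
        · obtain rfl : j = 4 := by omega
          rw [p4, D_last, neg_zero]
          exact zA _ (memA i hi)
      · exact (zA _ (memA i hi)).trans (zB _ (memB j hj hj'))
    · rcases Nat.lt_or_ge 5 i with h | h
      · rw [p6 i h, p6 j (by omega)]
        exact gs' _ _ (by omega) (by omega)
      · obtain rfl : i = 5 := by omega
        rw [p5, D_last', neg_zero]
        exact zB _ (memB j hj (by omega))
  have hlin : (b.2 - a.2) ≠ 0 ∨ (a.1 - b.1) ≠ 0 := by
    by_contra hn
    push Not at hn
    exact hab (Prod.ext (by linarith [hn.2]) (by linarith [hn.1]))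
  have mono' : ∀ i j, i < j → j < 11 → (b.2 - a.2) * (p i).1 + (a.1 - b.1) * (p i).2 ≤
      (b.2 - a.2) * (p j).1 + (a.1 - b.1) * (p j).2 := by
    intro i j hij hj
    have := mono i j hij hj
    simp only [D_eq] at this
    linarith
  refine ⟨p, ⟨memA, memB, coverA, ?_, ne, ?_⟩, ?_, ?_⟩
  · intro x hx
    rcases Finset.mem_union.1 hx with h | h
    · obtain ⟨j, hj, e⟩ := coverA x h
      exact ⟨j, by omega, e⟩
    · exact coverB x h
  · intro i j k l hij hjk hkl hl
    exact sig_of hlin (mono' i j hij (by omega)) (mono' j k hjk (by omega)) (mono' k l hkl hl)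
      (ne _ (by omega) _ (by omega) _ (by omega) (by omega) (by omega) (by omega))
      (ne _ (by omega) _ (by omega) _ (by omega) (by omega) (by omega) (by omega))
      (ne _ (by omega) _ (by omega) _ (by omega) (by omega) (by omega) (by omega))
      (ne _ (by omega) _ (by omega) _ (by omega) (by omega) (by omega) (by omega))
  · intro i hi
    rw [← PP_cyc]
    unfold PP
    refine lt_of_le_of_ne ?_ (ne _ (by norm_num) _ (by norm_num) _ (by omega) (by norm_num)
      (by omega) (by omega)).symm
    rw [p4, p5]
    exact hAx _ (memA i (by omega))
  · intro i hi
    unfold PP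
    rw [p4, p5, not_lt]
    exact hBy _ (memB _ (by omega) (by omega))

theorem main {v : Pt} (hv : v ≠ 0) {c : ℝ} {A B : Finset Pt}
    (hA : ∀ p ∈ A, dotp v p < c) (hB : ∀ p ∈ B, c < dotp v p)
    (hgen : GenPos (↑(A ∪ B) : Set Pt))
    (hAcard : A.card = 5) (hBcard : B.card = 6)
    (hAnc : ¬ ConvexPos (↑A : Set Pt)) :
    ∃ H : Finset Pt, DividedFiveHole A B H := by
  obtain ⟨p, hp, h1, h2⟩ := exists_conf hv hA hB hgen hAcard hBcard
  by_contra hno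
  exact comb (PP p) hp.sig
    (fun a b c d e ha hb hc hd he ha5 he5 => hp.pent hno ha hb hc hd he ha5 he5)
    (hp.nonconvex hAcard hAnc) h1 h2

end FiveHole

/-- **Lemma 9.** Let `P = A ∪ B` be an `ℓ`-divided set with `|A| = 5`, `|B| = 6`, and
with `A` not in convex position. Then there is an `ℓ`-divided 5-hole in `P`. -/
theorem lemma_five_six
    (v : Pt) (hv : v ≠ 0) (c : ℝ) (A B : Finset Pt)
    (hA : ∀ p ∈ A, dotp v p < c) (hB : ∀ p ∈ B, c < dotp v p)
    (hgen : GenPos (↑(A ∪ B) : Set Pt))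
    (hAcard : A.card = 5) (hBcard : B.card = 6)
    (hAnc : ¬ ConvexPos (↑A : Set Pt)) :
    ∃ H : Finset Pt, DividedFiveHole A B H := by
  exact FiveHole.main hv hA hB hgen hAcard hBcard hAnc

end
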